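/- Let k ≥ 2, let F be a fixed k-uniform hypergraph with |V(F)| > k, and let q ≤ |E(F)| with |V(F)| - k not divisible by |E(F)| - q + 1. Then for every k-uniform hypergraph G on n vertices, r_ℓ(G, F, q) = O((n^{|V(F)|-k}/log n)^{1/(|E(F)|-q+1)}). -/

import Mathlib

/-- `ι : Fin f ↪ Fin n` is a copy of the `k`-uniform hypergraph `F` (vertex set `Fin f`,
edge set `Fe`) in `G` if it maps edges of `F` to edges of `G`. -/
def IsCopy {f n : ℕ} (Fe : Finset (Finset (Fin f))) (G : Finset (Finset (Fin n)))
    (ι : Fin f ↪ Fin n) : Prop :=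
  ∀ e ∈ Fe, e.map ι ∈ G

/-- `φ` is an `(F,q)`-coloring of `G`: every copy of `F` in `G` receives at least `q`
colors. -/
def IsFQColoring {f n : ℕ} (Fe : Finset (Finset (Fin f))) (G : Finset (Finset (Fin n)))
    (q : ℕ) (φ : Finset (Fin n) → ℕ) : Prop :=
  ∀ ι : Fin f ↪ Fin n, IsCopy Fe G ι →
    q ≤ ((Fe.image (fun e => e.map ι)).image φ).card

/-- The generalized list Ramsey number `r_ℓ(G, F, q)`. -/
noncomputable def listRamseyF {f : ℕ} (Fe : Finset (Finset (Fin f))) (q n : ℕ)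
    (G : Finset (Finset (Fin n))) : ℕ :=
  sInf {t | ∀ L : Finset (Fin n) → Finset ℕ, (∀ e ∈ G, t ≤ (L e).card) →
    ∃ φ : Finset (Fin n) → ℕ, (∀ e ∈ G, φ e ∈ L e) ∧ IsFQColoring Fe G q φ}

set_option linter.unusedSectionVars false
set_option linter.unusedVariables false

def vs {E C : Type} [DecidableEq E] (S : Finset (E × C)) : Finset E := S.image Prod.fst

theorem mem_vs {E C : Type} [DecidableEq E] {S : Finset (E × C)} {e : E} :
    e ∈ vs S ↔ ∃ c, (e, c) ∈ S := by
  simp [vs]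

theorem mem_vs_of {E C : Type} [DecidableEq E] {S : Finset (E × C)} {x : E × C} (h : x ∈ S) :
    x.1 ∈ vs S := Finset.mem_image_of_mem _ h

def Link {E C : Type} [DecidableEq E] (Sf : Finset (Finset (E × C))) (v w : E)
    (S1 : Finset (E × C)) (x : E) (S2 : Finset (E × C)) : Prop :=
  S1 ∈ Sf ∧ S2 ∈ Sf ∧ v ∈ vs S1 ∧ x ∈ vs S1 ∧ x ≠ v ∧
    ((x = w ∧ S2 = S1) ∨ (x ≠ w ∧ S1 ≠ S2 ∧ x ∈ vs S2 ∧ w ∈ vs S2))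

noncomputable def Yf {E C : Type} [DecidableEq E] [DecidableEq C] (Sf : Finset (Finset (E × C)))
    (y : E × C → ℝ) (p : E × C) : ℝ :=
  ∑ S ∈ Sf.filter (fun S => p ∈ S), ∏ z ∈ S.erase p, y z

noncomputable def zf (K L a Y : ℝ) : ℝ :=
  (K * a / 4) * max 0 (1 - (Y + Real.log (K * a / 4)) / L)

theorem zf_nonneg {K L a Y : ℝ} (hK : 0 < K) (ha : 0 ≤ a) : 0 ≤ zf K L a Y := by
  unfold zf; positivity

theorem zf_le {K L a Y : ℝ} (hK : 0 < K) (hL : 0 < L) (ha : a = 0 ∨ 4 / K ≤ a) (hY : 0 ≤ Y) :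
    zf K L a Y ≤ Real.exp L := by
  unfold zf
  rcases ha with rfl | ha
  · simp; positivity
  · have h1 : 1 ≤ K * a / 4 := by
      rw [div_le_iff₀ hK] at ha; linarith
    have hlog := Real.log_nonneg h1
    rcases le_or_gt (1 - (Y + Real.log (K * a / 4)) / L) 0 with h | h
    · rw [max_eq_left h]; simp; positivity
    · rw [max_eq_right h.le]
      have h2 : (Y + Real.log (K * a / 4)) / L < 1 := by linarith
      rw [div_lt_one hL] at h2
      have h3 : K * a / 4 ≤ Real.exp L := by
        rw [← Real.log_le_iff_le_exp (by linarith)]; linarith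
      have h4 : 0 ≤ (Y + Real.log (K * a / 4)) / L := by positivity
      calc _ ≤ (K * a / 4) * 1 := by
            apply mul_le_mul_of_nonneg_left _ (by linarith); linarith
        _ ≤ _ := by linarith

/-- convexity step -/
theorem zf_avg {C : Type} {K L a Y : ℝ} (hK : 0 < K) (hL : 0 < L) (ha : 0 ≤ a) (s : Finset C)
    (q : C → ℝ) (hq : ∀ d ∈ s, 0 ≤ q d) (hq1 : ∑ d ∈ s, q d = 1) (Y' : C → ℝ)
    (hY : ∑ d ∈ s, q d * Y' d ≤ Y) :
    zf K L a Y ≤ ∑ d ∈ s, q d * zf K L a (Y' d) := by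
  unfold zf
  have hu : 0 ≤ K * a / 4 := by positivity
  have e1 : ∑ d ∈ s, q d * (K * a / 4 * max 0 (1 - (Y' d + Real.log (K * a / 4)) / L)) =
      (K * a / 4) * ∑ d ∈ s, q d * max 0 (1 - (Y' d + Real.log (K * a / 4)) / L) := by
    rw [Finset.mul_sum]; apply Finset.sum_congr rfl; intros; ring
  rw [e1]
  apply mul_le_mul_of_nonneg_left _ hu
  apply max_le
  · apply Finset.sum_nonneg; intro d hd; have := hq d hd; positivity
  · have e2 : ∑ d ∈ s, q d * (1 - (Y' d + Real.log (K * a / 4)) / L) =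
      (∑ d ∈ s, q d) - (∑ d ∈ s, q d * Y' d) / L - (∑ d ∈ s, q d) * (Real.log (K * a / 4) / L) := by
      rw [Finset.sum_div, Finset.sum_mul, ← Finset.sum_sub_distrib, ← Finset.sum_sub_distrib]
      apply Finset.sum_congr rfl; intros; ring
    calc 1 - (Y + Real.log (K * a / 4)) / L ≤ ∑ d ∈ s, q d * (1 - (Y' d + Real.log (K * a / 4)) / L) := by
          rw [e2, hq1]
          have := div_le_div_of_nonneg_right hY hL.le
          rw [add_div]; linarith
      _ ≤ _ := by
          apply Finset.sum_le_sum; intro d hd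
          exact mul_le_mul_of_nonneg_left (le_max_right _ _) (hq d hd)

/-- pair step -/
theorem zf_pair {K L a Y κ b : ℝ} (hK : 0 < K) (hL : 0 < L) (ha : 0 ≤ a) (hκ : 0 ≤ κ)
    (hκ2 : κ ≤ 1 / 2) (hb : 2 * κ ≤ b) :
    zf K L a Y ≤ (1 - κ) * zf K L (a * (1 / (1 - κ))) (Y - b) := by
  rcases ha.eq_or_lt with rfl | ha
  · simp [zf]
  unfold zf
  have h1 : 0 < 1 - κ := by linarith
  have hu : 0 < K * a / 4 := by positivity
  have e1 : K * (a * (1 / (1 - κ))) / 4 = (K * a / 4) / (1 - κ) := by field_simp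
  rw [e1, ← mul_assoc, mul_div_cancel₀ _ h1.ne']
  apply mul_le_mul_of_nonneg_left _ hu.le
  apply max_le_max le_rfl
  rw [Real.log_div hu.ne' h1.ne']
  have hlog : -(2 * κ) ≤ Real.log (1 - κ) := by
    have := Real.one_sub_inv_le_log_of_pos h1
    have h3 : (1 - κ)⁻¹ ≤ 1 + 2 * κ := by
      rw [inv_le_iff_one_le_mul₀ h1]; nlinarith
    linarith
  have : (Y - b + (Real.log (K * a / 4) - Real.log (1 - κ))) / L ≤ (Y + Real.log (K * a / 4)) / L := by
    apply div_le_div_of_nonneg_right _ hL.le; linarith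
  linarith

def Chosen {E C : Type} (y : E × C → ℝ) (Dn : Finset E) (z : E × C) : Prop := z.1 ∈ Dn ∧ y z = 1

def Prr {E C : Type} (Sf : Finset (Finset (E × C))) (y : E × C → ℝ) (Dn : Finset E) (w : E)
    (x : E × C) (d : C) : Prop :=
  ∃ S ∈ Sf, x ∈ S ∧ (w, d) ∈ S ∧ ∀ z ∈ S, z ≠ x → z ≠ (w, d) → Chosen y Dn z

open Classical in
noncomputable def facf {E C : Type} (Sf : Finset (Finset (E × C))) (y : E × C → ℝ) (Dn : Finset E)
    (w : E) (q : C → ℝ) (x : E × C) (d0 : C) : ℝ :=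
  if Prr Sf y Dn w x d0 then 0 else
    if h : ∃ d, Prr Sf y Dn w x d then 1 / (1 - q h.choose) else 1

open Classical in
noncomputable def ynew {E C : Type} (Sf : Finset (Finset (E × C))) (y : E × C → ℝ) (Dn : Finset E)
    (w : E) (q : C → ℝ) (d0 : C) (x : E × C) : ℝ :=
  if x.1 = w then (if x.2 = d0 then 1 else 0) else if x.1 ∈ Dn then y x else y x * facf Sf y Dn w q x d0

def Functional {E C : Type} (S : Finset (E × C)) : Prop := ∀ e c c', (e, c) ∈ S → (e, c') ∈ S → c = c'

def LinkU {E C : Type} [DecidableEq E] (Sf : Finset (Finset (E × C))) : Prop :=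
  ∀ v w S1 x S2 S1' x' S2', v ≠ w → Link Sf v w S1 x S2 → Link Sf v w S1' x' S2' →
    S1 = S1' ∧ x = x' ∧ S2 = S2'

theorem link_of_prr {E C : Type} [DecidableEq E] {Sf : Finset (Finset (E × C))}
    {w : E} {x : E × C} {S : Finset (E × C)} {d : C} (hS : S ∈ Sf) (hx : x ∈ S) (hw : (w, d) ∈ S)
    (hxw : x.1 ≠ w) : Link Sf x.1 w S w S :=
  ⟨hS, hS, mem_vs_of hx, mem_vs_of hw, fun h => hxw h.symm, Or.inl ⟨rfl, rfl⟩⟩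

theorem prr_unique {E C : Type} [DecidableEq E] {Sf : Finset (Finset (E × C))}
    (hfun : ∀ S ∈ Sf, Functional S) (hU : LinkU Sf) {y : E × C → ℝ} {Dn : Finset E}
    {w : E} {x : E × C} {d d' : C} (hxw : x.1 ≠ w) (h : Prr Sf y Dn w x d) (h' : Prr Sf y Dn w x d') :
    d = d' := by
  obtain ⟨S, hS, hx, hw, -⟩ := h
  obtain ⟨S', hS', hx', hw', -⟩ := h'
  have := hU _ _ _ _ _ _ _ _ hxw (link_of_prr hS hx hw hxw) (link_of_prr hS' hx' hw' hxw)
  obtain ⟨rfl, -, -⟩ := this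
  exact hfun _ hS _ _ _ hw hw'

theorem facf_of {E C : Type} [DecidableEq E] [DecidableEq C] {Sf : Finset (Finset (E × C))}
    (hfun : ∀ S ∈ Sf, Functional S) (hU : LinkU Sf) {y : E × C → ℝ} {Dn : Finset E}
    {w : E} {q : C → ℝ} {x : E × C} {d : C} (hxw : x.1 ≠ w) (h : Prr Sf y Dn w x d) (d0 : C) :
    facf Sf y Dn w q x d0 = if d0 = d then 0 else 1 / (1 - q d) := by
  unfold facf
  split_ifs with h1 h2 h3 h4 h5
  · rfl
  · exact absurd (prr_unique hfun hU hxw h1 h) h2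
  · subst h4; exact absurd h h1
  · rw [prr_unique hfun hU hxw h3.choose_spec h]
  · exact absurd ⟨d, h⟩ h3
  · exact absurd ⟨d, h⟩ h3

theorem facf_not {E C : Type} {Sf : Finset (Finset (E × C))}
    {y : E × C → ℝ} {Dn : Finset E}
    {w : E} {q : C → ℝ} {x : E × C}  (h : ¬ ∃ d, Prr Sf y Dn w x d) (d0 : C) :
    facf Sf y Dn w q x d0 = 1 := by
  unfold facf
  rw [if_neg (fun h' => h ⟨_, h'⟩), dif_neg h]

theorem facf_avg {E C : Type} [DecidableEq E] [DecidableEq C] {Sf : Finset (Finset (E × C))}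
    (hfun : ∀ S ∈ Sf, Functional S) (hU : LinkU Sf) {y : E × C → ℝ} {Dn : Finset E}
    {w : E} {q : C → ℝ} {x : E × C} (hxw : x.1 ≠ w) (s : Finset C) (hq1 : ∑ d ∈ s, q d = 1)
    (hqs : ∀ d ∉ s, q d = 0) (hqh : ∀ d, q d ≤ 1 / 2) :
    ∑ d0 ∈ s, q d0 * facf Sf y Dn w q x d0 = 1 := by
  by_cases h : ∃ d, Prr Sf y Dn w x d
  · obtain ⟨d, hd⟩ := h
    have h1 : ∀ d0 ∈ s, q d0 * facf Sf y Dn w q x d0 =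
        (q d0 - if d0 = d then q d0 else 0) * (1 / (1 - q d)) := by
      intro d0 _
      rw [facf_of hfun hU hxw hd]
      split_ifs <;> ring
    rw [Finset.sum_congr rfl h1, ← Finset.sum_mul, Finset.sum_sub_distrib, hq1, Finset.sum_ite_eq']
    have : (if d ∈ s then q d else 0) = q d := by
      split_ifs with hds
      · rfl
      · rw [hqs d hds]
    rw [this]
    have := hqh d
    field_simp
    rw [div_self]; linarith
  · simp only [facf_not h, mul_one, hq1]

theorem facf_cases {E C : Type} [DecidableEq E] [DecidableEq C] {Sf : Finset (Finset (E × C))}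
    {y : E × C → ℝ} {Dn : Finset E}
    {w : E} {q : C → ℝ} {x : E × C} (hq0 : ∀ d, 0 ≤ q d) (hqh : ∀ d, q d ≤ 1 / 2) (d0 : C) :
    facf Sf y Dn w q x d0 = 0 ∨ 1 ≤ facf Sf y Dn w q x d0 := by
  unfold facf
  split_ifs with h1 h2
  · exact Or.inl rfl
  · right
    have := hqh h2.choose
    have := hq0 h2.choose
    rw [le_div_iff₀ (by linarith)]; linarith
  · right; exact le_rfl

/-- a change at `z` produces a link -/
theorem link_of_change {E C : Type} [DecidableEq E] [DecidableEq C] {Sf : Finset (Finset (E × C))}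
    (hfun : ∀ S ∈ Sf, Functional S) {y : E × C → ℝ} {Dn : Finset E}
    {v w : E} {q : C → ℝ} {c : C} (hvw : v ≠ w) (hv : v ∉ Dn) {S : Finset (E × C)} (hS : S ∈ Sf)
    (hvS : (v, c) ∈ S) {z : E × C} (hz : z ∈ S.erase (v, c)) {d0 : C}
    (hch : ynew Sf y Dn w q d0 z ≠ y z) : ∃ S2, Link Sf v w S z.1 S2 := by
  obtain ⟨hzne, hzS⟩ := Finset.mem_erase.1 hz
  have hzv : z.1 ≠ v := by
    intro h
    apply hzne
    obtain ⟨z1, z2⟩ := z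
    simp only at h; subst h
    rw [hfun S hS _ _ _ hzS hvS]
  by_cases hzw : z.1 = w
  · exact ⟨S, hS, hS, mem_vs_of hvS, mem_vs_of hzS, hzv, Or.inl ⟨hzw, rfl⟩⟩
  · unfold ynew at hch
    rw [if_neg hzw] at hch
    split_ifs at hch with h1
    · exact absurd rfl hch
    · by_cases h : ∃ d, Prr Sf y Dn w z d
      · obtain ⟨d, S2, hS2, hz2, hw2, hall⟩ := h
        refine ⟨S2, hS, hS2, mem_vs_of hvS, mem_vs_of hzS, hzv, Or.inr ⟨hzw, ?_, mem_vs_of hz2, mem_vs_of hw2⟩⟩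
        rintro rfl
        exact hv (hall _ hvS (fun h => hzv (by rw [← h])) (fun h => hvw (by simpa using congrArg Prod.fst h))).1
      · rw [facf_not h, mul_one] at hch; exact absurd rfl hch

theorem Yf_nonneg {E C : Type} [DecidableEq E] [DecidableEq C] {Sf : Finset (Finset (E × C))}
    {y : E × C → ℝ} (hy : ∀ z, 0 ≤ y z) (p : E × C) : 0 ≤ Yf Sf y p :=
  Finset.sum_nonneg fun _ _ => Finset.prod_nonneg fun _ _ => hy _

noncomputable def Phi {E C : Type} [DecidableEq E] [DecidableEq C] (Sf : Finset (Finset (E × C)))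
    (P : E → Finset C) (K L η : ℝ) (y : E × C → ℝ) (v : E) : ℝ :=
  ∏ c ∈ P v, (1 - η * zf K L (y (v, c)) (Yf Sf y (v, c)))

theorem ynew_undone {E C : Type} [DecidableEq E] [DecidableEq C] {Sf : Finset (Finset (E × C))}
    {y : E × C → ℝ} {Dn : Finset E} {w : E} {q : C → ℝ} {d0 : C} {z : E × C} (hzw : z.1 ≠ w) (hz : z.1 ∉ Dn) :
    ynew Sf y Dn w q d0 z = y z * facf Sf y Dn w q z d0 := by
  unfold ynew; rw [if_neg hzw, if_neg hz]

theorem ynew_avg {E C : Type} [DecidableEq E] [DecidableEq C] {Sf : Finset (Finset (E × C))}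
    (hfun : ∀ S ∈ Sf, Functional S) (hU : LinkU Sf) {y : E × C → ℝ} {Dn : Finset E}
    {w : E} {q : C → ℝ} (s : Finset C) (hq1 : ∑ d ∈ s, q d = 1) (hq0 : ∀ d, 0 ≤ q d)
    (hqs : ∀ d ∉ s, q d = 0) (hqh : ∀ d, q d ≤ 1 / 2) (hqy : ∀ d, 2 * q d ≤ y (w, d)) (z : E × C) :
    ∑ d0 ∈ s, q d0 * ynew Sf y Dn w q d0 z ≤ y z := by
  by_cases hzw : z.1 = w
  · have h1 : ∀ d0 ∈ s, q d0 * ynew Sf y Dn w q d0 z = if d0 = z.2 then q d0 else 0 := by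
      intro d0 _
      unfold ynew; rw [if_pos hzw]
      by_cases h : d0 = z.2
      · rw [if_pos h, if_pos h.symm]; ring
      · rw [if_neg h, if_neg (fun h' => h h'.symm)]; ring
    rw [Finset.sum_congr rfl h1, Finset.sum_ite_eq']
    have h2 : y z = y (w, z.2) := by rw [← hzw]
    have := hqy z.2
    have := hq0 z.2
    split_ifs <;> linarith
  · by_cases hz : z.1 ∈ Dn
    · have h1 : ∀ d0 ∈ s, q d0 * ynew Sf y Dn w q d0 z = q d0 * y z := by
        intro d0 _
        unfold ynew; rw [if_neg hzw, if_pos hz]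
      rw [Finset.sum_congr rfl h1, ← Finset.sum_mul, hq1, one_mul]
    · have h1 : ∀ d0 ∈ s, q d0 * ynew Sf y Dn w q d0 z = y z * (q d0 * facf Sf y Dn w q z d0) := by
        intro d0 _
        rw [ynew_undone hzw hz]; ring
      rw [Finset.sum_congr rfl h1, ← Finset.mul_sum, facf_avg hfun hU hzw s hq1 hqs hqh, mul_one]

theorem Yf_congr {E C : Type} [DecidableEq E] [DecidableEq C] {Sf : Finset (Finset (E × C))}
    {y y' : E × C → ℝ} {p : E × C} (h : ∀ S ∈ Sf, p ∈ S → ∀ z ∈ S.erase p, y' z = y z) :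
    Yf Sf y' p = Yf Sf y p := by
  unfold Yf
  apply Finset.sum_congr rfl
  intro S hS
  rw [Finset.mem_filter] at hS
  exact Finset.prod_congr rfl (h S hS.1 hS.2)

theorem Yf_congr1 {E C : Type} [DecidableEq E] [DecidableEq C] {Sf : Finset (Finset (E × C))}
    {y y' : E × C → ℝ} {p : E × C} {S1 : Finset (E × C)} {z1 : E × C} (hS1 : S1 ∈ Sf) (hp : p ∈ S1)
    (hz1 : z1 ∈ S1.erase p)
    (h : ∀ S ∈ Sf, p ∈ S → ∀ z ∈ S.erase p, (S = S1 ∧ z = z1) ∨ y' z = y z) :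
    Yf Sf y' p = Yf Sf y p + (y' z1 - y z1) * ∏ z ∈ (S1.erase p).erase z1, y z := by
  unfold Yf
  have hm : S1 ∈ Sf.filter (fun S => p ∈ S) := Finset.mem_filter.2 ⟨hS1, hp⟩
  rw [← Finset.add_sum_erase _ _ hm, ← Finset.add_sum_erase _ (fun S => ∏ z ∈ S.erase p, y z) hm]
  rw [← Finset.mul_prod_erase _ _ hz1, ← Finset.mul_prod_erase _ y hz1]
  have e1 : ∏ z ∈ (S1.erase p).erase z1, y' z = ∏ z ∈ (S1.erase p).erase z1, y z := by
    apply Finset.prod_congr rfl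
    intro z hz
    rw [Finset.mem_erase] at hz
    rcases h S1 hS1 hp z hz.2 with h | h
    · exact absurd h.2 hz.1
    · exact h
  have e2 : ∑ S ∈ (Sf.filter (fun S => p ∈ S)).erase S1, ∏ z ∈ S.erase p, y' z =
     ∑ S ∈ (Sf.filter (fun S => p ∈ S)).erase S1, ∏ z ∈ S.erase p, y z := by
    apply Finset.sum_congr rfl
    intro S hS
    rw [Finset.mem_erase, Finset.mem_filter] at hS
    apply Finset.prod_congr rfl
    intro z hz
    rcases h S hS.2.1 hS.2.2 z hz with h | h
    · exact absurd h.1 hS.1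
    · exact h
  rw [e1, e2]; ring

theorem phi_step {E C : Type} [DecidableEq E] [DecidableEq C] {Sf : Finset (Finset (E × C))}
    {P : E → Finset C} {K L η : ℝ} (hK : 0 < K) (hL : 0 < L) (hη : 0 ≤ η) (hηL : η * Real.exp L ≤ 1)
    (hfun : ∀ S ∈ Sf, Functional S) (hU : LinkU Sf) {y : E × C → ℝ} {Dn : Finset E}
    (hy0 : ∀ z, 0 ≤ y z) (hyu : ∀ z, z.1 ∉ Dn → y z = 0 ∨ 4 / K ≤ y z)
    {v w : E} (hvw : v ≠ w) (hv : v ∉ Dn)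
    {q : C → ℝ} (s : Finset C) (hq1 : ∑ d ∈ s, q d = 1) (hq0 : ∀ d, 0 ≤ q d)
    (hqs : ∀ d ∉ s, q d = 0) (hqh : ∀ d, q d ≤ 1 / 2) (hqy : ∀ d, 2 * q d ≤ y (w, d)) :
    ∑ d0 ∈ s, q d0 * Phi Sf P K L η (ynew Sf y Dn w q d0) v ≤ Phi Sf P K L η y v := by
  have hfac : ∀ c, 0 ≤ 1 - η * zf K L (y (v, c)) (Yf Sf y (v, c)) := by
    intro c
    have := zf_le hK hL (hyu (v, c) hv) (Yf_nonneg (Sf := Sf) hy0 (v, c))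
    have := mul_le_mul_of_nonneg_left this hη
    linarith
  by_cases hlink : ∃ S1 x S2, Link Sf v w S1 x S2
  swap
  · have h1 : ∀ d0 ∈ s, q d0 * Phi Sf P K L η (ynew Sf y Dn w q d0) v = q d0 * Phi Sf P K L η y v := by
      intro d0 _
      congr 1
      unfold Phi
      apply Finset.prod_congr rfl
      intro c _
      have e1 : ynew Sf y Dn w q d0 (v, c) = y (v, c) := by
        rw [ynew_undone (by exact hvw) (by exact hv), facf_not, mul_one]
        rintro ⟨d, S, hS, hx, hw, -⟩
        exact hlink ⟨_, _, _, link_of_prr hS hx hw hvw⟩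
      have e2 : Yf Sf (ynew Sf y Dn w q d0) (v, c) = Yf Sf y (v, c) := by
        apply Yf_congr
        intro S hS hp z hz
        by_contra hne
        obtain ⟨S2, h2⟩ := link_of_change hfun hvw hv hS hp hz hne
        exact hlink ⟨_, _, _, h2⟩
      rw [e1, e2]
    rw [Finset.sum_congr rfl h1, ← Finset.sum_mul, hq1, one_mul]
  obtain ⟨S1, x, S2, hl⟩ := hlink
  have hS1 := hl.1
  obtain ⟨c1, hc1⟩ := mem_vs.1 hl.2.2.1
  obtain ⟨cx, hcx⟩ := mem_vs.1 hl.2.2.2.1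
  have hxv := hl.2.2.2.2.1
  have huniq : ∀ S x' S', Link Sf v w S x' S' → S = S1 ∧ x' = x ∧ S' = S2 := fun S x' S' h =>
    hU _ _ _ _ _ _ _ _ hvw h hl
  have hzx : (x, cx) ∈ S1.erase (v, c1) := by
    rw [Finset.mem_erase]; exact ⟨fun h => hxv (by simpa using congrArg Prod.fst h), hcx⟩
  -- changes
  have hchange : ∀ d0 c, ∀ S ∈ Sf, (v, c) ∈ S → ∀ z ∈ S.erase (v, c),
      (S = S1 ∧ z = (x, cx)) ∨ ynew Sf y Dn w q d0 z = y z := by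
    intro d0 c S hS hp z hz
    by_contra hne
    push Not at hne
    obtain ⟨S2', h2⟩ := link_of_change hfun hvw hv hS hp hz hne.2
    obtain ⟨rfl, h3, -⟩ := huniq _ _ _ h2
    apply hne.1 rfl
    obtain ⟨z1, z2⟩ := z
    simp only at h3; subst h3
    rw [hfun S hS _ _ _ (Finset.mem_of_mem_erase hz) hcx]
  have hother : ∀ d0 c, c ≠ c1 → ynew Sf y Dn w q d0 (v, c) = y (v, c) ∧
      Yf Sf (ynew Sf y Dn w q d0) (v, c) = Yf Sf y (v, c) := by
    intro d0 c hc
    constructor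
    · rw [ynew_undone (by exact hvw) (by exact hv), facf_not, mul_one]
      rintro ⟨d, S, hS, hx, hw, -⟩
      obtain ⟨rfl, -, -⟩ := huniq _ _ _ (link_of_prr hS hx hw hvw)
      exact hc (hfun S hS _ _ _ hx hc1)
    · apply Yf_congr
      intro S hS hp z hz
      rcases hchange d0 c S hS hp z hz with h | h
      · obtain ⟨rfl, -⟩ := h
        exact absurd (hfun S hS _ _ _ hp hc1) hc
      · exact h
  by_cases hcP : c1 ∈ P v
  swap
  · have h1 : ∀ d0 ∈ s, q d0 * Phi Sf P K L η (ynew Sf y Dn w q d0) v = q d0 * Phi Sf P K L η y v := by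
      intro d0 _
      congr 1
      unfold Phi
      apply Finset.prod_congr rfl
      intro c hc
      have := hother d0 c (fun h => hcP (h ▸ hc))
      rw [this.1, this.2]
    rw [Finset.sum_congr rfl h1, ← Finset.sum_mul, hq1, one_mul]
  have hYd : ∀ d0, Yf Sf (ynew Sf y Dn w q d0) (v, c1) = Yf Sf y (v, c1) +
      (ynew Sf y Dn w q d0 (x, cx) - y (x, cx)) * ∏ z ∈ (S1.erase (v, c1)).erase (x, cx), y z := fun d0 =>
    Yf_congr1 hS1 hc1 hzx (hchange d0 c1)
  -- main inequality
  have key : zf K L (y (v, c1)) (Yf Sf y (v, c1)) ≤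
      ∑ d0 ∈ s, q d0 * zf K L (ynew Sf y Dn w q d0 (v, c1)) (Yf Sf (ynew Sf y Dn w q d0) (v, c1)) := by
    by_cases hpr : ∃ d, Prr Sf y Dn w (v, c1) d
    · obtain ⟨d, hd⟩ := hpr
      have hd' := hd
      obtain ⟨S, hS, hx, hw, hall⟩ := hd'
      obtain ⟨rfl, rfl, -⟩ := huniq _ _ _ (link_of_prr hS hx hw hvw)
      have hdc := hfun S hS _ _ _ hw hcx
      subst hdc
      have hprod : ∏ z ∈ (S.erase (v, c1)).erase (w, d), y z = 1 := by
        apply Finset.prod_eq_one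
        intro z hz
        simp only [Finset.mem_erase] at hz
        exact (hall z hz.2.2 hz.2.1 hz.1).2
      have h1 : ∀ d0 ∈ s, q d0 * zf K L (ynew Sf y Dn w q d0 (v, c1)) (Yf Sf (ynew Sf y Dn w q d0) (v, c1))
          = (q d0 - if d0 = d then q d0 else 0) *
            zf K L (y (v, c1) * (1 / (1 - q d))) (Yf Sf y (v, c1) - y (w, d)) := by
        intro d0 _
        rw [ynew_undone (by exact hvw) (by exact hv), facf_of hfun hU (by exact hvw) hd, hYd d0, hprod]
        by_cases h : d0 = d
        · rw [if_pos h, if_pos h]; simp [zf]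
        · rw [if_neg h, if_neg h, sub_zero]
          have : ynew Sf y Dn w q d0 (w, d) = 0 := by
            unfold ynew; rw [if_pos rfl, if_neg (fun h' => h h'.symm)]
          rw [this]
          congr 2; ring
      rw [Finset.sum_congr rfl h1, ← Finset.sum_mul, Finset.sum_sub_distrib, hq1, Finset.sum_ite_eq']
      have : (if d ∈ s then q d else 0) = q d := by
        split_ifs with hds
        · rfl
        · rw [hqs d hds]
      rw [this]
      exact zf_pair hK hL (hy0 _) (hq0 d) (hqh d) (hqy d)
    · have e1 : ∀ d0, ynew Sf y Dn w q d0 (v, c1) = y (v, c1) := by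
        intro d0
        rw [ynew_undone (by exact hvw) (by exact hv), facf_not hpr, mul_one]
      simp only [e1]
      apply zf_avg hK hL (hy0 _) s q (fun d _ => hq0 d) hq1
      have hρ : 0 ≤ ∏ z ∈ (S1.erase (v, c1)).erase (x, cx), y z := Finset.prod_nonneg fun _ _ => hy0 _
      have h1 : ∀ d0 ∈ s, q d0 * Yf Sf (ynew Sf y Dn w q d0) (v, c1) =
          q d0 * (Yf Sf y (v, c1) - y (x, cx) * ∏ z ∈ (S1.erase (v, c1)).erase (x, cx), y z) +
          (q d0 * ynew Sf y Dn w q d0 (x, cx)) * ∏ z ∈ (S1.erase (v, c1)).erase (x, cx), y z := by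
        intro d0 _
        rw [hYd d0]; ring
      rw [Finset.sum_congr rfl h1, Finset.sum_add_distrib, ← Finset.sum_mul, ← Finset.sum_mul, hq1]
      have h2 := ynew_avg (Dn := Dn) hfun hU s hq1 hq0 hqs hqh hqy (x, cx)
      have := mul_le_mul_of_nonneg_right h2 hρ
      linarith
  have h2 : ∀ d0 ∈ s, q d0 * Phi Sf P K L η (ynew Sf y Dn w q d0) v =
      (q d0 - η * (q d0 * zf K L (ynew Sf y Dn w q d0 (v, c1)) (Yf Sf (ynew Sf y Dn w q d0) (v, c1)))) *
      ∏ c ∈ (P v).erase c1, (1 - η * zf K L (y (v, c)) (Yf Sf y (v, c))) := by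
    intro d0 _
    unfold Phi
    rw [← Finset.mul_prod_erase _ _ hcP]
    have : ∏ c ∈ (P v).erase c1, (1 - η * zf K L (ynew Sf y Dn w q d0 (v, c)) (Yf Sf (ynew Sf y Dn w q d0) (v, c)))
        = ∏ c ∈ (P v).erase c1, (1 - η * zf K L (y (v, c)) (Yf Sf y (v, c))) := by
      apply Finset.prod_congr rfl
      intro c hc
      have := hother d0 c (Finset.ne_of_mem_erase hc)
      rw [this.1, this.2]
    rw [this]; ring
  rw [Finset.sum_congr rfl h2, ← Finset.sum_mul, Finset.sum_sub_distrib, hq1, ← Finset.mul_sum]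
  unfold Phi
  rw [← Finset.mul_prod_erase _ _ hcP]
  apply mul_le_mul_of_nonneg_right _ (Finset.prod_nonneg fun _ _ => hfac _)
  have := mul_le_mul_of_nonneg_left key hη
  linarith

structure StInv {E C : Type} [Fintype E] [DecidableEq E] [DecidableEq C] (Sf : Finset (Finset (E × C)))
    (P : E → Finset C) (K L η T : ℝ) (y : E × C → ℝ) (Dn : Finset E) : Prop where
  done : ∀ e ∈ Dn, ∃ c ∈ P e, y (e, c) = 1 ∧ ∀ c', c' ≠ c → y (e, c') = 0
  und : ∀ z : E × C, z.1 ∉ Dn → y z = 0 ∨ 4 / K ≤ y z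
  sup : ∀ e c, y (e, c) ≠ 0 → c ∈ P e
  kill : ∀ S ∈ Sf, ∀ x ∈ S, x.1 ∉ Dn → (∀ z ∈ S, z ≠ x → Chosen y Dn z) → y x = 0
  free : ∀ S ∈ Sf, ¬ ∀ z ∈ S, Chosen y Dn z
  pot : ∑ v ∈ Finset.univ \ Dn, Phi Sf P K L η y v < T

theorem StInv.nonneg {E C : Type} [Fintype E] [DecidableEq E] [DecidableEq C] {Sf : Finset (Finset (E × C))}
    {P : E → Finset C} {K L η T : ℝ} {y : E × C → ℝ} {Dn : Finset E} (hK : 0 < K)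
    (h : StInv Sf P K L η T y Dn) (z : E × C) : 0 ≤ y z := by
  by_cases hz : z.1 ∈ Dn
  · obtain ⟨c, -, h1, h2⟩ := h.done _ hz
    by_cases hc : z.2 = c
    · subst hc; rw [show z = (z.1, z.2) from rfl, h1]; norm_num
    · rw [show z = (z.1, z.2) from rfl, h2 _ hc]
  · rcases h.und z hz with h | h
    · rw [h]
    · have : 0 < 4 / K := by positivity
      linarith

theorem exp_aux {a : ℝ} (h0 : 0 ≤ a) (h1 : a ≤ 1 / 8) : Real.exp (-(8 / 7 * a)) ≤ 1 - a := by
  have h2 : 8 / 7 * a + 1 ≤ Real.exp (8 / 7 * a) := Real.add_one_le_exp _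
  rw [Real.exp_neg, inv_le_iff_one_le_mul₀ (Real.exp_pos _)]
  calc (1 : ℝ) ≤ (1 - a) * (8 / 7 * a + 1) := by nlinarith
    _ ≤ _ := by apply mul_le_mul_of_nonneg_left h2; linarith

theorem inv_step {E C : Type} [Fintype E] [DecidableEq E] [DecidableEq C] {Sf : Finset (Finset (E × C))}
    {P : E → Finset C} {K L η : ℝ} (hK : 0 < K) (hL : 0 < L) (hη : η = Real.exp (-L) / 8)
    (hKL : 2 * Real.exp L / K ≤ 1 / 2)
    (hfun : ∀ S ∈ Sf, Functional S) (hU : LinkU Sf) {y : E × C → ℝ} {Dn : Finset E}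
    (h : StInv Sf P K L η (Real.exp (-(4 / 7 * (η * K)))) y Dn) {w : E} (hw : w ∉ Dn) :
    ∃ y', StInv Sf P K L η (Real.exp (-(4 / 7 * (η * K)))) y' (insert w Dn) := by
  classical
  have hη0 : 0 < η := by rw [hη]; positivity
  have hηL : η * Real.exp L = 1 / 8 := by
    rw [hη, Real.exp_neg]; field_simp
  have hy0 := h.nonneg hK
  have hz8 : ∀ v ∉ Dn, ∀ c, η * zf K L (y (v, c)) (Yf Sf y (v, c)) ≤ 1 / 8 := by
    intro v hv c
    have := zf_le hK hL (h.und (v, c) hv) (Yf_nonneg (Sf := Sf) hy0 (v, c))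
    have := mul_le_mul_of_nonneg_left this hη0.le
    linarith
  have hPhi0 : ∀ v ∈ Finset.univ \ Dn, 0 ≤ Phi Sf P K L η y v := by
    intro v hv
    have hv : v ∉ Dn := by simpa using hv
    apply Finset.prod_nonneg
    intro c _
    have := hz8 v hv c
    linarith
  have hwm : w ∈ Finset.univ \ Dn := by simpa using hw
  have hPw : Phi Sf P K L η y w < Real.exp (-(4 / 7 * (η * K))) :=
    lt_of_le_of_lt (Finset.single_le_sum hPhi0 hwm) h.pot
  set z : C → ℝ := fun c => zf K L (y (w, c)) (Yf Sf y (w, c)) with hz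
  have hz0 : ∀ c, 0 ≤ z c := fun c => zf_nonneg hK (hy0 _)
  have hsz : K / 2 ≤ ∑ c ∈ P w, z c := by
    have h1 : Real.exp (∑ c ∈ P w, -(8 / 7 * (η * z c))) ≤ Phi Sf P K L η y w := by
      rw [Real.exp_sum]
      apply Finset.prod_le_prod
      · intros; positivity
      · intro c _
        exact exp_aux (mul_nonneg hη0.le (hz0 c)) (hz8 w hw c)
    have h2 := Real.exp_lt_exp.1 (lt_of_le_of_lt h1 hPw)
    have h3 : ∑ c ∈ P w, -(8 / 7 * (η * z c)) = -(8 / 7 * η) * ∑ c ∈ P w, z c := by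
      rw [Finset.mul_sum]; apply Finset.sum_congr rfl; intros; ring
    rw [h3] at h2
    have h4 : η * (K / 2) < η * ∑ c ∈ P w, z c := by linarith
    exact (lt_of_mul_lt_mul_left h4 hη0.le).le
  have hzy : ∀ c, z c ≤ K * y (w, c) / 4 := by
    intro c
    simp only [hz, zf]
    rcases h.und (w, c) hw with h1 | h1
    · rw [h1]; simp
    · have h2 : 1 ≤ K * y (w, c) / 4 := by
        rw [div_le_iff₀ hK] at h1; linarith
      have h3 := Real.log_nonneg h2
      have h4 := Yf_nonneg (Sf := Sf) hy0 (w, c)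
      have h5 : max 0 (1 - (Yf Sf y (w, c) + Real.log (K * y (w, c) / 4)) / L) ≤ 1 := by
        apply max_le (by norm_num)
        have : 0 ≤ (Yf Sf y (w, c) + Real.log (K * y (w, c) / 4)) / L := by positivity
        linarith
      calc _ ≤ K * y (w, c) / 4 * 1 := mul_le_mul_of_nonneg_left h5 (by linarith)
        _ = _ := by ring
  have hyle : ∀ c, 0 < z c → y (w, c) ≤ 4 * Real.exp L / K ∧ 0 < y (w, c) := by
    intro c hc
    have hyp : 0 < y (w, c) := by
      rcases (hy0 (w, c)).eq_or_lt with h1 | h1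
      · exfalso; simp only [hz, zf, ← h1] at hc; simp at hc
      · exact h1
    refine ⟨?_, hyp⟩
    simp only [hz, zf] at hc
    have h1 : 0 < K * y (w, c) / 4 := by positivity
    have h2 := (mul_pos_iff_of_pos_left h1).1 hc
    have h3 : 0 < 1 - (Yf Sf y (w, c) + Real.log (K * y (w, c) / 4)) / L := by
      rcases lt_max_iff.1 h2 with h | h
      · exact absurd h (lt_irrefl _)
      · exact h
    have h4 : (Yf Sf y (w, c) + Real.log (K * y (w, c) / 4)) / L < 1 := by linarith
    rw [div_lt_one hL] at h4
    have h5 := Yf_nonneg (Sf := Sf) hy0 (w, c)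
    have h6 : K * y (w, c) / 4 ≤ Real.exp L := by
      rw [← Real.log_le_iff_le_exp h1]; linarith
    rw [le_div_iff₀ hK]; linarith
  set good := (P w).filter (fun c => 0 < z c) with hgood
  set X := ∑ c ∈ good, y (w, c) / 4 with hX
  have hXh : 1 / 2 ≤ X := by
    have h1 : ∑ c ∈ P w, z c = ∑ c ∈ good, z c := by
      rw [hgood, Finset.sum_filter]
      apply Finset.sum_congr rfl
      intro c _
      split_ifs with hc
      · rfl
      · exact le_antisymm (not_lt.1 hc) (hz0 c)
    have h2 : ∑ c ∈ good, z c ≤ K * X := by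
      rw [hX, Finset.mul_sum]
      apply Finset.sum_le_sum
      intro c _
      have := hzy c
      linarith
    have h3 : K * (1 / 2) ≤ K * X := by linarith
    exact le_of_mul_le_mul_left h3 hK
  have hX0 : 0 < X := by linarith
  set q : C → ℝ := fun d => if d ∈ good then (y (w, d) / 4) / X else 0 with hq
  have hq0 : ∀ d, 0 ≤ q d := by
    intro d; simp only [hq]; split_ifs
    · have := hy0 (w, d); positivity
    · exact le_rfl
  have hq1 : ∑ d ∈ P w, q d = 1 := by
    simp only [hq]
    rw [← Finset.sum_filter, Finset.filter_mem_eq_inter, Finset.inter_eq_right.2 (Finset.filter_subset _ _),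
      ← Finset.sum_div]
    exact div_self hX0.ne'
  have hqs : ∀ d ∉ P w, q d = 0 := by
    intro d hd; simp only [hq]; rw [if_neg]; intro h; exact hd (Finset.mem_filter.1 h).1
  have hqy : ∀ d, 2 * q d ≤ y (w, d) := by
    intro d; simp only [hq]
    have := hy0 (w, d)
    split_ifs
    · rw [← mul_div_assoc, div_le_iff₀ hX0]; nlinarith
    · linarith
  have hqh : ∀ d, q d ≤ 1 / 2 := by
    intro d
    by_cases hd : d ∈ good
    · have h1 := (hyle d (Finset.mem_filter.1 hd).2).1
      have h2 := hqy d
      have : 4 * Real.exp L / K = 2 * (2 * Real.exp L / K) := by ring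
      linarith
    · simp only [hq]; rw [if_neg hd]; norm_num
  -- choose d0
  have hsum : ∑ d0 ∈ P w, q d0 * ∑ v ∈ Finset.univ \ insert w Dn, Phi Sf P K L η (ynew Sf y Dn w q d0) v ≤
      ∑ v ∈ Finset.univ \ Dn, Phi Sf P K L η y v := by
    calc _ = ∑ v ∈ Finset.univ \ insert w Dn, ∑ d0 ∈ P w, q d0 * Phi Sf P K L η (ynew Sf y Dn w q d0) v := by
          simp only [Finset.mul_sum]; rw [Finset.sum_comm]
      _ ≤ ∑ v ∈ Finset.univ \ insert w Dn, Phi Sf P K L η y v := by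
          apply Finset.sum_le_sum
          intro v hv
          simp only [Finset.mem_sdiff, Finset.mem_insert, not_or] at hv
          exact phi_step hK hL hη0.le (by rw [hηL]; norm_num) hfun hU hy0 h.und hv.2.1 hv.2.2 (P w) hq1 hq0 hqs hqh hqy
      _ ≤ _ := by
          apply Finset.sum_le_sum_of_subset_of_nonneg
          · exact Finset.sdiff_subset_sdiff le_rfl (Finset.subset_insert _ _)
          · intro v hv _; exact hPhi0 v hv
  obtain ⟨d0, hd0P, hd0q, hd0⟩ : ∃ d0 ∈ P w, 0 < q d0 ∧
      ∑ v ∈ Finset.univ \ insert w Dn, Phi Sf P K L η (ynew Sf y Dn w q d0) v ≤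
      ∑ v ∈ Finset.univ \ Dn, Phi Sf P K L η y v := by
    by_contra hcon
    push Not at hcon
    set R := ∑ v ∈ Finset.univ \ Dn, Phi Sf P K L η y v
    have : ∑ d0 ∈ P w, q d0 * R <
       ∑ d0 ∈ P w, q d0 * ∑ v ∈ Finset.univ \ insert w Dn, Phi Sf P K L η (ynew Sf y Dn w q d0) v := by
      apply Finset.sum_lt_sum
      · intro d hd
        rcases (hq0 d).eq_or_lt with h1 | h1
        · rw [← h1]; simp
        · exact mul_le_mul_of_nonneg_left (hcon d hd h1).le h1.le
      · obtain ⟨d, hd, h1⟩ : ∃ d ∈ P w, 0 < q d := by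
          apply Finset.exists_lt_of_sum_lt (f := fun _ => 0)
          rw [hq1]; simp
        exact ⟨d, hd, mul_lt_mul_of_pos_left (hcon d hd h1) h1⟩
    rw [← Finset.sum_mul, hq1, one_mul] at this
    linarith
  have hd0good : d0 ∈ good := by
    by_contra hn
    simp only [hq] at hd0q; rw [if_neg hn] at hd0q; exact lt_irrefl _ hd0q
  have hyd0 : 0 < y (w, d0) := (hyle d0 (Finset.mem_filter.1 hd0good).2).2
  have ew : ∀ c, ynew Sf y Dn w q d0 (w, c) = if c = d0 then 1 else 0 := by
    intro c; unfold ynew; rw [if_pos rfl]; by_cases hc : c = d0 <;> simp [hc]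
  have ed : ∀ z : E × C, z.1 ∈ Dn → ynew Sf y Dn w q d0 z = y z := by
    intro z hz; unfold ynew; rw [if_neg (fun h => hw (by rw [← h]; exact hz)), if_pos hz]
  -- chosen in new state
  have hch : ∀ z, Chosen (ynew Sf y Dn w q d0) (insert w Dn) z → z = (w, d0) ∨ Chosen y Dn z := by
    rintro ⟨z1, z2⟩ ⟨h1, h2⟩
    rw [Finset.mem_insert] at h1
    by_cases hzw : z1 = w
    · left
      subst hzw
      rw [ew] at h2
      split_ifs at h2 with h3
      · rw [h3]
      · norm_num at h2
    · right
      rcases h1 with h1 | h1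
      · exact absurd h1 hzw
      · exact ⟨h1, by rw [← ed _ h1]; exact h2⟩
  refine ⟨ynew Sf y Dn w q d0, ⟨?_, ?_, ?_, ?_, ?_, ?_⟩⟩
  · intro e he
    rcases Finset.mem_insert.1 he with rfl | he
    · refine ⟨d0, hd0P, by rw [ew, if_pos rfl], fun c' hc' => by rw [ew, if_neg hc']⟩
    · obtain ⟨c, hc, h1, h2⟩ := h.done e he
      exact ⟨c, hc, by rw [ed _ he, h1], fun c' hc' => by rw [ed _ he, h2 c' hc']⟩
  · intro x hx
    rw [Finset.mem_insert, not_or] at hx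
    rw [ynew_undone hx.1 hx.2]
    rcases h.und x hx.2 with h1 | h1
    · left; rw [h1, zero_mul]
    · rcases facf_cases (Sf := Sf) (y := y) (Dn := Dn) (w := w) (x := x) hq0 hqh d0 with h2 | h2
      · left; rw [h2, mul_zero]
      · right
        have := hy0 x
        nlinarith
  · intro e c hne
    by_cases hew : e = w
    · subst hew
      rw [ew] at hne
      split_ifs at hne with h1
      · rw [h1]; exact hd0P
      · exact absurd rfl hne
    · by_cases hed : e ∈ Dn
      · rw [ed _ hed] at hne; exact h.sup e c hne
      · rw [ynew_undone (by exact hew) (by exact hed)] at hne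
        exact h.sup e c (left_ne_zero_of_mul hne)
  · intro S hS x hx hxD hall
    rw [Finset.mem_insert, not_or] at hxD
    rw [ynew_undone hxD.1 hxD.2]
    by_cases hwS : (w, d0) ∈ S
    · have : Prr Sf y Dn w x d0 := by
        refine ⟨S, hS, hx, hwS, fun z hz hzx hzw => ?_⟩
        rcases hch z (hall z hz hzx) with h1 | h1
        · exact absurd h1 hzw
        · exact h1
      unfold facf; rw [if_pos this, mul_zero]
    · rw [h.kill S hS x hx hxD.2, zero_mul]
      intro z hz hzx
      rcases hch z (hall z hz hzx) with h1 | h1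
      · rw [h1] at hz; exact absurd hz hwS
      · exact h1
  · intro S hS hall
    by_cases hwS : (w, d0) ∈ S
    · have := h.kill S hS _ hwS hw (by
        intro z hz hzx
        rcases hch z (hall z hz) with h1 | h1
        · exact absurd h1 hzx
        · exact h1)
      linarith
    · apply h.free S hS
      intro z hz
      rcases hch z (hall z hz) with h1 | h1
      · rw [h1] at hz; exact absurd hz hwS
      · exact h1
  · exact lt_of_le_of_lt hd0 h.pot

theorem coloring_T2 {E C : Type} [Fintype E] [DecidableEq E] [DecidableEq C] (Sf : Finset (Finset (E × C)))
    (P : E → Finset C) {K L η : ℝ} (hK : 0 < K) (hL : 0 < L) (hη : η = Real.exp (-L) / 8)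
    (hKL : 2 * Real.exp L / K ≤ 1 / 2)
    (hfun : ∀ S ∈ Sf, Functional S) (h2 : ∀ S ∈ Sf, 2 ≤ S.card) (hU : LinkU Sf)
    (hP : ∀ v, 3 * K / 4 ≤ (P v).card)
    (hdeg : ∀ v, ∑ c ∈ P v, ∑ S ∈ Sf.filter (fun S => (v, c) ∈ S), (4 / K) ^ (S.card - 1) ≤ L * K / 16)
    (hE : (Fintype.card E : ℝ) * Real.exp (-(11 / 16 * (η * K))) < Real.exp (-(4 / 7 * (η * K)))) :
    ∃ φ : E → C, (∀ v, φ v ∈ P v) ∧ ∀ S ∈ Sf, ¬ ∀ z ∈ S, φ z.1 = z.2 := by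
  classical
  have hη0 : 0 < η := by rw [hη]; positivity
  have hηL : η * Real.exp L = 1 / 8 := by
    rw [hη, Real.exp_neg]; field_simp
  set y0 : E × C → ℝ := fun z => if z.2 ∈ P z.1 then 4 / K else 0 with hy0
  have hynn : ∀ z, 0 ≤ y0 z := by intro z; simp only [hy0]; split_ifs <;> positivity
  have hyle : ∀ z, y0 z ≤ 4 / K := by
    intro z; simp only [hy0]; split_ifs
    · exact le_rfl
    · positivity
  have hinit : StInv Sf P K L η (Real.exp (-(4 / 7 * (η * K)))) y0 ∅ := by
    refine ⟨by simp, ?_, ?_, ?_, ?_, ?_⟩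
    · intro z _; simp only [hy0]; split_ifs
      · right; exact le_rfl
      · left; rfl
    · intro e c hne; by_contra hn; apply hne; simp only [hy0]; rw [if_neg hn]
    · intro S hS x hx _ hall
      exfalso
      obtain ⟨z, hz, hzx⟩ := Finset.exists_mem_ne (h2 S hS) x
      have := (hall z hz hzx).1; simp at this
    · intro S hS hall
      obtain ⟨z, hz⟩ : S.Nonempty := by rw [← Finset.card_pos]; have := h2 S hS; omega
      have := (hall z hz).1; simp at this
    · refine lt_of_le_of_lt ?_ hE
      have : ∀ v ∈ Finset.univ \ (∅ : Finset E), Phi Sf P K L η y0 v ≤ Real.exp (-(11 / 16 * (η * K))) := by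
        intro v _
        have hz : ∀ c ∈ P v, 1 - Yf Sf y0 (v, c) / L ≤ zf K L (y0 (v, c)) (Yf Sf y0 (v, c)) := by
          intro c hc
          have e1 : y0 (v, c) = 4 / K := by simp only [hy0]; rw [if_pos hc]
          rw [e1]; unfold zf
          have : K * (4 / K) / 4 = 1 := by field_simp
          rw [this, Real.log_one, add_zero, one_mul]
          exact le_max_right _ _
        have hsum : 11 * K / 16 ≤ ∑ c ∈ P v, zf K L (y0 (v, c)) (Yf Sf y0 (v, c)) := by
          have h1 := Finset.sum_le_sum hz
          rw [Finset.sum_sub_distrib, ← Finset.sum_div] at h1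
          have h3 : ∑ c ∈ P v, Yf Sf y0 (v, c) ≤ L * K / 16 := by
            refine le_trans (Finset.sum_le_sum ?_) (hdeg v)
            intro c _
            unfold Yf
            apply Finset.sum_le_sum
            intro S hS
            rw [← Finset.card_erase_of_mem (Finset.mem_filter.1 hS).2]
            calc _ ≤ ∏ z ∈ S.erase (v, c), (4 / K) := Finset.prod_le_prod (fun _ _ => hynn _) (fun _ _ => hyle _)
              _ = _ := by rw [Finset.prod_const]
          have h4 : (∑ c ∈ P v, Yf Sf y0 (v, c)) / L ≤ K / 16 := by
            rw [div_le_iff₀ hL]; linarith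
          have h5 := hP v
          simp only [Finset.sum_const, nsmul_eq_mul, mul_one] at h1
          linarith
        calc Phi Sf P K L η y0 v ≤ ∏ c ∈ P v, Real.exp (-(η * zf K L (y0 (v, c)) (Yf Sf y0 (v, c)))) := by
              apply Finset.prod_le_prod
              · intro c _
                have := zf_le hK hL (a := y0 (v, c)) (by simp only [hy0]; split_ifs <;> simp) (Yf_nonneg (Sf := Sf) hynn (v, c))
                have := mul_le_mul_of_nonneg_left this hη0.le
                linarith
              · intro c _
                have := Real.add_one_le_exp (-(η * zf K L (y0 (v, c)) (Yf Sf y0 (v, c))))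
                linarith
          _ = Real.exp (-(η * ∑ c ∈ P v, zf K L (y0 (v, c)) (Yf Sf y0 (v, c)))) := by
              rw [← Real.exp_sum, Finset.sum_neg_distrib, Finset.mul_sum]
          _ ≤ _ := by
              apply Real.exp_le_exp.2
              have := mul_le_mul_of_nonneg_left hsum hη0.le
              linarith
      calc _ ≤ ∑ v ∈ Finset.univ \ (∅ : Finset E), Real.exp (-(11 / 16 * (η * K))) := Finset.sum_le_sum this
        _ = _ := by simp
  have hall : ∀ Dn : Finset E, ∃ y, StInv Sf P K L η (Real.exp (-(4 / 7 * (η * K)))) y Dn := by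
    intro Dn
    induction Dn using Finset.induction_on with
    | empty => exact ⟨y0, hinit⟩
    | insert w s hw ih =>
      obtain ⟨y, hy⟩ := ih
      exact inv_step hK hL hη hKL hfun hU hy hw
  obtain ⟨y, hy⟩ := hall Finset.univ
  choose φ h1 h3 h4 using fun e => hy.done e (Finset.mem_univ e)
  refine ⟨φ, h1, fun S hS hcon => hy.free S hS ?_⟩
  rintro ⟨e, c⟩ hz
  refine ⟨Finset.mem_univ _, ?_⟩
  have := hcon _ hz
  simp only at this
  rw [← this, h3]

set_option linter.unusedSectionVars false
def InU {E C : Type} [DecidableEq E] (v : E) (A : Finset (E × C)) (u : E) : Prop := u ∈ vs A ∨ u = v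

def Att {E C : Type} [DecidableEq E] (v : E) (A S : Finset (E × C)) : Prop := ∃ u ∈ vs S, InU v A u

def Dbl {E C : Type} [DecidableEq E] (v : E) (A S : Finset (E × C)) : Prop :=
  ¬ S ⊆ A ∧ ((∃ u ∈ vs S, ∃ u' ∈ vs S, u ≠ u' ∧ InU v A u ∧ InU v A u') ∨ (S.card = 2 ∧ Att v A S))

inductive Ev {E C : Type} [DecidableEq E] [DecidableEq C] (Q : Finset (E × C) → Prop) (v : E) :
    ℕ → ℕ → Finset (E × C) → Finset (E × C) → Prop
  | zero (A) : Ev Q v 0 0 A A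
  | att {j d A S A'} : Q S → Att v A S → Ev Q v j d (A ∪ S) A' → Ev Q v (j + 1) d A A'
  | dbl {j d A S A'} : Q S → Dbl v A S → Ev Q v j d (A ∪ S) A' → Ev Q v (j + 1) (d + 1) A A'

theorem Ev.trans {E C : Type} [DecidableEq E] [DecidableEq C] {Q : Finset (E × C) → Prop} {v : E}
    {j d j' d' : ℕ} {A A' A'' : Finset (E × C)} (h : Ev Q v j d A A') (h' : Ev Q v j' d' A' A'') :
    Ev Q v (j + j') (d + d') A A'' := by
  induction h with
  | zero A => simpa using h'
  | att hS ha _ ih =>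
    have := Ev.att hS ha (ih h')
    rwa [Nat.add_right_comm] at this
  | dbl hS ha _ ih =>
    have := Ev.dbl hS ha (ih h')
    rwa [Nat.add_right_comm, Nat.add_right_comm _ _ 1] at this

theorem Ev.card {E C : Type} [DecidableEq E] [DecidableEq C] {Q : Finset (E × C) → Prop} {v : E}
    {g : ℕ} (hg : ∀ S, Q S → S.card ≤ g)
    {j d : ℕ} {A A' : Finset (E × C)} (h : Ev Q v j d A A') : A'.card ≤ A.card + j * g := by
  induction h with
  | zero A => simp
  | att hS _ _ ih =>
    have := hg _ hS
    refine ih.trans ?_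
    rename_i A S A' _ _
    have := Finset.card_union_le A S
    rw [Nat.add_mul]; omega
  | dbl hS _ _ ih =>
    have := hg _ hS
    refine ih.trans ?_
    rename_i A S A' _ _
    have := Finset.card_union_le A S
    rw [Nat.add_mul]; omega

section
variable {E C : Type} [DecidableEq E] [DecidableEq C]

theorem vs_mono {A B : Finset (E × C)} (h : A ⊆ B) : vs A ⊆ vs B := Finset.image_subset_image h

theorem InU.l {v u : E} {A B : Finset (E × C)} (h : InU v A u) : InU v (A ∪ B) u :=
  h.imp (fun h => vs_mono Finset.subset_union_left h) id

theorem InU.r {v u : E} {A B : Finset (E × C)} (h : u ∈ vs B) : InU v (A ∪ B) u :=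
  Or.inl (vs_mono Finset.subset_union_right h)

theorem InU.v {v : E} {A : Finset (E × C)} : InU v A v := Or.inr rfl

theorem InU.x {v : E} {A : Finset (E × C)} {x : E × C} (h : x ∈ A) : InU v A x.1 := Or.inl (mem_vs_of h)

theorem Dbl.att {v : E} {A S : Finset (E × C)} (h : Dbl v A S) : Att v A S := by
  rcases h.2 with ⟨u, hu, _, _, _, h1, _⟩ | h
  · exact ⟨u, hu, h1⟩
  · exact h.2

theorem Dbl.mk2 {v : E} {A S : Finset (E × C)} {u u' : E} (hn : ¬ S ⊆ A) (h : u ∈ vs S) (h' : u' ∈ vs S)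
    (hne : u ≠ u') (hu : InU v A u) (hu' : InU v A u') : Dbl v A S :=
  ⟨hn, Or.inl ⟨u, h, u', h', hne, hu, hu'⟩⟩

theorem Att.self {v : E} {A S : Finset (E × C)} (h : Att v A S) : Att v (A ∪ S) S := by
  obtain ⟨u, hu, h⟩ := h
  exact ⟨u, hu, h.l⟩

variable {Q : Finset (E × C) → Prop} {v : E} {A S1 S2 S3 S4 : Finset (E × C)}

theorem ev1 (h1 : Q S1) (d1 : Dbl v A S1) : ∃ A', Ev Q v 4 1 A A' :=
  ⟨_, Ev.dbl h1 d1 (Ev.att h1 d1.att.self (Ev.att h1 d1.att.self.self (Ev.att h1 d1.att.self.self.self (Ev.zero _))))⟩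

theorem ev2 (h1 : Q S1) (h2 : Q S2) (a1 : Att v A S1) (d2 : Dbl v (A ∪ S1) S2) : ∃ A', Ev Q v 4 1 A A' :=
  ⟨_, Ev.att h1 a1 (Ev.dbl h2 d2 (Ev.att h2 d2.att.self (Ev.att h2 d2.att.self.self (Ev.zero _))))⟩

theorem ev3 (h1 : Q S1) (h2 : Q S2) (h3 : Q S3) (a1 : Att v A S1) (a2 : Att v (A ∪ S1) S2)
    (d3 : Dbl v (A ∪ S1 ∪ S2) S3) : ∃ A', Ev Q v 4 1 A A' :=
  ⟨_, Ev.att h1 a1 (Ev.att h2 a2 (Ev.dbl h3 d3 (Ev.att h3 d3.att.self (Ev.zero _))))⟩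

theorem ev4 (h1 : Q S1) (h2 : Q S2) (h3 : Q S3) (h4 : Q S4) (a1 : Att v A S1) (a2 : Att v (A ∪ S1) S2)
    (a3 : Att v (A ∪ S1 ∪ S2) S3) (d4 : Dbl v (A ∪ S1 ∪ S2 ∪ S3) S4) : ∃ A', Ev Q v 4 1 A A' :=
  ⟨_, Ev.att h1 a1 (Ev.att h2 a2 (Ev.att h3 a3 (Ev.dbl h4 d4 (Ev.zero _))))⟩

def BadAt (Q : Finset (E × C) → Prop) (v : E) (Γ : Finset (E × C)) : Prop :=
  (Q Γ ∧ Γ.card = 2 ∧ v ∈ vs Γ) ∨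
  (∃ S1 S2 w, ∃ x : E × C, Q S1 ∧ Q S2 ∧ v ∈ vs S1 ∧ v ∈ vs S2 ∧ w ∈ vs S1 ∧ w ∈ vs S2 ∧ w ≠ v ∧
    x ∈ S1 ∧ x ∉ S2 ∧ x.1 ≠ v ∧ Γ = S1 ∪ S2) ∨
  (∃ S1 S2 S3 u w, ∃ x1 x3 : E × C, Q S1 ∧ Q S2 ∧ Q S3 ∧ v ∈ vs S1 ∧ v ∈ vs S3 ∧ u ∈ vs S1 ∧ u ∈ vs S2 ∧
    w ∈ vs S2 ∧ w ∈ vs S3 ∧ u ≠ v ∧ w ≠ v ∧ u ≠ w ∧ x1 ∈ S1 ∧ x1 ∉ S2 ∧ x1 ∉ S3 ∧ x1.1 ≠ v ∧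
    x3 ∈ S3 ∧ x3 ∉ S1 ∧ x3 ∉ S2 ∧ x3.1 ≠ v ∧ Γ = S1 ∪ S2 ∪ S3) ∨
  (∃ S1 S2 S3 S4 a w b, ∃ x1 x2 x4 : E × C, Q S1 ∧ Q S2 ∧ Q S3 ∧ Q S4 ∧ v ∈ vs S1 ∧ v ∈ vs S4 ∧
    a ∈ vs S1 ∧ a ∈ vs S2 ∧ w ∈ vs S2 ∧ w ∈ vs S3 ∧ b ∈ vs S3 ∧ b ∈ vs S4 ∧ a ≠ v ∧ a ≠ w ∧ b ≠ w ∧ b ≠ v ∧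
    (x1 ∈ S1 ∧ x1 ∉ S2 ∧ x1 ∉ S3 ∧ x1 ∉ S4 ∧ x1.1 ≠ v) ∧ (x4 ∈ S4 ∧ x4 ∉ S1 ∧ x4 ∉ S2 ∧ x4 ∉ S3 ∧ x4.1 ≠ v) ∧
    (x2 ∈ S2 ∧ x2 ∉ S1 ∧ x2 ∉ S3 ∧ x2 ∉ S4 ∧ x2.1 ≠ a) ∧ Γ = S1 ∪ S2 ∪ S3 ∪ S4)

theorem BadAt.ev {Γ : Finset (E × C)} (h : BadAt Q v Γ) (hn : ¬ Γ ⊆ A) : ∃ A', Ev Q v 4 1 A A' := by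
  by_contra hno
  rcases h with ⟨h1, h2, h3⟩ | ⟨S1, S2, w, x, q1, q2, v1, v2, w1, w2, hwv, x1, x2, xv, rfl⟩ |
    ⟨S1, S2, S3, u, w, x1, x3, q1, q2, q3, v1, v3, u1, u2, w2, w3, huv, hwv, huw, m1, m12, m13, mv, n3, n31, n32, nv, rfl⟩ |
    ⟨S1, S2, S3, S4, a, w, b, x1, x2, x4, q1, q2, q3, q4, v1, v4, a1, a2, w2, w3, b3, b4, hav, haw, hbw, hbv,
      ⟨m1, m12, m13, m14, mv⟩, ⟨n4, n41, n42, n43, nv⟩, ⟨l2, l21, l23, l24, la⟩, rfl⟩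
  · exact hno (ev1 h1 ⟨hn, Or.inr ⟨h2, v, h3, InU.v⟩⟩)
  · have s2 : S2 ⊆ A ∪ S1 := by
      by_contra hc
      exact hno (ev2 q1 q2 ⟨v, v1, InU.v⟩ (Dbl.mk2 hc w2 v2 hwv (InU.r w1) InU.v))
    have s1 : S1 ⊆ A ∪ S2 := by
      by_contra hc
      exact hno (ev2 q2 q1 ⟨v, v2, InU.v⟩ (Dbl.mk2 hc w1 v1 hwv (InU.r w2) InU.v))
    have hxA : x ∈ A := by
      have := s1 x1; rw [Finset.mem_union] at this; tauto
    have t1 : S1 ⊆ A := by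
      by_contra hc
      exact hno (ev1 q1 (Dbl.mk2 hc (mem_vs_of x1) v1 xv (InU.x hxA) InU.v))
    exact hn (Finset.union_subset t1 (s2.trans (Finset.union_subset subset_rfl t1)))
  · have s3 : S3 ⊆ A ∪ S1 ∪ S2 := by
      by_contra hc
      exact hno (ev3 q1 q2 q3 ⟨v, v1, InU.v⟩ ⟨u, u2, InU.r u1⟩ (Dbl.mk2 hc w3 v3 hwv (InU.r w2) InU.v))
    have s1 : S1 ⊆ A ∪ S3 ∪ S2 := by
      by_contra hc
      exact hno (ev3 q3 q2 q1 ⟨v, v3, InU.v⟩ ⟨w, w2, InU.r w3⟩ (Dbl.mk2 hc u1 v1 huv (InU.r u2) InU.v))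
    have s2 : S2 ⊆ A ∪ S1 ∪ S3 := by
      by_contra hc
      exact hno (ev3 q1 q3 q2 ⟨v, v1, InU.v⟩ ⟨v, v3, InU.v⟩ (Dbl.mk2 hc u2 w2 huw (InU.r u1).l (InU.r w3)))
    have hx1 : x1 ∈ A := by
      have := s1 m1; simp only [Finset.mem_union] at this; tauto
    have hx3 : x3 ∈ A := by
      have := s3 n3; simp only [Finset.mem_union] at this; tauto
    have t1 : S1 ⊆ A := by
      by_contra hc
      exact hno (ev1 q1 (Dbl.mk2 hc (mem_vs_of m1) v1 mv (InU.x hx1) InU.v))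
    have t3 : S3 ⊆ A := by
      by_contra hc
      exact hno (ev1 q3 (Dbl.mk2 hc (mem_vs_of n3) v3 nv (InU.x hx3) InU.v))
    have t2 : S2 ⊆ A := s2.trans (Finset.union_subset (Finset.union_subset subset_rfl t1) t3)
    exact hn (Finset.union_subset (Finset.union_subset t1 t2) t3)
  · have s4 : S4 ⊆ A ∪ S1 ∪ S2 ∪ S3 := by
      by_contra hc
      exact hno (ev4 q1 q2 q3 q4 ⟨v, v1, InU.v⟩ ⟨a, a2, InU.r a1⟩ ⟨w, w3, InU.r w2⟩
        (Dbl.mk2 hc b4 v4 hbv (InU.r b3) InU.v))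
    have s1 : S1 ⊆ A ∪ S4 ∪ S3 ∪ S2 := by
      by_contra hc
      exact hno (ev4 q4 q3 q2 q1 ⟨v, v4, InU.v⟩ ⟨b, b3, InU.r b4⟩ ⟨w, w2, InU.r w3⟩
        (Dbl.mk2 hc a1 v1 hav (InU.r a2) InU.v))
    have s2 : S2 ⊆ A ∪ S1 ∪ S4 ∪ S3 := by
      by_contra hc
      exact hno (ev4 q1 q4 q3 q2 ⟨v, v1, InU.v⟩ ⟨v, v4, InU.v⟩ ⟨b, b3, InU.r b4⟩
        (Dbl.mk2 hc a2 w2 haw (InU.r a1).l.l (InU.r w3)))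
    have s3 : S3 ⊆ A ∪ S1 ∪ S2 ∪ S4 := by
      by_contra hc
      exact hno (ev4 q1 q2 q4 q3 ⟨v, v1, InU.v⟩ ⟨a, a2, InU.r a1⟩ ⟨v, v4, InU.v⟩
        (Dbl.mk2 hc b3 w3 hbw (InU.r b4) (InU.r w2).l))
    have hx1 : x1 ∈ A := by
      have := s1 m1; simp only [Finset.mem_union] at this; tauto
    have hx4 : x4 ∈ A := by
      have := s4 n4; simp only [Finset.mem_union] at this; tauto
    have hx2 : x2 ∈ A := by
      have := s2 l2; simp only [Finset.mem_union] at this; tauto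
    have t1 : S1 ⊆ A := by
      by_contra hc
      exact hno (ev1 q1 (Dbl.mk2 hc (mem_vs_of m1) v1 mv (InU.x hx1) InU.v))
    have t4 : S4 ⊆ A := by
      by_contra hc
      exact hno (ev1 q4 (Dbl.mk2 hc (mem_vs_of n4) v4 nv (InU.x hx4) InU.v))
    have t2 : S2 ⊆ A := by
      by_contra hc
      exact hno (ev1 q2 (Dbl.mk2 hc (mem_vs_of l2) a2 la (InU.x hx2) (Or.inl (vs_mono t1 a1))))
    have t3 : S3 ⊆ A := s3.trans (Finset.union_subset (Finset.union_subset (Finset.union_subset subset_rfl t1) t2) t4)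
    exact hn (Finset.union_subset (Finset.union_subset (Finset.union_subset t1 t2) t3) t4)

theorem bad_small {g r : ℕ} (hg : ∀ S, Q S → S.card ≤ g) (hno : ¬ ∃ A', Ev Q v (4 * r) r ∅ A') :
    ∃ A : Finset (E × C), A.card ≤ 4 * r * g ∧ ∀ Γ, BadAt Q v Γ → Γ ⊆ A := by
  obtain ⟨d, hdr, ⟨A, hA⟩, hd⟩ : ∃ d ≤ r, (∃ A', Ev Q v (4 * d) d ∅ A') ∧ ¬ ∃ A', Ev Q v (4 * (d + 1)) (d + 1) ∅ A' := by
    by_contra hc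
    push Not at hc
    have : ∀ d ≤ r, ∃ A', Ev Q v (4 * d) d ∅ A' := by
      intro d
      induction d with
      | zero => intro _; exact ⟨_, Ev.zero _⟩
      | succ d ih =>
        intro h
        obtain ⟨A, hA⟩ := ih (by omega)
        exact hc d (by omega) ⟨A, hA⟩
    exact hno (this r le_rfl)
  refine ⟨A, ?_, fun Γ hΓ => ?_⟩
  · have := hA.card hg
    simp only [Finset.card_empty, zero_add] at this
    exact this.trans (Nat.mul_le_mul_right _ (by omega))
  · by_contra hn
    obtain ⟨A', hA'⟩ := hΓ.ev hn
    exact hd ⟨A', hA.trans hA'⟩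

def BadP (Q : Finset (E × C) → Prop) (x : E × C) : Prop := ∃ Γ, BadAt Q x.1 Γ ∧ x ∈ Γ

/-- the surviving sets -/
def Surv (Q : Finset (E × C) → Prop) (S : Finset (E × C)) : Prop := Q S ∧ ∀ x ∈ S, ¬ BadP Q x

theorem Surv.no {S Γ : Finset (E × C)} (h : Surv Q S) (hv : v ∈ vs S) (hS : S ⊆ Γ) (hb : BadAt Q v Γ) : False := by
  obtain ⟨c, hc⟩ := mem_vs.1 hv
  exact h.2 _ hc ⟨Γ, hb, hS hc⟩

variable (hfun : ∀ S, Q S → Functional S) (h2 : ∀ S, Q S → 2 ≤ S.card)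
  (hanti : ∀ S S', Q S → Q S' → S ⊆ S' → S = S')
include h2

theorem Surv.three {S : Finset (E × C)} (h : Surv Q S) : 3 ≤ S.card := by
  by_contra hc
  have := h2 S h.1
  obtain ⟨x, hx⟩ : S.Nonempty := by rw [← Finset.card_pos]; omega
  exact h.no (mem_vs_of hx) subset_rfl (Or.inl ⟨h.1, by omega, mem_vs_of hx⟩)

omit h2
include hanti

theorem Surv.linear {S1 S2 : Finset (E × C)} (h1 : Surv Q S1) (h2 : Surv Q S2) {u w : E} (huw : u ≠ w)
    (u1 : u ∈ vs S1) (u2 : u ∈ vs S2) (w1 : w ∈ vs S1) (w2 : w ∈ vs S2) : S1 = S2 := by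
  by_contra hne
  obtain ⟨x, hx1, hx2⟩ : ∃ x ∈ S1, x ∉ S2 := by
    by_contra hc
    push Not at hc
    exact hne (hanti _ _ h1.1 h2.1 hc)
  by_cases hxu : x.1 = u
  · refine h1.no w1 Finset.subset_union_left (Or.inr (Or.inl ⟨S1, S2, u, x, h1.1, h2.1, w1, w2, u1, u2, huw, hx1, hx2, ?_, rfl⟩))
    rw [hxu]; exact huw
  · exact h1.no u1 Finset.subset_union_left
      (Or.inr (Or.inl ⟨S1, S2, w, x, h1.1, h2.1, u1, u2, w1, w2, huw.symm, hx1, hx2, hxu, rfl⟩))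

include hfun h2

theorem exists_third {S : Finset (E × C)} (h : Surv Q S) (u w : E) : ∃ x ∈ S, x.1 ≠ u ∧ x.1 ≠ w := by
  by_contra hc
  push Not at hc
  have h3 := h.three h2
  have hinj : Set.InjOn Prod.fst (S : Set (E × C)) := by
    rintro ⟨a, b⟩ ha ⟨a', b'⟩ ha' (rfl : a = a')
    rw [hfun S h.1 _ _ _ ha ha']
  have h4 : (S.image Prod.fst).card = S.card := Finset.card_image_of_injOn hinj
  have h5 : S.image Prod.fst ⊆ {u, w} := by
    intro e he
    obtain ⟨x, hx, rfl⟩ := Finset.mem_image.1 he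
    by_cases hxu : x.1 = u
    · simp [hxu]
    · simp [hc x hx hxu]
  have := Finset.card_le_card h5
  have := Finset.card_le_two (a := u) (b := w)
  omega

theorem Surv.tri {S1 S2 S3 : Finset (E × C)} (h1 : Surv Q S1) (hS2 : Surv Q S2) (h3 : Surv Q S3)
    (n12 : S1 ≠ S2) (n23 : S2 ≠ S3) (n13 : S1 ≠ S3) {v u w : E} (huv : u ≠ v) (hwv : w ≠ v) (huw : u ≠ w)
    (v1 : v ∈ vs S1) (v3 : v ∈ vs S3) (u1 : u ∈ vs S1) (u2 : u ∈ vs S2) (w2 : w ∈ vs S2) (w3 : w ∈ vs S3) : False := by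
  obtain ⟨x1, hx1, x1v, x1u⟩ := exists_third hfun h2 hanti h1 v u
  obtain ⟨x3, hx3, x3v, x3w⟩ := exists_third hfun h2 hanti h3 v w
  refine h1.no v1 (Γ := S1 ∪ S2 ∪ S3) (fun x hx => by simp [hx]) (Or.inr (Or.inr (Or.inl ⟨S1, S2, S3, u, w, x1, x3, h1.1, hS2.1, h3.1, v1, v3, u1, u2, w2, w3,
    huv, hwv, huw, hx1, ?_, ?_, x1v, hx3, ?_, ?_, x3v, rfl⟩)))
  · intro h; exact n12 (h1.linear hanti hS2 x1u (mem_vs_of hx1) (mem_vs_of h) u1 u2)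
  · intro h; exact n13 (h1.linear hanti h3 x1v (mem_vs_of hx1) (mem_vs_of h) v1 v3)
  · intro h; exact n13 (h1.linear hanti h3 x3v (mem_vs_of h) (mem_vs_of hx3) v1 v3)
  · intro h; exact n23 (hS2.linear hanti h3 x3w (mem_vs_of h) (mem_vs_of hx3) w2 w3)

theorem Surv.quad {S1 S2 S3 S4 : Finset (E × C)} (h1 : Surv Q S1) (hS2 : Surv Q S2) (h3 : Surv Q S3) (h4 : Surv Q S4)
    (n12 : S1 ≠ S2) (n23 : S2 ≠ S3) (n34 : S3 ≠ S4) (n14 : S1 ≠ S4) {v a w b : E} (hav : a ≠ v) (haw : a ≠ w)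
    (hbw : b ≠ w) (hbv : b ≠ v) (hvw : v ≠ w) (hab : a ≠ b)
    (v1 : v ∈ vs S1) (v4 : v ∈ vs S4) (a1 : a ∈ vs S1) (a2 : a ∈ vs S2) (w2 : w ∈ vs S2) (w3 : w ∈ vs S3)
    (b3 : b ∈ vs S3) (b4 : b ∈ vs S4) : False := by
  have n13 : S1 ≠ S3 := by
    rintro rfl
    exact n12 (h1.linear hanti hS2 haw a1 a2 w3 w2)
  have n24 : S2 ≠ S4 := by
    rintro rfl
    exact n12 (h1.linear hanti hS2 hav a1 a2 v1 v4)
  have d13 : ∀ e, e ∈ vs S1 → e ∈ vs S3 → False := by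
    intro e e1 e3
    by_cases hea : e = a
    · subst hea; exact n23 (hS2.linear hanti h3 haw a2 e3 w2 w3)
    by_cases hew : e = w
    · subst hew; exact n12 (h1.linear hanti hS2 haw a1 a2 e1 w2)
    exact Surv.tri hfun h2 hanti h1 hS2 h3 n12 n23 n13 (fun h => hea h.symm) (fun h => hew h.symm) haw e1 e3 a1 a2 w2 w3
  have d24 : ∀ e, e ∈ vs S2 → e ∈ vs S4 → False := by
    intro e e2 e4
    by_cases hea : e = a
    · subst hea; exact n14 (h1.linear hanti h4 hav a1 e4 v1 v4)
    by_cases hev : e = v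
    · subst hev; exact n12 (h1.linear hanti hS2 hav a1 a2 v1 e2)
    exact Surv.tri hfun h2 hanti hS2 h1 h4 n12.symm n14 n24 (fun h => hea h.symm) (fun h => hev h.symm) hav e2 e4 a2 a1 v1 v4
  obtain ⟨x1, hx1, x1v, x1a⟩ := exists_third hfun h2 hanti h1 v a
  obtain ⟨x4, hx4, x4v, x4b⟩ := exists_third hfun h2 hanti h4 v b
  obtain ⟨x2, hx2, x2a, x2w⟩ := exists_third hfun h2 hanti hS2 a w
  refine h1.no v1 (Γ := S1 ∪ S2 ∪ S3 ∪ S4) (fun x hx => by simp [hx]) (Or.inr (Or.inr (Or.inr ⟨S1, S2, S3, S4, a, w, b, x1, x2, x4,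
    h1.1, hS2.1, h3.1, h4.1, v1, v4, a1, a2, w2, w3, b3, b4, hav, haw, hbw, hbv,
    ⟨hx1, ?_, ?_, ?_, x1v⟩, ⟨hx4, ?_, ?_, ?_, x4v⟩, ⟨hx2, ?_, ?_, ?_, x2a⟩, rfl⟩)))
  · intro h; exact n12 (h1.linear hanti hS2 x1a (mem_vs_of hx1) (mem_vs_of h) a1 a2)
  · intro h; exact d13 _ (mem_vs_of hx1) (mem_vs_of h)
  · intro h; exact n14 (h1.linear hanti h4 x1v (mem_vs_of hx1) (mem_vs_of h) v1 v4)
  · intro h; exact n14 (h1.linear hanti h4 x4v (mem_vs_of h) (mem_vs_of hx4) v1 v4)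
  · intro h; exact d24 _ (mem_vs_of h) (mem_vs_of hx4)
  · intro h; exact n34 (h3.linear hanti h4 x4b (mem_vs_of h) (mem_vs_of hx4) b3 b4)
  · intro h; exact n12 (h1.linear hanti hS2 x2a (mem_vs_of h) (mem_vs_of hx2) a1 a2)
  · intro h; exact n23 (hS2.linear hanti h3 x2w (mem_vs_of hx2) (mem_vs_of h) w2 w3)
  · intro h; exact d24 _ (mem_vs_of hx2) (mem_vs_of h)

theorem surv_linkU (Sf : Finset (Finset (E × C))) (hSf : ∀ S ∈ Sf, Surv Q S) : LinkU Sf := by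
  -- mixed case
  have mixed : ∀ v w S1 S1' x' S2', v ≠ w → S1 ∈ Sf → S1' ∈ Sf → S2' ∈ Sf → v ∈ vs S1 → w ∈ vs S1 →
      v ∈ vs S1' → x' ∈ vs S1' → x' ≠ v → x' ≠ w → S1' ≠ S2' → x' ∈ vs S2' → w ∈ vs S2' → False := by
    intro v w S1 S1' x' S2' hvw m1 m1' m2' v1 w1 v1' x1' hxv hxw hne x2' w2'
    have a1 := hSf _ m1
    have b1 := hSf _ m1'
    have b2 := hSf _ m2'
    by_cases e1 : S1 = S1'
    · subst e1
      exact hne (a1.linear hanti b2 hxw x1' x2' w1 w2')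
    by_cases e2 : S1 = S2'
    · subst e2
      exact hne (b1.linear hanti b2 hxv x1' x2' v1' v1)
    exact Surv.tri hfun h2 hanti b1 b2 a1 hne (fun h => e2 h.symm) (fun h => e1 h.symm) hxv hvw.symm hxw
      v1' v1 x1' x2' w2' w1
  intro v w S1 x S2 S1' x' S2' hvw ⟨m1, m2, v1, x1, hxv, hl⟩ ⟨m1', m2', v1', x1', hxv', hl'⟩
  rcases hl with ⟨rfl, rfl⟩ | ⟨hxw, hne, x2, w2⟩
  · rcases hl' with ⟨rfl, rfl⟩ | ⟨hxw', hne', x2', w2'⟩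
    · have := (hSf _ m1).linear hanti (hSf _ m1') hvw v1 v1' x1 x1'
      exact ⟨this, rfl, this⟩
    · exact (mixed v x _ _ _ _ hvw m1 m1' m2' v1 x1 v1' x1' hxv' hxw' hne' x2' w2').elim
  · rcases hl' with ⟨rfl, rfl⟩ | ⟨hxw', hne', x2', w2'⟩
    · exact (mixed v x' _ _ _ _ hvw m1' m1 m2 v1' x1' v1 x1 hxv hxw hne x2 w2).elim
    · have a1 := hSf _ m1
      have a2 := hSf _ m2
      have b1 := hSf _ m1'
      have b2 := hSf _ m2'
      by_cases hxx : x = x'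
      · subst hxx
        exact ⟨a1.linear hanti b1 hxv x1 x1' v1 v1', rfl, a2.linear hanti b2 hxw x2 x2' w2 w2'⟩
      exfalso
      by_cases e1 : S1 = S1'
      · subst e1
        by_cases e2 : S2 = S2'
        · subst e2
          exact hne (a1.linear hanti a2 hxx x1 x2 x1' x2')
        · exact Surv.tri hfun h2 hanti a2 a1 b2 hne.symm hne' e2 hxw hxw' hxx w2 w2' x2 x1 x1' x2'
      · by_cases e2 : S2 = S2'
        · subst e2
          exact Surv.tri hfun h2 hanti a1 a2 b1 hne hne'.symm e1 hxv hxv' hxx v1 v1' x1 x2 x2' x1'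
        · exact Surv.quad hfun h2 hanti a1 a2 b2 b1 hne e2 hne'.symm e1 hxv hxw hxw' hxv' hvw hxx
            v1 v1' x1 x2 w2 w2' x2' x1'

end

def SubS {E : Type} {K M : ℕ} (ω : E → Fin K → Fin M) (A : Finset (E × (Fin K × Fin M))) : Prop :=
  ∀ x ∈ A, ω x.1 x.2.1 = x.2.2

theorem SubS.union {E : Type} [DecidableEq E] {K M : ℕ} {ω : E → Fin K → Fin M} {A B : Finset (E × (Fin K × Fin M))} :
    SubS ω (A ∪ B) ↔ SubS ω A ∧ SubS ω B := by
  unfold SubS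
  constructor
  · intro h; exact ⟨fun x hx => h x (Finset.mem_union_left _ hx), fun x hx => h x (Finset.mem_union_right _ hx)⟩
  · rintro ⟨h1, h2⟩ x hx
    rcases Finset.mem_union.1 hx with h | h
    · exact h1 x h
    · exact h2 x h

open Classical in
theorem pr_sub_nat {E : Type} [Fintype E] [DecidableEq E] {K M : ℕ} (A : Finset (E × (Fin K × Fin M))) :
    (Finset.univ.filter (fun ω : E → Fin K → Fin M => SubS ω A)).card * M ^ A.card ≤
      Fintype.card (E → Fin K → Fin M) := by
  induction A using Finset.induction_on with
  | empty => rw [Finset.card_empty, pow_zero, mul_one]; exact Finset.card_le_univ _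
  | insert x A hx ih =>
    refine le_trans ?_ ih
    rw [Finset.card_insert_of_notMem hx, pow_succ, ← mul_assoc, mul_right_comm]
    apply Nat.mul_le_mul_right
    have : (Finset.univ.filter (fun ω : E → Fin K → Fin M => SubS ω (insert x A))).card * M =
      ((Finset.univ.filter (fun ω : E → Fin K → Fin M => SubS ω (insert x A))) ×ˢ (Finset.univ : Finset (Fin M))).card := by
      rw [Finset.card_product, Finset.card_univ, Fintype.card_fin]
    rw [this]
    apply Finset.card_le_card_of_injOn
      (fun p => Function.update p.1 x.1 (Function.update (p.1 x.1) x.2.1 p.2))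
    · rintro ⟨ω, j⟩ h
      simp only [Finset.coe_product, Set.mem_prod, Finset.mem_coe, Finset.mem_filter, Finset.mem_univ, true_and,
        and_true] at h ⊢
      intro y hy
      have hyω := h y (Finset.mem_insert_of_mem hy)
      have hxω := h x (Finset.mem_insert_self _ _)
      by_cases h1 : y.1 = x.1
      · have h2 : y.2.1 ≠ x.2.1 := by
          intro h2
          apply hx
          have : y = x := by
            refine Prod.ext h1 (Prod.ext h2 ?_)
            rw [← hyω, ← hxω, h1, h2]
          rwa [← this]
        rw [h1, Function.update_self, Function.update_of_ne h2, ← h1]; exact hyω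
      · rw [Function.update_of_ne h1]; exact hyω
    · rintro ⟨ω, j⟩ h ⟨ω', j'⟩ h' heq
      simp only [Finset.coe_product, Set.mem_prod, Finset.mem_coe, Finset.mem_filter, Finset.mem_univ, true_and,
        and_true] at h h'
      have hxω := h x (Finset.mem_insert_self _ _)
      have hxω' := h' x (Finset.mem_insert_self _ _)
      simp only at heq
      have e1 : ∀ e i, Function.update ω x.1 (Function.update (ω x.1) x.2.1 j) e i =
        Function.update ω' x.1 (Function.update (ω' x.1) x.2.1 j') e i := by
        intro e i; rw [heq]
      have ej : j = j' := by
        have := e1 x.1 x.2.1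
        simpa using this
      subst ej
      have : ω = ω' := by
        funext e i
        by_cases h1 : e = x.1
        · subst h1
          by_cases h2 : i = x.2.1
          · subst h2; rw [hxω, hxω']
          · have := e1 x.1 i
            simpa [Function.update_of_ne h2] using this
        · have := e1 e i
          simpa [Function.update_of_ne h1] using this
      rw [this]

open Classical in
noncomputable def ind {E : Type} {K M : ℕ} (A : Finset (E × (Fin K × Fin M))) (ω : E → Fin K → Fin M) : ℝ :=
  if SubS ω A then 1 else 0

theorem ind_nonneg {E : Type} {K M : ℕ} (A : Finset (E × (Fin K × Fin M))) (ω : E → Fin K → Fin M) :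
    0 ≤ ind A ω := by unfold ind; split_ifs <;> norm_num

theorem ind_union {E : Type} [DecidableEq E] {K M : ℕ} (A B : Finset (E × (Fin K × Fin M))) (ω : E → Fin K → Fin M) :
    ind (A ∪ B) ω = ind A ω * ind B ω := by
  unfold ind
  by_cases h1 : SubS ω A <;> by_cases h2 : SubS ω B <;> simp [SubS.union, h1, h2]

theorem pr_sub {E : Type} [Fintype E] [DecidableEq E] {K M : ℕ} (hM : 0 < M) (A : Finset (E × (Fin K × Fin M))) :
    ∑ ω : E → Fin K → Fin M, ind A ω ≤ (Fintype.card (E → Fin K → Fin M) : ℝ) * (1 / (M : ℝ)) ^ A.card := by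
  classical
  unfold ind
  rw [Finset.sum_boole, one_div, inv_pow, ← div_eq_mul_inv, le_div_iff₀ (by positivity)]
  have := pr_sub_nat (K := K) (M := M) A
  convert (Nat.cast_le (α := ℝ)).2 this using 1
  push_cast
  congr!

theorem card_union_sdiff {X : Type} [DecidableEq X] (A S : Finset X) : (A ∪ S).card = A.card + (S \ A).card := by
  rw [Finset.card_union_eq_card_add_card.2 Finset.disjoint_sdiff |>.symm, Finset.union_sdiff_self_eq_union]

theorem moment {E : Type} [Fintype E] [DecidableEq E] {K M : ℕ} (hM : 0 < M)
    (SS : Finset (Finset (E × (Fin K × Fin M)))) (wt : Finset (E × (Fin K × Fin M)) → ℝ) (hwt : ∀ S ∈ SS, 0 ≤ wt S)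
    (g R : ℕ) (hg : ∀ S ∈ SS, S.card ≤ g) (b : ℝ) (hb0 : 0 ≤ b)
    (hb : ∀ A : Finset (E × (Fin K × Fin M)), A.card ≤ R → ∑ S ∈ SS, wt S * (1 / (M : ℝ)) ^ (S \ A).card ≤ b)
    (r : ℕ) : ∀ A : Finset (E × (Fin K × Fin M)), A.card + r * g ≤ R →
    ∑ ω : E → Fin K → Fin M, ind A ω * (∑ S ∈ SS, wt S * ind S ω) ^ r ≤
      (Fintype.card (E → Fin K → Fin M) : ℝ) * (1 / (M : ℝ)) ^ A.card * b ^ r := by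
  induction r with
  | zero => intro A _; simpa using pr_sub hM A
  | succ r ih =>
    intro A hA
    have e1 : ∀ ω : E → Fin K → Fin M, ind A ω * (∑ S ∈ SS, wt S * ind S ω) ^ (r + 1) =
        ∑ S ∈ SS, wt S * (ind (A ∪ S) ω * (∑ S ∈ SS, wt S * ind S ω) ^ r) := by
      intro ω
      rw [pow_succ, ← mul_assoc, Finset.mul_sum]
      apply Finset.sum_congr rfl
      intro S _
      rw [ind_union]; ring
    simp only [e1]
    rw [Finset.sum_comm]
    simp only [← Finset.mul_sum]
    have hAR : A.card ≤ R := by rw [Nat.add_mul] at hA; omega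
    calc _ ≤ ∑ S ∈ SS, wt S * ((Fintype.card (E → Fin K → Fin M) : ℝ) * (1 / (M : ℝ)) ^ (A ∪ S).card * b ^ r) := by
          apply Finset.sum_le_sum
          intro S hS
          apply mul_le_mul_of_nonneg_left _ (hwt S hS)
          apply ih
          have := Finset.card_union_le A S
          have := hg S hS
          rw [Nat.add_mul] at hA; omega
      _ = (Fintype.card (E → Fin K → Fin M) : ℝ) * (1 / (M : ℝ)) ^ A.card * b ^ r *
          ∑ S ∈ SS, wt S * (1 / (M : ℝ)) ^ (S \ A).card := by
          rw [Finset.mul_sum]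
          apply Finset.sum_congr rfl
          intro S _
          rw [card_union_sdiff, pow_add]; ring
      _ ≤ (Fintype.card (E → Fin K → Fin M) : ℝ) * (1 / (M : ℝ)) ^ A.card * b ^ r * b := by
          apply mul_le_mul_of_nonneg_left (hb A hAR); positivity
      _ = _ := by ring

open Classical in
theorem moment_tail {E : Type} [Fintype E] [DecidableEq E] {K M : ℕ} (hM : 0 < M)
    (SS : Finset (Finset (E × (Fin K × Fin M)))) (wt : Finset (E × (Fin K × Fin M)) → ℝ) (hwt : ∀ S ∈ SS, 0 ≤ wt S)
    (g R : ℕ) (hg : ∀ S ∈ SS, S.card ≤ g) (b : ℝ) (hb0 : 0 < b)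
    (hb : ∀ A : Finset (E × (Fin K × Fin M)), A.card ≤ R → ∑ S ∈ SS, wt S * (1 / (M : ℝ)) ^ (S \ A).card ≤ b)
    (r : ℕ) (hr : r * g ≤ R) :
    ((Finset.univ.filter (fun ω : E → Fin K → Fin M => 2 * b ≤ ∑ S ∈ SS, wt S * ind S ω)).card : ℝ) ≤
      (Fintype.card (E → Fin K → Fin M) : ℝ) * (1 / 2) ^ r := by
  have h := moment hM SS wt hwt g R hg b hb0.le hb r ∅ (by simpa using hr)
  simp only [Finset.card_empty, pow_zero, mul_one] at h
  have h2 : ((Finset.univ.filter (fun ω : E → Fin K → Fin M => 2 * b ≤ ∑ S ∈ SS, wt S * ind S ω)).card : ℝ) * (2 * b) ^ r ≤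
      ∑ ω : E → Fin K → Fin M, ind ∅ ω * (∑ S ∈ SS, wt S * ind S ω) ^ r := by
    rw [← nsmul_eq_mul, ← Finset.sum_const]
    rw [Finset.sum_filter]
    apply Finset.sum_le_sum
    intro ω _
    have : ind ∅ ω = 1 := by simp [ind, SubS]
    rw [this, one_mul]
    have h0 : 0 ≤ ∑ S ∈ SS, wt S * ind S ω := Finset.sum_nonneg fun S hS => mul_nonneg (hwt S hS) (ind_nonneg _ _)
    split_ifs with h3
    · exact pow_le_pow_left₀ (by positivity) h3 r
    · positivity
  have h3 := h2.trans h
  rw [mul_pow, ← mul_assoc] at h3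
  have h4 := le_of_mul_le_mul_right h3 (by positivity)
  rw [one_div, inv_pow, ← div_eq_mul_inv, le_div_iff₀ (by positivity)]
  exact h4

open Classical in
theorem chain_prob {E : Type} [Fintype E] [DecidableEq E] {K M : ℕ} (hM : 0 < M)
    (SS : Finset (Finset (E × (Fin K × Fin M)))) (v : E)
    (g R : ℕ) (hg : ∀ S ∈ SS, S.card ≤ g) (B θ : ℝ) (hB : 1 ≤ B) (hθ : 0 ≤ θ)
    (hatt : ∀ A : Finset (E × (Fin K × Fin M)), A.card ≤ R →
      ∑ S ∈ SS.filter (fun S => Att v A S), (1 / (M : ℝ)) ^ (S \ A).card ≤ B)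
    (hdbl : ∀ A : Finset (E × (Fin K × Fin M)), A.card ≤ R →
      ∑ S ∈ SS.filter (fun S => Dbl v A S), (1 / (M : ℝ)) ^ (S \ A).card ≤ θ)
    (j : ℕ) : ∀ (d : ℕ) (A : Finset (E × (Fin K × Fin M))), A.card + j * g ≤ R →
    ((Finset.univ.filter (fun ω : E → Fin K → Fin M => SubS ω A ∧
      ∃ A', Ev (fun S => S ∈ SS ∧ SubS ω S) v j d A A')).card : ℝ) ≤
      (Fintype.card (E → Fin K → Fin M) : ℝ) * (1 / (M : ℝ)) ^ A.card * ((2 * B) ^ j * θ ^ d) := by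
  induction j with
  | zero =>
    intro d A _
    rcases d with _ | d
    · have h := pr_sub hM A
      simp only [pow_zero, mul_one]
      refine le_trans ?_ h
      unfold ind
      rw [Finset.sum_boole]
      apply Nat.cast_le.2
      apply Finset.card_le_card
      intro ω hω
      simp only [Finset.mem_filter] at hω ⊢
      exact ⟨hω.1, hω.2.1⟩
    · rw [Finset.filter_eq_empty_iff.2]
      · simp only [Finset.card_empty, Nat.cast_zero]; positivity
      · rintro ω - ⟨-, A', h⟩
        cases h
  | succ j ih =>
    intro d A hA
    have hAR : A.card ≤ R := by rw [Nat.add_mul] at hA; omega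
    have hAS : ∀ S ∈ SS, (A ∪ S).card + j * g ≤ R := by
      intro S hS
      have := Finset.card_union_le A S
      have := hg S hS
      rw [Nat.add_mul] at hA; omega
    set N : ℝ := (Fintype.card (E → Fin K → Fin M) : ℝ) with hN
    set Fa := (SS.filter (fun S => Att v A S)).biUnion (fun S => Finset.univ.filter
      (fun ω : E → Fin K → Fin M => SubS ω (A ∪ S) ∧ ∃ A', Ev (fun S => S ∈ SS ∧ SubS ω S) v j d (A ∪ S) A')) with hFa
    set Fd := (SS.filter (fun S => Dbl v A S)).biUnion (fun S => Finset.univ.filter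
      (fun ω : E → Fin K → Fin M => SubS ω (A ∪ S) ∧ 1 ≤ d ∧ ∃ A', Ev (fun S => S ∈ SS ∧ SubS ω S) v j (d - 1) (A ∪ S) A')) with hFd
    have hsub : (Finset.univ.filter (fun ω : E → Fin K → Fin M => SubS ω A ∧
      ∃ A', Ev (fun S => S ∈ SS ∧ SubS ω S) v (j + 1) d A A')) ⊆ Fa ∪ Fd := by
      intro ω hω
      simp only [Finset.mem_filter, Finset.mem_univ, true_and] at hω
      obtain ⟨h1, A', h2⟩ := hω
      simp only [hFa, hFd, Finset.mem_union, Finset.mem_biUnion, Finset.mem_filter, Finset.mem_univ, true_and]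
      cases h2 with
      | att hS ha he => exact Or.inl ⟨_, ⟨hS.1, ha⟩, SubS.union.2 ⟨h1, hS.2⟩, _, he⟩
      | dbl hS ha he => exact Or.inr ⟨_, ⟨hS.1, ha⟩, SubS.union.2 ⟨h1, hS.2⟩, by omega, _, by simpa using he⟩
    have hfa : (Fa.card : ℝ) ≤ N * (1 / (M : ℝ)) ^ A.card * ((2 * B) ^ j * θ ^ d) * B := by
      calc (Fa.card : ℝ) ≤ ∑ S ∈ SS.filter (fun S => Att v A S), ((Finset.univ.filter
          (fun ω : E → Fin K → Fin M => SubS ω (A ∪ S) ∧ ∃ A', Ev (fun S => S ∈ SS ∧ SubS ω S) v j d (A ∪ S) A')).card : ℝ) := by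
            exact_mod_cast Finset.card_biUnion_le
        _ ≤ ∑ S ∈ SS.filter (fun S => Att v A S), N * (1 / (M : ℝ)) ^ (A ∪ S).card * ((2 * B) ^ j * θ ^ d) := by
            apply Finset.sum_le_sum
            intro S hS
            exact ih d (A ∪ S) (hAS S (Finset.mem_filter.1 hS).1)
        _ = N * (1 / (M : ℝ)) ^ A.card * ((2 * B) ^ j * θ ^ d) *
            ∑ S ∈ SS.filter (fun S => Att v A S), (1 / (M : ℝ)) ^ (S \ A).card := by
            rw [Finset.mul_sum]
            apply Finset.sum_congr rfl
            intro S _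
            rw [card_union_sdiff, pow_add]; ring
        _ ≤ _ := by
            apply mul_le_mul_of_nonneg_left (hatt A hAR); positivity
    have hfd : (Fd.card : ℝ) ≤ N * (1 / (M : ℝ)) ^ A.card * ((2 * B) ^ j * θ ^ d) := by
      rcases d with _ | d
      · have : Fd = ∅ := by
          rw [hFd]; ext ω; simp
        rw [this]
        simp only [Finset.card_empty, Nat.cast_zero]; positivity
      calc (Fd.card : ℝ) ≤ ∑ S ∈ SS.filter (fun S => Dbl v A S), ((Finset.univ.filter
          (fun ω : E → Fin K → Fin M => SubS ω (A ∪ S) ∧ 1 ≤ d + 1 ∧ ∃ A', Ev (fun S => S ∈ SS ∧ SubS ω S) v j (d + 1 - 1) (A ∪ S) A')).card : ℝ) := by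
            exact_mod_cast Finset.card_biUnion_le
        _ ≤ ∑ S ∈ SS.filter (fun S => Dbl v A S), N * (1 / (M : ℝ)) ^ (A ∪ S).card * ((2 * B) ^ j * θ ^ d) := by
            apply Finset.sum_le_sum
            intro S hS
            refine le_trans ?_ (ih d (A ∪ S) (hAS S (Finset.mem_filter.1 hS).1))
            apply Nat.cast_le.2
            apply Finset.card_le_card
            intro ω hω
            simp only [Finset.mem_filter, Finset.mem_univ, true_and, add_tsub_cancel_right] at hω ⊢
            exact ⟨hω.1, hω.2.2⟩
        _ = N * (1 / (M : ℝ)) ^ A.card * ((2 * B) ^ j * θ ^ d) *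
            ∑ S ∈ SS.filter (fun S => Dbl v A S), (1 / (M : ℝ)) ^ (S \ A).card := by
            rw [Finset.mul_sum]
            apply Finset.sum_congr rfl
            intro S _
            rw [card_union_sdiff, pow_add]; ring
        _ ≤ N * (1 / (M : ℝ)) ^ A.card * ((2 * B) ^ j * θ ^ d) * θ := by
            apply mul_le_mul_of_nonneg_left (hdbl A hAR); positivity
        _ = _ := by ring
    have h1 : ((Finset.univ.filter (fun ω : E → Fin K → Fin M => SubS ω A ∧
      ∃ A', Ev (fun S => S ∈ SS ∧ SubS ω S) v (j + 1) d A A')).card : ℝ) ≤ Fa.card + Fd.card := by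
      exact_mod_cast (Finset.card_le_card hsub).trans (Finset.card_union_le _ _)
    set X := N * (1 / (M : ℝ)) ^ A.card * ((2 * B) ^ j * θ ^ d) with hX
    have hX0 : 0 ≤ X := by positivity
    have e : N * (1 / (M : ℝ)) ^ A.card * ((2 * B) ^ (j + 1) * θ ^ d) = X * (2 * B) := by rw [hX]; ring
    rw [e]
    nlinarith

structure TSums {E C : Type} [DecidableEq E] [DecidableEq C] (SS : Finset (Finset (E × C))) (t D B θ : ℝ) : Prop where
  t1 : ∀ T : Finset (E × C), T.Nonempty → ∑ S ∈ SS.filter (fun S => T ⊆ S), (1 / t) ^ (S.card - T.card) ≤ B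
  t2 : ∀ u, ∑ S ∈ SS.filter (fun S => u ∈ vs S), (1 / t) ^ S.card ≤ D
  t3 : ∀ T : Finset (E × C), 2 ≤ T.card → ∑ S ∈ SS.filter (fun S => T ⊂ S), (1 / t) ^ (S.card - T.card) ≤ θ
  t4 : ∀ x : E × C, ∀ u, u ≠ x.1 → ∑ S ∈ SS.filter (fun S => x ∈ S ∧ u ∈ vs S), (1 / t) ^ (S.card - 1) ≤ θ
  t5 : ∀ u u', u ≠ u' → ∑ S ∈ SS.filter (fun S => u ∈ vs S ∧ u' ∈ vs S), (1 / t) ^ S.card ≤ θ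
  t6 : ∀ x : E × C, ∑ S ∈ SS.filter (fun S => x ∈ S ∧ S.card = 2), (1 / t) ^ (S.card - 1) ≤ θ
  t7 : ∀ u, ∑ S ∈ SS.filter (fun S => u ∈ vs S ∧ S.card = 2), (1 / t) ^ S.card ≤ θ

theorem sum_cover {X I : Type} [DecidableEq X] (F SS : Finset X) (hF : F ⊆ SS) (J : Finset I) (P : I → X → Prop)
    [∀ i, DecidablePred (P i)] (w : X → ℝ) (w' : I → X → ℝ) (hw' : ∀ i S, 0 ≤ w' i S)
    (h : ∀ S ∈ F, ∃ i ∈ J, P i S ∧ w S ≤ w' i S) (c m : ℝ) (hc0 : 0 ≤ c) (hJ : (J.card : ℝ) ≤ m)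
    (hc : ∀ i ∈ J, ∑ S ∈ SS.filter (P i), w' i S ≤ c) : ∑ S ∈ F, w S ≤ m * c := by
  calc ∑ S ∈ F, w S ≤ ∑ S ∈ F, ∑ i ∈ J, (if P i S then w' i S else 0) := by
        apply Finset.sum_le_sum
        intro S hS
        obtain ⟨i, hi, h1, h2⟩ := h S hS
        refine h2.trans ?_
        have := Finset.single_le_sum (f := fun i => if P i S then w' i S else 0) (s := J)
          (fun i _ => by split_ifs <;> simp [hw']) hi
        simpa [h1] using this
    _ ≤ ∑ S ∈ SS, ∑ i ∈ J, (if P i S then w' i S else 0) := by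
        apply Finset.sum_le_sum_of_subset_of_nonneg hF
        intro S _ _
        apply Finset.sum_nonneg
        intro i _; split_ifs <;> simp [hw']
    _ = ∑ i ∈ J, ∑ S ∈ SS.filter (P i), w' i S := by
        rw [Finset.sum_comm]
        apply Finset.sum_congr rfl
        intro i _
        rw [Finset.sum_filter]
    _ ≤ ∑ i ∈ J, c := Finset.sum_le_sum hc
    _ = J.card * c := by simp
    _ ≤ _ := mul_le_mul_of_nonneg_right hJ hc0

theorem sum_split {X : Type} [DecidableEq X] (F : Finset X) (p1 p2 : X → Prop) [DecidablePred p1] [DecidablePred p2]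
    (w : X → ℝ) (hw : ∀ S, 0 ≤ w S) (h : ∀ S ∈ F, p1 S ∨ p2 S) :
    ∑ S ∈ F, w S ≤ ∑ S ∈ F.filter p1, w S + ∑ S ∈ F.filter p2, w S := by
  rw [Finset.sum_filter, Finset.sum_filter, ← Finset.sum_add_distrib]
  apply Finset.sum_le_sum
  intro S hS
  have := hw S
  rcases h S hS with h | h
  · rw [if_pos h]; split_ifs <;> linarith
  · rw [if_pos h]; split_ifs <;> linarith

section
variable {E C : Type} [DecidableEq E] [DecidableEq C] {SS : Finset (Finset (E × C))} {t D B θ : ℝ}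

theorem card_sdiff_inter (S A : Finset (E × C)) : (S \ A).card = S.card - (S ∩ A).card := by
  have := Finset.card_sdiff_add_card_inter S A; omega

theorem card_insert_vs (v : E) (A : Finset (E × C)) {R : ℕ} (hA : A.card ≤ R) :
    (((insert v (vs A)).card : ℕ) : ℝ) ≤ (R : ℝ) + 1 := by
  have h1 := Finset.card_insert_le v (vs A)
  have h2 : (vs A).card ≤ A.card := Finset.card_image_le
  have : (insert v (vs A)).card ≤ R + 1 := by omega
  exact_mod_cast this

theorem inU_iff {v u : E} {A : Finset (E × C)} : InU v A u ↔ u ∈ insert v (vs A) := by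
  rw [Finset.mem_insert]; exact or_comm

open Classical in
theorem att_sum (h : TSums SS t D B θ) (ht : 0 < t) (hB : 0 ≤ B) (hD : 0 ≤ D) (v : E) {R : ℕ} (A : Finset (E × C)) (hA : A.card ≤ R) :
    ∑ S ∈ SS.filter (fun S => Att v A S), (1 / t) ^ (S \ A).card ≤ 2 ^ R * B + (R + 1) * D := by
  have hp : ∀ n : ℕ, (0 : ℝ) ≤ (1 / t) ^ n := fun n => by positivity
  refine (sum_split _ (fun S => (S ∩ A).Nonempty) (fun S => ¬ (S ∩ A).Nonempty) _ (fun S => hp _) (fun S _ => Classical.em _)).trans ?_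
  apply add_le_add
  · apply sum_cover _ SS ((Finset.filter_subset _ _).trans (Finset.filter_subset _ _)) (A.powerset.filter (fun T => T.Nonempty))
      (fun T S => T ⊆ S) _ (fun T S => (1 / t) ^ (S.card - T.card)) (fun _ _ => hp _) _ _ _ hB
    · have h1 := Finset.card_filter_le A.powerset (fun T => T.Nonempty)
      rw [Finset.card_powerset] at h1
      have h2 := Nat.pow_le_pow_right (n := 2) (by norm_num) hA
      exact_mod_cast h1.trans h2
    · intro T hT
      exact h.t1 T (Finset.mem_filter.1 hT).2
    · intro S hS
      refine ⟨S ∩ A, ?_, Finset.inter_subset_left, ?_⟩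
      · rw [Finset.mem_filter, Finset.mem_powerset]; exact ⟨Finset.inter_subset_right, (Finset.mem_filter.1 hS).2⟩
      · rw [card_sdiff_inter]
  · apply sum_cover _ SS ((Finset.filter_subset _ _).trans (Finset.filter_subset _ _)) (insert v (vs A))
      (fun u S => u ∈ vs S) _ (fun u S => (1 / t) ^ S.card) (fun _ _ => hp _) _ _ _ hD
    · exact card_insert_vs v A hA
    · intro u _; exact h.t2 u
    · intro S hS
      rw [Finset.mem_filter, Finset.mem_filter] at hS
      obtain ⟨u, hu, hu'⟩ := hS.1.2
      refine ⟨u, inU_iff.1 hu', hu, ?_⟩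
      rw [card_sdiff_inter, Finset.not_nonempty_iff_eq_empty.1 hS.2]; simp

set_option maxHeartbeats 1000000 in
open Classical in
theorem dbl_sum (h : TSums SS t D B θ) (ht : 0 < t) (hθ : 0 ≤ θ) (v : E) {R : ℕ} (A : Finset (E × C)) (hA : A.card ≤ R) :
    ∑ S ∈ SS.filter (fun S => Dbl v A S), (1 / t) ^ (S \ A).card ≤
      2 ^ R * θ + ((R * (R + 1) * θ + R * θ) + ((R + 1) * (R + 1) * θ + (R + 1) * θ)) := by
  have hp : ∀ n : ℕ, (0 : ℝ) ≤ (1 / t) ^ n := fun n => by positivity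
  have hAR : (A.card : ℝ) ≤ R := by exact_mod_cast hA
  have hU := card_insert_vs v A hA
  refine (sum_split _ (fun S => 2 ≤ (S ∩ A).card) (fun S => ¬ 2 ≤ (S ∩ A).card) _ (fun S => hp _) (fun S _ => Classical.em _)).trans ?_
  apply add_le_add
  · apply sum_cover _ SS ((Finset.filter_subset _ _).trans (Finset.filter_subset _ _)) (A.powerset.filter (fun T => 2 ≤ T.card))
      (fun T S => T ⊂ S) _ (fun T S => (1 / t) ^ (S.card - T.card)) (fun _ _ => hp _) _ _ _ hθ
    · have h1 := Finset.card_filter_le A.powerset (fun T => 2 ≤ T.card)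
      rw [Finset.card_powerset] at h1
      have h2 := Nat.pow_le_pow_right (n := 2) (by norm_num) hA
      exact_mod_cast h1.trans h2
    · intro T hT
      exact h.t3 T (Finset.mem_filter.1 hT).2
    · intro S hS
      rw [Finset.mem_filter, Finset.mem_filter] at hS
      refine ⟨S ∩ A, ?_, ⟨Finset.inter_subset_left, ?_⟩, ?_⟩
      · rw [Finset.mem_filter, Finset.mem_powerset]; exact ⟨Finset.inter_subset_right, hS.2⟩
      · intro hc; exact hS.1.2.1 (hc.trans Finset.inter_subset_right)
      · rw [card_sdiff_inter]
  refine (sum_split _ (fun S => (S ∩ A).card = 1) (fun S => (S ∩ A).card = 0) _ (fun S => hp _) ?_).trans ?_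
  · intro S hS
    have := (Finset.mem_filter.1 hS).2
    omega
  apply add_le_add
  · refine (sum_split _ (fun S => S.card ≠ 2) (fun S => S.card = 2) _ (fun S => hp _) (fun S _ => (Classical.em _).symm)).trans ?_
    apply add_le_add
    · apply sum_cover _ SS ((Finset.filter_subset _ _).trans ((Finset.filter_subset _ _).trans ((Finset.filter_subset _ _).trans (Finset.filter_subset _ _))))
        ((A ×ˢ (insert v (vs A))).filter (fun p => p.2 ≠ p.1.1))
        (fun p S => p.1 ∈ S ∧ p.2 ∈ vs S) _ (fun p S => (1 / t) ^ (S.card - 1)) (fun _ _ => hp _) _ _ _ hθ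
      · have h1 := Finset.card_filter_le (A ×ˢ (insert v (vs A))) (fun p => p.2 ≠ p.1.1)
        rw [Finset.card_product] at h1
        calc _ ≤ (A.card : ℝ) * ((insert v (vs A)).card : ℝ) := by exact_mod_cast h1
          _ ≤ _ := mul_le_mul hAR hU (by positivity) (by positivity)
      · intro p hp'
        exact h.t4 p.1 p.2 (Finset.mem_filter.1 hp').2
      · intro S hS
        simp only [Finset.mem_filter] at hS
        obtain ⟨⟨⟨⟨hSS, hd⟩, -⟩, h1⟩, h2⟩ := hS
        obtain ⟨x, hx⟩ := Finset.card_eq_one.1 h1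
        have hxm : x ∈ S ∩ A := by rw [hx]; simp
        rw [Finset.mem_inter] at hxm
        rcases hd.2 with ⟨u, hu, u', hu', hne, iu, iu'⟩ | hd
        · rw [inU_iff] at iu iu'
          by_cases hux : u = x.1
          · refine ⟨(x, u'), ?_, ⟨hxm.1, hu'⟩, ?_⟩
            · simp only [Finset.mem_filter, Finset.mem_product]
              exact ⟨⟨hxm.2, iu'⟩, fun h => hne (by rw [hux, h])⟩
            · rw [card_sdiff_inter, h1]
          · refine ⟨(x, u), ?_, ⟨hxm.1, hu⟩, ?_⟩
            · simp only [Finset.mem_filter, Finset.mem_product]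
              exact ⟨⟨hxm.2, iu⟩, hux⟩
            · rw [card_sdiff_inter, h1]
        · exact absurd hd.1 h2
    · apply sum_cover _ SS ((Finset.filter_subset _ _).trans ((Finset.filter_subset _ _).trans ((Finset.filter_subset _ _).trans (Finset.filter_subset _ _)))) A
        (fun x S => x ∈ S ∧ S.card = 2) _ (fun p S => (1 / t) ^ (S.card - 1)) (fun _ _ => hp _) _ _ _ hθ
      · exact hAR
      · intro x _; exact h.t6 x
      · intro S hS
        simp only [Finset.mem_filter] at hS
        obtain ⟨⟨⟨⟨hSS, hd⟩, -⟩, h1⟩, h2⟩ := hS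
        obtain ⟨x, hx⟩ := Finset.card_eq_one.1 h1
        have hxm : x ∈ S ∩ A := by rw [hx]; simp
        rw [Finset.mem_inter] at hxm
        exact ⟨x, hxm.2, ⟨hxm.1, h2⟩, by rw [card_sdiff_inter, h1]⟩
  · refine (sum_split _ (fun S => S.card ≠ 2) (fun S => S.card = 2) _ (fun S => hp _) (fun S _ => (Classical.em _).symm)).trans ?_
    apply add_le_add
    · apply sum_cover _ SS ((Finset.filter_subset _ _).trans ((Finset.filter_subset _ _).trans ((Finset.filter_subset _ _).trans (Finset.filter_subset _ _))))
        (((insert v (vs A)) ×ˢ (insert v (vs A))).filter (fun p => p.1 ≠ p.2))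
        (fun p S => p.1 ∈ vs S ∧ p.2 ∈ vs S) _ (fun p S => (1 / t) ^ S.card) (fun _ _ => hp _) _ _ _ hθ
      · have h1 := Finset.card_filter_le ((insert v (vs A)) ×ˢ (insert v (vs A))) (fun p => p.1 ≠ p.2)
        rw [Finset.card_product] at h1
        calc _ ≤ ((insert v (vs A)).card : ℝ) * ((insert v (vs A)).card : ℝ) := by exact_mod_cast h1
          _ ≤ _ := mul_le_mul hU hU (by positivity) (by positivity)
      · intro p hp'
        exact h.t5 p.1 p.2 (Finset.mem_filter.1 hp').2
      · intro S hS
        simp only [Finset.mem_filter] at hS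
        obtain ⟨⟨⟨⟨hSS, hd⟩, -⟩, h1⟩, h2⟩ := hS
        rcases hd.2 with ⟨u, hu, u', hu', hne, iu, iu'⟩ | hd
        · rw [inU_iff] at iu iu'
          refine ⟨(u, u'), ?_, ⟨hu, hu'⟩, ?_⟩
          · simp only [Finset.mem_filter, Finset.mem_product]
            exact ⟨⟨iu, iu'⟩, hne⟩
          · rw [card_sdiff_inter, h1]; simp
        · exact absurd hd.1 h2
    · apply sum_cover _ SS ((Finset.filter_subset _ _).trans ((Finset.filter_subset _ _).trans ((Finset.filter_subset _ _).trans (Finset.filter_subset _ _)))) (insert v (vs A))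
        (fun u S => u ∈ vs S ∧ S.card = 2) _ (fun p S => (1 / t) ^ S.card) (fun _ _ => hp _) _ _ _ hθ
      · exact hU
      · intro x _; exact h.t7 x
      · intro S hS
        simp only [Finset.mem_filter] at hS
        obtain ⟨⟨⟨⟨hSS, hd⟩, -⟩, h1⟩, h2⟩ := hS
        obtain ⟨u, hu, iu⟩ := hd.att
        exact ⟨u, inU_iff.1 iu, ⟨hu, h2⟩, by rw [card_sdiff_inter, h1]; simp⟩

theorem card_small_subsets {X : Type} [DecidableEq X] (A : Finset X) (g : ℕ) :
    (A.powerset.filter (fun T => T.card ≤ g)).card ≤ (A.card + 1) ^ g := by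
  have h1 : A.powerset.filter (fun T => T.card ≤ g) ⊆ (Finset.range (g + 1)).biUnion (fun i => A.powersetCard i) := by
    intro T hT
    simp only [Finset.mem_filter, Finset.mem_powerset] at hT
    simp only [Finset.mem_biUnion, Finset.mem_range, Finset.mem_powersetCard]
    exact ⟨T.card, by omega, hT.1, rfl⟩
  refine (Finset.card_le_card h1).trans (Finset.card_biUnion_le.trans ?_)
  rw [add_pow]
  apply Finset.sum_le_sum
  intro i hi
  rw [Finset.card_powersetCard, one_pow, mul_one]
  have h2 : 0 < g.choose i := Nat.choose_pos (by rw [Finset.mem_range] at hi; omega)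
  calc A.card.choose i ≤ A.card ^ i := Nat.choose_le_pow _ _
    _ ≤ _ := Nat.le_mul_of_pos_right _ h2

open Classical in
theorem deg_sum (h : TSums SS t D B θ) (ht : 0 < t) (hB : 0 ≤ B) (hD : 0 ≤ D) (v : E) {R g : ℕ} {K M : ℝ} (hK : 1 ≤ K) (hM : 0 < M)
    (hKM : t = K * M) (hg : ∀ S ∈ SS, S.card ≤ g) (hg2 : ∀ S ∈ SS, 2 ≤ S.card) (A : Finset (E × C)) (hA : A.card ≤ R) :
    ∑ S ∈ SS.filter (fun S => v ∈ vs S), (4 / K) ^ (S.card - 1) * (1 / M) ^ (S \ A).card ≤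
      4 ^ g * (K * D + ((R : ℝ) + 1) ^ g * B) := by
  have hp : ∀ n : ℕ, (0 : ℝ) ≤ (1 / t) ^ n := fun n => by positivity
  have hK0 : 0 < K := by linarith
  have hMt : 1 / M = K * (1 / t) := by rw [hKM]; field_simp
  have key : ∀ S ∈ SS, ∀ j ≤ S.card, (4 / K) ^ (S.card - 1) * (1 / M) ^ j ≤
      (if j = S.card then 4 ^ g * K else 4 ^ g) * (1 / t) ^ j := by
    intro S hS j hj
    have h2 := hg2 S hS
    have hgS := hg S hS
    rw [hMt, mul_pow, ← mul_assoc]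
    apply mul_le_mul_of_nonneg_right _ (hp _)
    have h4 : (4 : ℝ) ^ (S.card - 1) ≤ 4 ^ g := pow_le_pow_right₀ (by norm_num) (by omega)
    rw [div_pow]
    split_ifs with hjs
    · subst hjs
      have : K ^ S.card = K ^ (S.card - 1) * K := by rw [← pow_succ]; congr 1; omega
      rw [this]
      calc (4 : ℝ) ^ (S.card - 1) / K ^ (S.card - 1) * (K ^ (S.card - 1) * K) = 4 ^ (S.card - 1) * K := by
            field_simp
        _ ≤ _ := mul_le_mul_of_nonneg_right h4 hK0.le
    · have h5 : K ^ j ≤ K ^ (S.card - 1) := pow_le_pow_right₀ hK (by omega)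
      calc (4 : ℝ) ^ (S.card - 1) / K ^ (S.card - 1) * K ^ j ≤ 4 ^ (S.card - 1) / K ^ (S.card - 1) * K ^ (S.card - 1) :=
            mul_le_mul_of_nonneg_left h5 (by positivity)
        _ = 4 ^ (S.card - 1) := by field_simp
        _ ≤ _ := h4
  refine (sum_split _ (fun S => S ∩ A = ∅) (fun S => ¬ S ∩ A = ∅) _ (fun S => by positivity) (fun S _ => Classical.em _)).trans ?_
  rw [mul_add]
  apply add_le_add
  · calc _ ≤ ∑ S ∈ SS.filter (fun S => v ∈ vs S), 4 ^ g * K * (1 / t) ^ S.card := by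
          refine le_trans (Finset.sum_le_sum (g := fun S => 4 ^ g * K * (1 / t) ^ S.card) ?_) (Finset.sum_le_sum_of_subset_of_nonneg (Finset.filter_subset _ _) (fun S _ _ => by positivity))
          intro S hS
          rw [Finset.mem_filter, Finset.mem_filter] at hS
          have := key S hS.1.1 S.card le_rfl
          rw [if_pos rfl] at this
          rwa [card_sdiff_inter, hS.2, Finset.card_empty, Nat.sub_zero]
      _ = 4 ^ g * K * ∑ S ∈ SS.filter (fun S => v ∈ vs S), (1 / t) ^ S.card := by rw [Finset.mul_sum]
      _ ≤ 4 ^ g * K * D := mul_le_mul_of_nonneg_left (h.t2 v) (by positivity)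
      _ = _ := by ring
  · rw [show (4 : ℝ) ^ g * (((R : ℝ) + 1) ^ g * B) = ((R : ℝ) + 1) ^ g * (4 ^ g * B) by ring]
    apply sum_cover _ SS ((Finset.filter_subset _ _).trans (Finset.filter_subset _ _))
      (A.powerset.filter (fun T => T.card ≤ g ∧ T.Nonempty))
      (fun T S => T ⊆ S) _ (fun T S => 4 ^ g * (1 / t) ^ (S.card - T.card)) (fun _ _ => by positivity) _ _ _ (by positivity)
    · have h1 := card_small_subsets A g
      have h2 : (A.powerset.filter (fun T => T.card ≤ g ∧ T.Nonempty)).card ≤ (A.powerset.filter (fun T => T.card ≤ g)).card := by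
        apply Finset.card_le_card
        intro T hT
        simp only [Finset.mem_filter] at hT ⊢
        exact ⟨hT.1, hT.2.1⟩
      have h3 : (A.card + 1) ^ g ≤ (R + 1) ^ g := Nat.pow_le_pow_left (by omega) g
      exact_mod_cast (h2.trans h1).trans h3
    · intro T hT
      rw [← Finset.mul_sum]
      exact mul_le_mul_of_nonneg_left (h.t1 T (Finset.mem_filter.1 hT).2.2) (by positivity)
    · intro S hS
      rw [Finset.mem_filter, Finset.mem_filter] at hS
      have hne : (S ∩ A).Nonempty := Finset.nonempty_iff_ne_empty.2 hS.2
      refine ⟨S ∩ A, ?_, Finset.inter_subset_left, ?_⟩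
      · rw [Finset.mem_filter, Finset.mem_powerset]
        exact ⟨Finset.inter_subset_right, (Finset.card_le_card Finset.inter_subset_left).trans (hg S hS.1.1), hne⟩
      · rw [card_sdiff_inter]
        have hc : (S ∩ A).card ≤ S.card := Finset.card_le_card Finset.inter_subset_left
        have := key S hS.1.1 (S.card - (S ∩ A).card) (by omega)
        rwa [if_neg (by have := hne.card_pos; have := hg2 S hS.1.1; omega)] at this

theorem M_sum {g : ℕ} {K M : ℝ} (hK : 1 ≤ K) (hM : 0 < M) (hKM : t = K * M) (F : Finset (Finset (E × C)))
    (hg : ∀ S ∈ F, S.card ≤ g) (A : Finset (E × C)) {c : ℝ} (hc : ∑ S ∈ F, (1 / t) ^ (S \ A).card ≤ c) :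
    ∑ S ∈ F, (1 / M) ^ (S \ A).card ≤ K ^ g * c := by
  have hMt : 1 / M = K * (1 / t) := by rw [hKM]; field_simp
  have ht : 0 < t := by rw [hKM]; positivity
  refine le_trans ?_ (mul_le_mul_of_nonneg_left hc (by positivity))
  rw [Finset.mul_sum]
  apply Finset.sum_le_sum
  intro S hS
  rw [hMt, mul_pow]
  apply mul_le_mul_of_nonneg_right _ (by positivity)
  apply pow_le_pow_right₀ hK
  exact (Finset.card_le_card Finset.sdiff_subset).trans (hg S hS)
end

open Classical in
theorem main_T1 {E : Type} [Fintype E] [DecidableEq E] {K M : ℕ} (hK : 1 ≤ K) (hM : 0 < M)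
    (SS : Finset (Finset (E × (Fin K × Fin M)))) (hfun : ∀ S ∈ SS, Functional S) (g : ℕ)
    (hg : ∀ S ∈ SS, S.card ≤ g) (h2 : ∀ S ∈ SS, 2 ≤ S.card) (hanti : ∀ S ∈ SS, ∀ S' ∈ SS, S ⊆ S' → S = S')
    {t D B θ : ℝ} (ht : t = (K : ℝ) * M) (hTS : TSums SS t D B θ) (hB : 0 ≤ B) (hD : 0 ≤ D) (hθ : 0 ≤ θ)
    (r r' : ℕ) {Bc θc b L η : ℝ} (hBc1 : 1 ≤ Bc) (hθc0 : 0 ≤ θc)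
    (hBc : (K : ℝ) ^ g * (2 ^ (4 * r * g) * B + (((4 * r * g : ℕ) : ℝ) + 1) * D) ≤ Bc)
    (hθc : (K : ℝ) ^ g * (2 ^ (4 * r * g) * θ + (((4 * r * g : ℕ) * ((4 * r * g : ℕ) + 1) * θ + (4 * r * g : ℕ) * θ)
      + (((4 * r * g : ℕ) + 1) * ((4 * r * g : ℕ) + 1) * θ + ((4 * r * g : ℕ) + 1) * θ))) ≤ θc)
    (hun : (Fintype.card E : ℝ) * ((2 * Bc) ^ (4 * r) * θc ^ r + (1 / 2) ^ r') < 1)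
    (hK4 : 4 * (4 * r * g) ≤ K) (hb0 : 0 < b)
    (hb : 4 ^ g * (K * D + (((r' * g : ℕ) : ℝ) + 1) ^ g * B) ≤ b) (hbL : 2 * b ≤ L * K / 16) (hL : 0 < L)
    (hη : η = Real.exp (-L) / 8) (hKL : 2 * Real.exp L / K ≤ 1 / 2)
    (hE : (Fintype.card E : ℝ) * Real.exp (-(11 / 16 * (η * K))) < Real.exp (-(4 / 7 * (η * K)))) :
    ∃ φ : E → Fin K × Fin M, ∀ S ∈ SS, ¬ ∀ z ∈ S, φ z.1 = z.2 := by
  have hKr : (1 : ℝ) ≤ K := by exact_mod_cast hK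
  have hMr : (0 : ℝ) < M := by exact_mod_cast hM
  have ht0 : 0 < t := by rw [ht]; positivity
  haveI : Nonempty (Fin M) := ⟨⟨0, hM⟩⟩
  set wt : Finset (E × (Fin K × Fin M)) → ℝ := fun S => (4 / (K : ℝ)) ^ (S.card - 1) with hwt
  set bad1 : E → Finset (E → Fin K → Fin M) := fun v => Finset.univ.filter (fun ω => SubS ω ∅ ∧
      ∃ A', Ev (fun S => S ∈ SS ∧ SubS ω S) v (4 * r) r ∅ A') with hbad1
  set bad2 : E → Finset (E → Fin K → Fin M) := fun v => Finset.univ.filter (fun ω =>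
      2 * b ≤ ∑ S ∈ SS.filter (fun S => v ∈ vs S), wt S * ind S ω) with hbad2
  have hc1 : ∀ v, ((bad1 v).card : ℝ) ≤ (Fintype.card (E → Fin K → Fin M) : ℝ) * ((2 * Bc) ^ (4 * r) * θc ^ r) := by
    intro v
    have := chain_prob hM SS v g (4 * r * g) hg Bc θc hBc1 hθc0
      (fun A hA => (M_sum hKr hMr ht _ (fun S hS => hg S (Finset.mem_filter.1 hS).1) A
        (att_sum hTS ht0 hB hD v A hA)).trans hBc)
      (fun A hA => (M_sum hKr hMr ht _ (fun S hS => hg S (Finset.mem_filter.1 hS).1) A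
        (dbl_sum hTS ht0 hθ v A hA)).trans hθc) (4 * r) r ∅ (by simp)
    simpa [hbad1] using this
  have hc2 : ∀ v, ((bad2 v).card : ℝ) ≤ (Fintype.card (E → Fin K → Fin M) : ℝ) * (1 / 2) ^ r' := by
    intro v
    refine moment_tail hM (SS.filter (fun S => v ∈ vs S)) wt (fun S _ => by positivity) g (r' * g)
      (fun S hS => hg S (Finset.mem_filter.1 hS).1) b hb0 (fun A hA => ?_) r' le_rfl
    exact (deg_sum hTS ht0 hB hD v hKr hMr ht hg h2 A hA).trans hb
  obtain ⟨ω, hω⟩ : ∃ ω, ω ∉ Finset.univ.biUnion (fun v => bad1 v ∪ bad2 v) := by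
    by_contra hcon
    push Not at hcon
    have hΩ : (0 : ℝ) < Fintype.card (E → Fin K → Fin M) := by
      have : 0 < Fintype.card (E → Fin K → Fin M) := Fintype.card_pos
      exact_mod_cast this
    have h1 : (Fintype.card (E → Fin K → Fin M) : ℝ) ≤ ∑ v : E, ((bad1 v).card + (bad2 v).card : ℝ) := by
      have : Fintype.card (E → Fin K → Fin M) ≤ ∑ v : E, ((bad1 v).card + (bad2 v).card) := by
        calc Fintype.card (E → Fin K → Fin M) = (Finset.univ.biUnion (fun v => bad1 v ∪ bad2 v)).card := by
              rw [Finset.eq_univ_iff_forall.2 hcon, Finset.card_univ]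
          _ ≤ ∑ v : E, (bad1 v ∪ bad2 v).card := Finset.card_biUnion_le
          _ ≤ _ := Finset.sum_le_sum (fun v _ => Finset.card_union_le _ _)
      exact_mod_cast this
    have h3 : ∑ v : E, ((bad1 v).card + (bad2 v).card : ℝ) ≤
        ∑ v : E, (Fintype.card (E → Fin K → Fin M) : ℝ) * ((2 * Bc) ^ (4 * r) * θc ^ r + (1 / 2) ^ r') := by
      apply Finset.sum_le_sum
      intro v _
      rw [mul_add]
      exact add_le_add (hc1 v) (hc2 v)
    rw [Finset.sum_const, Finset.card_univ, nsmul_eq_mul] at h3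
    have h4 := mul_lt_mul_of_pos_left hun hΩ
    have : (Fintype.card E : ℝ) * ((Fintype.card (E → Fin K → Fin M) : ℝ) * ((2 * Bc) ^ (4 * r) * θc ^ r + (1 / 2) ^ r'))
      = (Fintype.card (E → Fin K → Fin M) : ℝ) * ((Fintype.card E : ℝ) * ((2 * Bc) ^ (4 * r) * θc ^ r + (1 / 2) ^ r')) := by ring
    linarith
  simp only [Finset.mem_biUnion, Finset.mem_univ, true_and, Finset.mem_union, not_exists, not_or] at hω
  set Q : Finset (E × (Fin K × Fin M)) → Prop := fun S => S ∈ SS ∧ SubS ω S with hQ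
  have hno : ∀ v, ¬ ∃ A', Ev Q v (4 * r) r ∅ A' := by
    intro v hv
    apply (hω v).1
    simp only [hbad1, Finset.mem_filter, Finset.mem_univ, true_and]
    exact ⟨fun x hx => by simp at hx, hv⟩
  have hZ : ∀ v, ∑ S ∈ SS.filter (fun S => v ∈ vs S), wt S * ind S ω < 2 * b := by
    intro v
    have := (hω v).2
    simp only [hbad2, Finset.mem_filter, Finset.mem_univ, true_and, not_le] at this
    exact this
  have hQf : ∀ S, Q S → Functional S := fun S hS => hfun S hS.1
  have hQ2 : ∀ S, Q S → 2 ≤ S.card := fun S hS => h2 S hS.1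
  set P : E → Finset (Fin K × Fin M) := fun v => Finset.univ.filter (fun c => ω v c.1 = c.2 ∧ ¬ BadP Q (v, c)) with hP
  set Sf := SS.filter (fun S => Surv Q S) with hSf
  have hLU : LinkU Sf := surv_linkU hQf hQ2 (fun S S' h h' => hanti S h.1 S' h'.1) Sf (fun S hS => (Finset.mem_filter.1 hS).2)
  have hPc : ∀ v, 3 * (K : ℝ) / 4 ≤ (P v).card := by
    intro v
    obtain ⟨A, hA, hAΓ⟩ := bad_small (fun S hS => hg S hS.1) (hno v)
    have hsub : (Finset.univ.image (fun i : Fin K => (i, ω v i))) ⊆ P v ∪ A.image Prod.snd := by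
      intro c hc
      simp only [Finset.mem_image, Finset.mem_univ, true_and] at hc
      obtain ⟨i, rfl⟩ := hc
      by_cases hbp : BadP Q (v, (i, ω v i))
      · apply Finset.mem_union_right
        obtain ⟨Γ, h1, h2⟩ := hbp
        exact Finset.mem_image.2 ⟨_, hAΓ Γ h1 h2, rfl⟩
      · apply Finset.mem_union_left
        simp only [hP, Finset.mem_filter, Finset.mem_univ, true_and]
        exact hbp
    have h1 := (Finset.card_le_card hsub).trans (Finset.card_union_le _ _)
    rw [Finset.card_image_of_injective _ (fun i j hij => (Prod.ext_iff.1 hij).1), Finset.card_univ, Fintype.card_fin] at h1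
    have h3 : (A.image Prod.snd).card ≤ A.card := Finset.card_image_le
    have h5 : 3 * K ≤ 4 * (P v).card := by omega
    have h6 : (3 : ℝ) * K ≤ 4 * (P v).card := by exact_mod_cast h5
    linarith
  obtain ⟨φ, hφP, hφ⟩ := coloring_T2 Sf P (K := K) (L := L) (η := η) (by linarith) hL hη hKL
    (fun S hS => hfun S (Finset.mem_filter.1 hS).1) (fun S hS => h2 S (Finset.mem_filter.1 hS).1) hLU hPc
    (by
      intro v
      refine le_trans ?_ ((hZ v).le.trans hbL)
      rw [← Finset.sum_biUnion]
      · refine le_trans (Finset.sum_le_sum (g := fun S => wt S * ind S ω) ?_)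
          (Finset.sum_le_sum_of_subset_of_nonneg ?_ ?_)
        · intro S hS
          simp only [Finset.mem_biUnion, Finset.mem_filter, hSf] at hS
          obtain ⟨c, -, ⟨-, hs⟩, -⟩ := hS
          have : SubS ω S := hs.1.2
          simp [ind, this, hwt]
        · intro S hS
          simp only [Finset.mem_biUnion, Finset.mem_filter, hSf] at hS
          obtain ⟨c, -, ⟨hs, -⟩, hm⟩ := hS
          rw [Finset.mem_filter]
          exact ⟨hs, mem_vs_of hm⟩
        · intro S _ _
          exact mul_nonneg (by positivity) (ind_nonneg _ _)
      · intro c _ c' _ hne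
        rw [Function.onFun, Finset.disjoint_left]
        intro S hS hS'
        rw [Finset.mem_filter] at hS hS'
        exact hne (hfun S (Finset.mem_filter.1 hS.1).1 v c c' hS.2 hS'.2)) hE
  refine ⟨φ, fun S hS hall => ?_⟩
  refine hφ S ?_ hall
  rw [hSf, Finset.mem_filter]
  have hPm : ∀ z ∈ S, ω z.1 z.2.1 = z.2.2 ∧ ¬ BadP Q z := by
    intro z hz
    have := hφP z.1
    rw [hall z hz] at this
    simpa [hP] using this
  exact ⟨hS, ⟨hS, fun z hz => (hPm z hz).1⟩, fun z hz => (hPm z hz).2⟩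

theorem sum_small_subsets {X : Type} [DecidableEq X] (U : Finset X) (g a N : ℕ) (ha : 1 ≤ a) (hN : 0 < N) (hU : U.card ≤ a * N) :
    ∑ Y ∈ U.powerset.filter (fun Y => Y.card ≤ g), (1 / (N : ℝ)) ^ Y.card ≤ ((g : ℝ) + 1) * (a : ℝ) ^ g := by
  have hNr : (0 : ℝ) < N := by exact_mod_cast hN
  have har : (1 : ℝ) ≤ a := by exact_mod_cast ha
  have hmap : ∀ Y ∈ U.powerset.filter (fun Y => Y.card ≤ g), Y.card ∈ Finset.range (g + 1) := by
    intro Y hY; rw [Finset.mem_range]; have := (Finset.mem_filter.1 hY).2; omega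
  rw [← Finset.sum_fiberwise_of_maps_to hmap]
  calc _ ≤ ∑ i ∈ Finset.range (g + 1), (a : ℝ) ^ g := by
        apply Finset.sum_le_sum
        intro i hi
        rw [Finset.mem_range] at hi
        calc _ ≤ ∑ Y ∈ U.powersetCard i, (1 / (N : ℝ)) ^ i := by
              refine le_trans (le_of_eq (Finset.sum_congr rfl (g := fun Y => (1 / (N : ℝ)) ^ i) ?_))
                (Finset.sum_le_sum_of_subset_of_nonneg ?_ (fun _ _ _ => by positivity))
              · intro Y hY; rw [(Finset.mem_filter.1 hY).2]
              · intro Y hY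
                simp only [Finset.mem_filter, Finset.mem_powerset] at hY
                rw [Finset.mem_powersetCard]; exact ⟨hY.1.1, hY.2⟩
          _ = (U.card.choose i : ℝ) * (1 / (N : ℝ)) ^ i := by
              rw [Finset.sum_const, Finset.card_powersetCard, nsmul_eq_mul]
          _ ≤ ((a : ℝ) * N) ^ i * (1 / (N : ℝ)) ^ i := by
              apply mul_le_mul_of_nonneg_right _ (by positivity)
              have : U.card.choose i ≤ (a * N) ^ i := (Nat.choose_le_pow _ _).trans (Nat.pow_le_pow_left hU i)
              exact_mod_cast this
          _ = (a : ℝ) ^ i := by rw [mul_pow, one_div, inv_pow]; field_simp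
          _ ≤ _ := pow_le_pow_right₀ har (by omega)
    _ = _ := by simp

theorem sum_small_supersets {X : Type} [DecidableEq X] (U W0 : Finset X) (g a N : ℕ) (ha : 1 ≤ a) (hN : 0 < N) (hU : U.card ≤ a * N) :
    ∑ W ∈ U.powerset.filter (fun W => W0 ⊆ W ∧ W.card ≤ g), (1 / (N : ℝ)) ^ (W.card - W0.card) ≤ ((g : ℝ) + 1) * (a : ℝ) ^ g := by
  refine le_trans ?_ (sum_small_subsets U g a N ha hN hU)
  have hinj : ∀ x ∈ U.powerset.filter (fun W => W0 ⊆ W ∧ W.card ≤ g), ∀ y ∈ U.powerset.filter (fun W => W0 ⊆ W ∧ W.card ≤ g),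
      x \ W0 = y \ W0 → x = y := by
    intro x hx y hy h
    have h1 := (Finset.mem_filter.1 hx).2.1
    have h2 := (Finset.mem_filter.1 hy).2.1
    rw [← Finset.sdiff_union_of_subset h1, h, Finset.sdiff_union_of_subset h2]
  rw [Finset.sum_congr rfl (g := fun W => (1 / (N : ℝ)) ^ (W \ W0).card)]
  · rw [← Finset.sum_image (f := fun Y : Finset X => (1 / (N : ℝ)) ^ Y.card) hinj]
    apply Finset.sum_le_sum_of_subset_of_nonneg _ (fun _ _ _ => by positivity)
    intro Y hY
    rw [Finset.mem_image] at hY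
    obtain ⟨W, hW, rfl⟩ := hY
    simp only [Finset.mem_filter, Finset.mem_powerset] at hW ⊢
    exact ⟨Finset.sdiff_subset.trans hW.1, (Finset.card_le_card Finset.sdiff_subset).trans hW.2.2⟩
  · intro W hW
    rw [Finset.card_sdiff_of_subset (Finset.mem_filter.1 hW).2.1]

section
variable {n : ℕ} {G : Finset (Finset (Fin n))} {C : Type} [Fintype C] [DecidableEq C]

def Vx (S : Finset ({e // e ∈ G} × C)) : Finset (Fin n) := S.biUnion (fun x => x.1.1)

def cl (col : {e // e ∈ G} → C → ℕ) (S : Finset ({e // e ∈ G} × C)) : Finset ℕ := S.image (fun x => col x.1 x.2)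

def rep (col : {e // e ∈ G} → C → ℕ) (S : Finset ({e // e ∈ G} × C)) : ℕ := S.card - (cl col S).card

theorem cl_le (col : {e // e ∈ G} → C → ℕ) (S : Finset ({e // e ∈ G} × C)) : (cl col S).card ≤ S.card :=
  Finset.card_image_le

theorem cl_mono (col : {e // e ∈ G} → C → ℕ) {T S : Finset ({e // e ∈ G} × C)} (h : T ⊆ S) : cl col T ⊆ cl col S :=
  Finset.image_subset_image h

theorem Vx_mono {T S : Finset ({e // e ∈ G} × C)} (h : T ⊆ S) : Vx T ⊆ Vx S :=
  Finset.biUnion_subset_biUnion_of_subset_left _ h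

theorem cl_card_le (col : {e // e ∈ G} → C → ℕ) {T S : Finset ({e // e ∈ G} × C)} (h : T ⊆ S) :
    (cl col S).card + T.card ≤ (cl col T).card + S.card := by
  have h1 : cl col S ⊆ cl col T ∪ cl col (S \ T) := by
    intro c hc
    simp only [cl, Finset.mem_image, Finset.mem_union, Finset.mem_sdiff] at hc ⊢
    obtain ⟨x, hx, rfl⟩ := hc
    by_cases hT : x ∈ T
    · exact Or.inl ⟨x, hT, rfl⟩
    · exact Or.inr ⟨x, ⟨hx, hT⟩, rfl⟩
  have h2 := (Finset.card_le_card h1).trans (Finset.card_union_le _ _)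
  have h3 := cl_le col (S \ T)
  have h4 := Finset.card_sdiff_add_card_eq_card h
  omega

def C1 (f g : ℕ) : ℝ := (2 ^ (2 ^ f * g) : ℕ) * (((g : ℝ) + 1) * ((2 ^ f : ℕ) : ℝ) ^ g) * (((f : ℝ) + 1) * ((1 : ℕ) : ℝ) ^ f)

theorem C1_pos (f g : ℕ) : 0 < C1 f g := by unfold C1; positivity

/-- pairs inside `W` -/
def inW (W : Finset (Fin n)) : Finset ({e // e ∈ G}) := Finset.univ.filter (fun e => e.1 ⊆ W)

theorem inW_card (W : Finset (Fin n)) {f : ℕ} (hW : W.card ≤ f) : (inW (G := G) W).card ≤ 2 ^ f := by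
  have h1 : (inW (G := G) W).card ≤ W.powerset.card := by
    apply Finset.card_le_card_of_injOn (fun e => e.1)
    · intro e he
      have : e ∈ inW (G := G) W := he
      simp only [inW, Finset.mem_filter, Finset.mem_univ, true_and] at this
      simpa using this
    · intro e _ e' _ h; exact Subtype.ext h
  rw [Finset.card_powerset] at h1
  exact h1.trans (Nat.pow_le_pow_right (by norm_num) hW)

theorem univ_count (col : {e // e ∈ G} → C → ℕ) (hcol : ∀ e, Function.Injective (col e)) (f g : ℕ) (hn : 0 < n)
    (ht : 0 < Fintype.card C) (T : Finset ({e // e ∈ G} × C)) (W0 : Finset (Fin n)) (F : Finset (Finset ({e // e ∈ G} × C)))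
    (hF : ∀ S ∈ F, T ⊆ S ∧ W0 ⊆ Vx S ∧ (Vx S).card ≤ f ∧ S.card ≤ g) :
    ∑ S ∈ F, (1 / (n : ℝ)) ^ ((Vx S).card - W0.card) * (1 / (Fintype.card C : ℝ)) ^ ((cl col S).card - (cl col T).card) ≤ C1 f g := by
  set t := Fintype.card C with htdef
  set U : Finset (Fin n) → Finset ℕ := fun W => (inW (G := G) W).biUnion (fun e => Finset.univ.image (col e)) with hUdef
  have hUc : ∀ W : Finset (Fin n), W.card ≤ f → (U W).card ≤ 2 ^ f * t := by
    intro W hW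
    refine (Finset.card_biUnion_le_card_mul _ _ t ?_).trans (Nat.mul_le_mul_right _ (inW_card W hW))
    intro e _
    exact Finset.card_image_le.trans (by rw [Finset.card_univ])
  have hin : ∀ S : Finset ({e // e ∈ G} × C), ∀ x ∈ S, x.1 ∈ inW (G := G) (Vx S) := by
    intro S x hx
    simp only [inW, Finset.mem_filter, Finset.mem_univ, true_and]
    exact Finset.subset_biUnion_of_mem (fun x : {e // e ∈ G} × C => x.1.1) hx
  have hmap1 : ∀ S ∈ F, Vx S ∈ (Finset.univ : Finset (Fin n)).powerset.filter (fun W => W0 ⊆ W ∧ W.card ≤ f) := by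
    intro S hS
    obtain ⟨h1, h2, h3, h4⟩ := hF S hS
    rw [Finset.mem_filter, Finset.mem_powerset]
    exact ⟨Finset.subset_univ _, h2, h3⟩
  rw [← Finset.sum_fiberwise_of_maps_to hmap1]
  have hW : ∀ W ∈ (Finset.univ : Finset (Fin n)).powerset.filter (fun W => W0 ⊆ W ∧ W.card ≤ f),
      ∑ S ∈ F.filter (fun S => Vx S = W), (1 / (n : ℝ)) ^ ((Vx S).card - W0.card) * (1 / (t : ℝ)) ^ ((cl col S).card - (cl col T).card) ≤
      ((2 ^ (2 ^ f * g) : ℕ) * (((g : ℝ) + 1) * ((2 ^ f : ℕ) : ℝ) ^ g)) * (1 / (n : ℝ)) ^ (W.card - W0.card) := by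
    intro W hWm
    obtain ⟨-, hW0, hWf⟩ := Finset.mem_filter.1 hWm
    have hmap2 : ∀ S ∈ F.filter (fun S => Vx S = W), cl col S ∈ (U W).powerset.filter (fun B => cl col T ⊆ B ∧ B.card ≤ g) := by
      intro S hS
      obtain ⟨hS', rfl⟩ := Finset.mem_filter.1 hS
      obtain ⟨h1, h2, h3, h4⟩ := hF S hS'
      rw [Finset.mem_filter, Finset.mem_powerset]
      refine ⟨?_, cl_mono col h1, (cl_le col S).trans h4⟩
      intro c hc
      simp only [cl, Finset.mem_image] at hc
      obtain ⟨x, hx, rfl⟩ := hc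
      rw [hUdef, Finset.mem_biUnion]
      exact ⟨x.1, hin S x hx, Finset.mem_image_of_mem _ (Finset.mem_univ _)⟩
    rw [← Finset.sum_fiberwise_of_maps_to hmap2]
    calc _ ≤ ∑ B ∈ (U W).powerset.filter (fun B => cl col T ⊆ B ∧ B.card ≤ g),
          ((2 ^ (2 ^ f * g) : ℕ) : ℝ) * ((1 / (n : ℝ)) ^ (W.card - W0.card) * (1 / (t : ℝ)) ^ (B.card - (cl col T).card)) := by
          apply Finset.sum_le_sum
          intro B hB
          obtain ⟨-, -, hBg⟩ := Finset.mem_filter.1 hB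
          rw [Finset.sum_congr rfl (g := fun _ => (1 / (n : ℝ)) ^ (W.card - W0.card) * (1 / (t : ℝ)) ^ (B.card - (cl col T).card))]
          · rw [Finset.sum_const, nsmul_eq_mul]
            apply mul_le_mul_of_nonneg_right _ (by positivity)
            set Y := ((inW (G := G) W) ×ˢ (Finset.univ : Finset C)).filter (fun x => col x.1 x.2 ∈ B) with hY
            have hYc : Y.card ≤ 2 ^ f * g := by
              calc Y.card ≤ ((inW (G := G) W) ×ˢ B).card := by
                    apply Finset.card_le_card_of_injOn (fun x => (x.1, col x.1 x.2))
                    · intro x hx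
                      have hx : x ∈ Y := hx
                      simp only [hY, Finset.mem_filter, Finset.mem_product, Finset.mem_univ, and_true] at hx
                      simpa using hx
                    · rintro ⟨e, c⟩ _ ⟨e', c'⟩ _ h
                      simp only [Prod.mk.injEq] at h
                      obtain ⟨rfl, h⟩ := h
                      rw [hcol e h]
                _ ≤ _ := by rw [Finset.card_product]; exact Nat.mul_le_mul (inW_card W hWf) hBg
            have : ((F.filter (fun S => Vx S = W)).filter (fun S => cl col S = B)).card ≤ 2 ^ (2 ^ f * g) := by
              calc _ ≤ Y.powerset.card := by
                    apply Finset.card_le_card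
                    intro S hS
                    simp only [Finset.mem_filter] at hS
                    obtain ⟨⟨hS, rfl⟩, rfl⟩ := hS
                    rw [Finset.mem_powerset]
                    intro x hx
                    simp only [hY, Finset.mem_filter, Finset.mem_product, Finset.mem_univ, and_true]
                    exact ⟨hin S x hx, Finset.mem_image_of_mem (fun x : {e // e ∈ G} × C => col x.1 x.2) hx⟩
                _ ≤ _ := by rw [Finset.card_powerset]; exact Nat.pow_le_pow_right (by norm_num) hYc
            exact_mod_cast this
          · intro S hS
            simp only [Finset.mem_filter] at hS
            rw [hS.1.2, hS.2]
      _ = ((2 ^ (2 ^ f * g) : ℕ) : ℝ) * (1 / (n : ℝ)) ^ (W.card - W0.card) *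
          ∑ B ∈ (U W).powerset.filter (fun B => cl col T ⊆ B ∧ B.card ≤ g), (1 / (t : ℝ)) ^ (B.card - (cl col T).card) := by
          rw [Finset.mul_sum]; apply Finset.sum_congr rfl; intro B _; ring
      _ ≤ ((2 ^ (2 ^ f * g) : ℕ) : ℝ) * (1 / (n : ℝ)) ^ (W.card - W0.card) * (((g : ℝ) + 1) * ((2 ^ f : ℕ) : ℝ) ^ g) := by
          apply mul_le_mul_of_nonneg_left _ (by positivity)
          exact sum_small_supersets (U W) (cl col T) g (2 ^ f) t Nat.one_le_two_pow ht (hUc W hWf)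
      _ = _ := by ring
  refine (Finset.sum_le_sum hW).trans ?_
  rw [← Finset.mul_sum]
  unfold C1
  apply mul_le_mul_of_nonneg_left _ (by positivity)
  exact sum_small_supersets Finset.univ W0 f 1 n le_rfl hn (by simp)

theorem cnt (col : {e // e ∈ G} → C → ℕ) (hcol : ∀ e, Function.Injective (col e)) (f g : ℕ) (hn : 0 < n)
    (ht : 0 < Fintype.card C) (T : Finset ({e // e ∈ G} × C)) (W0 : Finset (Fin n)) (F : Finset (Finset ({e // e ∈ G} × C)))
    {c : ℝ} (hc : 0 ≤ c)
    (hF : ∀ S ∈ F, T ⊆ S ∧ W0 ⊆ Vx S ∧ (Vx S).card ≤ f ∧ S.card ≤ g ∧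
      (1 / (Fintype.card C : ℝ)) ^ (rep col S - rep col T) ≤ c * (1 / (n : ℝ)) ^ ((Vx S).card - W0.card)) :
    ∑ S ∈ F, (1 / (Fintype.card C : ℝ)) ^ (S.card - T.card) ≤ c * C1 f g := by
  refine le_trans ?_ (mul_le_mul_of_nonneg_left (univ_count col hcol f g hn ht T W0 F
    (fun S hS => ⟨(hF S hS).1, (hF S hS).2.1, (hF S hS).2.2.1, (hF S hS).2.2.2.1⟩)) hc)
  rw [Finset.mul_sum]
  apply Finset.sum_le_sum
  intro S hS
  obtain ⟨h1, -, -, -, h5⟩ := hF S hS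
  have e1 := cl_card_le col h1
  have e2 := cl_le col S
  have e3 := cl_le col T
  have e4 := Finset.card_le_card (cl_mono col h1)
  have : S.card - T.card = (rep col S - rep col T) + ((cl col S).card - (cl col T).card) := by
    unfold rep; omega
  rw [this, pow_add, ← mul_assoc]
  exact mul_le_mul_of_nonneg_right h5 (by positivity)
end

section
variable {n : ℕ} {G : Finset (Finset (Fin n))} {C : Type} [Fintype C] [DecidableEq C]

/-- the minimal conflicts -/
def Conf (col : {e // e ∈ G} → C → ℕ) (k f g m p : ℕ) (S : Finset ({e // e ∈ G} × C)) : Prop :=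
  Functional S ∧ 2 ≤ S.card ∧ S.card ≤ g ∧ (Vx S).card ≤ f ∧ m * (Vx S).card ≤ m * k + p * rep col S ∧
    ∀ T, T ⊂ S → 2 ≤ T.card → m * k + p * rep col T < m * (Vx T).card

theorem rep_mono (col : {e // e ∈ G} → C → ℕ) {T S : Finset ({e // e ∈ G} × C)} (h : T ⊆ S) : rep col T ≤ rep col S := by
  have := cl_card_le col h
  have := cl_le col S
  have := cl_le col T
  unfold rep; omega

theorem rep_empty (col : {e // e ∈ G} → C → ℕ) : rep col ∅ = 0 := by simp [rep]

theorem rep_single (col : {e // e ∈ G} → C → ℕ) (x : {e // e ∈ G} × C) : rep col {x} = 0 := by simp [rep, cl]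

theorem Vx_single (x : {e // e ∈ G} × C) : Vx {x} = x.1.1 := by simp [Vx]

theorem card_union_gt {X : Type} [DecidableEq X] {a b : Finset X} {k : ℕ} (ha : a.card = k) (hb : b.card = k) (h : a ≠ b) :
    k + 1 ≤ (a ∪ b).card := by
  by_contra hc
  have h1 : a = a ∪ b := Finset.eq_of_subset_of_card_le Finset.subset_union_left (by omega)
  have h2 : b = a ∪ b := Finset.eq_of_subset_of_card_le Finset.subset_union_right (by omega)
  exact h (h1.trans h2.symm)

theorem sub_Vx {S : Finset ({e // e ∈ G} × C)} {u : {e // e ∈ G}} (h : u ∈ vs S) : u.1 ⊆ Vx S := by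
  obtain ⟨c, hc⟩ := mem_vs.1 h
  exact Finset.subset_biUnion_of_mem (fun x : {e // e ∈ G} × C => x.1.1) hc

theorem Vx_big {k : ℕ} (hG : ∀ e ∈ G, e.card = k) {S : Finset ({e // e ∈ G} × C)} (hf : Functional S) (h2 : 2 ≤ S.card) :
    k + 1 ≤ (Vx S).card := by
  obtain ⟨x, hx, y, hy, hxy⟩ := Finset.one_lt_card.1 (show 1 < S.card by omega)
  have hne : x.1 ≠ y.1 := by
    intro h
    apply hxy
    refine Prod.ext h (hf x.1 x.2 y.2 hx ?_)
    rw [h]; exact hy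
  refine (card_union_gt (hG _ x.1.2) (hG _ y.1.2) (fun h => hne (Subtype.ext h))).trans (Finset.card_le_card ?_)
  exact Finset.union_subset (sub_Vx (mem_vs_of hx)) (sub_Vx (mem_vs_of hy))

theorem pw (col : {e // e ∈ G} → C → ℕ) {g m p s : ℕ} {x lam A t : ℝ} (hx0 : 0 < x) (hx1 : x ≤ 1) (hxm : x ^ m = 1 / (n : ℝ))
    (hlam : 1 ≤ lam) (hA : 1 ≤ A) (ht0 : 0 < t) (ht : 1 / t ≤ lam / A * x ^ p)
    {T S : Finset ({e // e ∈ G} × C)} {W0 : Finset (Fin n)} (hTS : T ⊆ S) (hW : W0 ⊆ Vx S) (hg : S.card ≤ g)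
    (h : m * (Vx S).card + p * rep col T + s ≤ m * W0.card + p * rep col S) :
    (1 / t) ^ (rep col S - rep col T) ≤ (lam ^ g * x ^ s) * (1 / (n : ℝ)) ^ ((Vx S).card - W0.card) := by
  have hr := rep_mono col hTS
  have hWc := Finset.card_le_card hW
  have hrg : rep col S ≤ g := (Nat.sub_le _ _).trans hg
  obtain ⟨d, hd⟩ := Nat.exists_eq_add_of_le hr
  obtain ⟨a, ha⟩ := Nat.exists_eq_add_of_le hWc
  have h' : m * a + s ≤ p * d := by
    rw [hd, ha, Nat.mul_add, Nat.mul_add] at h; omega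
  rw [show rep col S - rep col T = d by omega, show (Vx S).card - W0.card = a by omega]
  have hlA : lam / A ≤ lam := div_le_self (by linarith) hA
  calc (1 / t) ^ d ≤ (lam / A * x ^ p) ^ d := pow_le_pow_left₀ (by positivity) ht d
    _ = (lam / A) ^ d * x ^ (p * d) := by rw [mul_pow, ← pow_mul]
    _ ≤ lam ^ g * x ^ (m * a + s) := by
        apply mul_le_mul _ (pow_le_pow_of_le_one hx0.le hx1 h') (by positivity) (by positivity)
        exact (pow_le_pow_left₀ (by positivity) hlA d).trans (pow_le_pow_right₀ hlam (by omega))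
    _ = _ := by rw [pow_add, pow_mul, hxm]; ring

open Classical in
theorem conf_TSums (col : {e // e ∈ G} → C → ℕ) (hcol : ∀ e, Function.Injective (col e)) {k f g m p : ℕ}
    (hG : ∀ e ∈ G, e.card = k) (hm : 0 < m) (hfk : f = k + p) (hnd : ¬ m ∣ p) (hn : 0 < n) (htC : 0 < Fintype.card C)
    {x lam A : ℝ} (hx0 : 0 < x) (hx1 : x ≤ 1) (hxm : x ^ m = 1 / (n : ℝ))
    (hlam : 1 ≤ lam) (hA : 1 ≤ A) (ht : 1 / (Fintype.card C : ℝ) ≤ lam / A * x ^ p) :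
    TSums (Finset.univ.filter (fun S => Conf col k f g m p S)) (Fintype.card C : ℝ)
      ((lam ^ m / A + lam ^ g * x) * C1 f g) (lam ^ g * C1 f g) (lam ^ g * x * C1 f g) := by
  have ht0 : (0 : ℝ) < Fintype.card C := by exact_mod_cast htC
  have hC1 := C1_pos f g
  have pw0 : ∀ {T S : Finset ({e // e ∈ G} × C)} {W0 : Finset (Fin n)}, T ⊆ S → W0 ⊆ Vx S → S.card ≤ g →
      m * (Vx S).card + p * rep col T ≤ m * W0.card + p * rep col S →
      (1 / (Fintype.card C : ℝ)) ^ (rep col S - rep col T) ≤ (lam ^ g) * (1 / (n : ℝ)) ^ ((Vx S).card - W0.card) := by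
    intro T S W0 h1 h2 h3 h4
    have := pw (s := 0) col hx0 hx1 hxm hlam hA ht0 ht h1 h2 h3 h4
    simpa using this
  have pw1 : ∀ {T S : Finset ({e // e ∈ G} × C)} {W0 : Finset (Fin n)}, T ⊆ S → W0 ⊆ Vx S → S.card ≤ g →
      m * (Vx S).card + p * rep col T + 1 ≤ m * W0.card + p * rep col S →
      (1 / (Fintype.card C : ℝ)) ^ (rep col S - rep col T) ≤ (lam ^ g * x) * (1 / (n : ℝ)) ^ ((Vx S).card - W0.card) := by
    intro T S W0 h1 h2 h3 h4
    have := pw (s := 1) col hx0 hx1 hxm hlam hA ht0 ht h1 h2 h3 h4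
    simpa using this
  have two : ∀ S, Conf col k f g m p S → S.card = 2 → m * (Vx S).card + 1 ≤ m * k + p * rep col S := by
    rintro S ⟨hf, h2, -, -, hle, -⟩ hc
    rcases Nat.lt_or_ge (m * (Vx S).card) (m * k + p * rep col S) with h | h
    · exact h
    exfalso
    have hb := Vx_big hG hf h2
    obtain ⟨a, ha⟩ := Nat.exists_eq_add_of_le (show k ≤ (Vx S).card by omega)
    have hma : m * a = p * rep col S := by
      have := le_antisymm hle h
      rw [ha, Nat.mul_add] at this; omega
    have hr1 : rep col S ≤ 1 := by
      have : 0 < (cl col S).card := by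
        rw [Finset.card_pos]
        exact (Finset.card_pos.1 (show 0 < S.card by omega)).image _
      unfold rep; omega
    have hr : rep col S = 1 := by
      have hpos : 0 < m * a := Nat.mul_pos hm (by omega)
      rcases Nat.eq_zero_or_pos (rep col S) with h0 | h0
      · rw [h0] at hma; omega
      · omega
    rw [hr, mul_one] at hma
    exact hnd ⟨a, hma.symm⟩
  have hk1 : ∀ u : {e // e ∈ G}, u.1.card = k := fun u => hG _ u.2
  have hbig : ∀ j, m * k + m ≤ m * (k + 1 + j) := fun j => by
    rw [Nat.mul_add, Nat.mul_add]; omega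
  refine ⟨?_, ?_, ?_, ?_, ?_, ?_, ?_⟩
  · -- t1
    intro T hT
    apply cnt col hcol f g hn htC T (Vx T) _ (by positivity)
    intro S hS
    simp only [Finset.mem_filter, Finset.mem_univ, true_and] at hS
    obtain ⟨⟨hf, h2, hg, hVf, hle, hmin⟩, hTS⟩ := hS
    refine ⟨hTS, Vx_mono hTS, hVf, hg, pw0 hTS (Vx_mono hTS) hg ?_⟩
    rcases Nat.lt_or_ge T.card 2 with h | h
    · have hT1 : T.card = 1 := by have := hT.card_pos; omega
      obtain ⟨y, rfl⟩ := Finset.card_eq_one.1 hT1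
      rw [Vx_single, rep_single, hk1]; omega
    · rcases eq_or_ne T S with rfl | hne
      · exact le_rfl
      · have := hmin T (Finset.ssubset_iff_subset_ne.2 ⟨hTS, hne⟩) h
        omega
  · -- t2
    intro u
    have hsplit := sum_split ((Finset.univ.filter (fun S => Conf col k f g m p S)).filter (fun S => u ∈ vs S))
      (fun S => m * (Vx S).card = m * k + p * rep col S) (fun S => m * (Vx S).card + 1 ≤ m * k + p * rep col S)
      (fun S => (1 / (Fintype.card C : ℝ)) ^ S.card) (fun S => by positivity) (by
        intro S hS
        simp only [Finset.mem_filter, Finset.mem_univ, true_and] at hS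
        have := hS.1.2.2.2.2.1
        omega)
    refine hsplit.trans ?_
    rw [add_mul]
    apply add_le_add
    · have := cnt col hcol f g hn htC ∅ u.1 (((Finset.univ.filter (fun S => Conf col k f g m p S)).filter (fun S => u ∈ vs S)).filter
        (fun S => m * (Vx S).card = m * k + p * rep col S)) (c := lam ^ m / A) (by positivity) ?_
      · simpa using this
      intro S hS
      simp only [Finset.mem_filter, Finset.mem_univ, true_and] at hS
      obtain ⟨⟨⟨hf, h2, hg, hVf, hle, hmin⟩, hu⟩, heq⟩ := hS
      refine ⟨Finset.empty_subset _, sub_Vx hu, hVf, hg, ?_⟩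
      rw [rep_empty, Nat.sub_zero, hk1]
      have hb := Vx_big hG hf h2
      obtain ⟨a, ha⟩ := Nat.exists_eq_add_of_le (show k ≤ (Vx S).card by omega)
      have hma : m * a = p * rep col S := by
        rw [ha, Nat.mul_add] at heq; omega
      have hpos : 0 < m * a := Nat.mul_pos hm (by omega)
      have hr0 : 1 ≤ rep col S := by
        rcases Nat.eq_zero_or_pos (rep col S) with h0 | h0
        · rw [h0] at hma; omega
        · exact h0
      have hp0 : 0 < p := by
        rcases Nat.eq_zero_or_pos p with h0 | h0
        · rw [h0] at hma; omega
        · exact h0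
      have hrm : rep col S ≤ m := by
        have : p * rep col S ≤ p * m := by
          rw [← hma, mul_comm p m]; exact Nat.mul_le_mul_left _ (by omega)
        exact Nat.le_of_mul_le_mul_left this hp0
      rw [show (Vx S).card - k = a by omega]
      calc (1 / (Fintype.card C : ℝ)) ^ (rep col S) ≤ (lam / A * x ^ p) ^ (rep col S) := pow_le_pow_left₀ (by positivity) ht _
        _ = lam ^ (rep col S) / A ^ (rep col S) * x ^ (m * a) := by rw [mul_pow, ← pow_mul, hma, div_pow]
        _ ≤ lam ^ m / A * x ^ (m * a) := by
            apply mul_le_mul_of_nonneg_right _ (by positivity)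
            apply div_le_div₀ (by positivity) (pow_le_pow_right₀ hlam hrm) (by positivity)
            exact le_self_pow₀ hA (by omega)
        _ = _ := by rw [pow_mul, hxm]
    · have := cnt col hcol f g hn htC ∅ u.1 (((Finset.univ.filter (fun S => Conf col k f g m p S)).filter (fun S => u ∈ vs S)).filter
        (fun S => m * (Vx S).card + 1 ≤ m * k + p * rep col S)) (c := lam ^ g * x) (by positivity) ?_
      · simpa using this
      intro S hS
      simp only [Finset.mem_filter, Finset.mem_univ, true_and] at hS
      obtain ⟨⟨⟨hf, h2, hg, hVf, hle, hmin⟩, hu⟩, hlt⟩ := hS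
      refine ⟨Finset.empty_subset _, sub_Vx hu, hVf, hg, pw1 (Finset.empty_subset _) (sub_Vx hu) hg ?_⟩
      rw [rep_empty, hk1]; omega
  · -- t3
    intro T hT
    apply cnt col hcol f g hn htC T (Vx T) _ (by positivity)
    intro S hS
    simp only [Finset.mem_filter, Finset.mem_univ, true_and] at hS
    obtain ⟨⟨hf, h2, hg, hVf, hle, hmin⟩, hTS⟩ := hS
    refine ⟨hTS.1, Vx_mono hTS.1, hVf, hg, pw1 hTS.1 (Vx_mono hTS.1) hg ?_⟩
    have := hmin T hTS hT
    omega
  · -- t4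
    intro y u hu
    have := cnt col hcol f g hn htC {y} (y.1.1 ∪ u.1) ((Finset.univ.filter (fun S => Conf col k f g m p S)).filter
      (fun S => y ∈ S ∧ u ∈ vs S)) (c := lam ^ g * x) (by positivity) ?_
    · simpa using this
    intro S hS
    simp only [Finset.mem_filter, Finset.mem_univ, true_and] at hS
    obtain ⟨⟨hf, h2, hg, hVf, hle, hmin⟩, hy, hu'⟩ := hS
    have hs : ({y} : Finset ({e // e ∈ G} × C)) ⊆ S := by simpa using hy
    have hW := Finset.union_subset (sub_Vx (mem_vs_of hy)) (sub_Vx hu')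
    refine ⟨hs, hW, hVf, hg, pw1 hs hW hg ?_⟩
    rw [rep_single]
    have hc := card_union_gt (hk1 y.1) (hk1 u) (fun h => hu (Subtype.ext h.symm))
    obtain ⟨j, hj⟩ := Nat.exists_eq_add_of_le hc
    have := hbig j
    rw [hj]; omega
  · -- t5
    intro u u' hu
    have := cnt col hcol f g hn htC ∅ (u.1 ∪ u'.1) ((Finset.univ.filter (fun S => Conf col k f g m p S)).filter
      (fun S => u ∈ vs S ∧ u' ∈ vs S)) (c := lam ^ g * x) (by positivity) ?_
    · simpa using this
    intro S hS
    simp only [Finset.mem_filter, Finset.mem_univ, true_and] at hS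
    obtain ⟨⟨hf, h2, hg, hVf, hle, hmin⟩, hy, hu'⟩ := hS
    have hW := Finset.union_subset (sub_Vx hy) (sub_Vx hu')
    refine ⟨Finset.empty_subset _, hW, hVf, hg, pw1 (Finset.empty_subset _) hW hg ?_⟩
    rw [rep_empty]
    have hc := card_union_gt (hk1 u) (hk1 u') (fun h => hu (Subtype.ext h))
    obtain ⟨j, hj⟩ := Nat.exists_eq_add_of_le hc
    have := hbig j
    rw [hj]; omega
  · -- t6
    intro y
    have := cnt col hcol f g hn htC {y} y.1.1 ((Finset.univ.filter (fun S => Conf col k f g m p S)).filter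
      (fun S => y ∈ S ∧ S.card = 2)) (c := lam ^ g * x) (by positivity) ?_
    · simpa using this
    intro S hS
    simp only [Finset.mem_filter, Finset.mem_univ, true_and] at hS
    obtain ⟨hconf, hy, hc⟩ := hS
    have htwo := two S hconf hc
    obtain ⟨hf, h2, hg, hVf, hle, hmin⟩ := hconf
    have hs : ({y} : Finset ({e // e ∈ G} × C)) ⊆ S := by simpa using hy
    have hW := sub_Vx (mem_vs_of hy)
    refine ⟨hs, hW, hVf, hg, pw1 hs hW hg ?_⟩
    rw [rep_single, hk1]; omega
  · -- t7
    intro u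
    have := cnt col hcol f g hn htC ∅ u.1 ((Finset.univ.filter (fun S => Conf col k f g m p S)).filter
      (fun S => u ∈ vs S ∧ S.card = 2)) (c := lam ^ g * x) (by positivity) ?_
    · simpa using this
    intro S hS
    simp only [Finset.mem_filter, Finset.mem_univ, true_and] at hS
    obtain ⟨hconf, hy, hc⟩ := hS
    have htwo := two S hconf hc
    obtain ⟨hf, h2, hg, hVf, hle, hmin⟩ := hconf
    refine ⟨Finset.empty_subset _, sub_Vx hy, hVf, hg, pw1 (Finset.empty_subset _) (sub_Vx hy) hg ?_⟩
    rw [rep_empty, hk1]; omega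

theorem Conf.anti {col : {e // e ∈ G} → C → ℕ} {k f g m p : ℕ} {S S' : Finset ({e // e ∈ G} × C)}
    (h : Conf col k f g m p S) (h' : Conf col k f g m p S') (hs : S ⊆ S') : S = S' := by
  by_contra hne
  have := h'.2.2.2.2.2 S (Finset.ssubset_iff_subset_ne.2 ⟨hs, hne⟩) h.2.1
  have := h.2.2.2.2.1
  omega

/-- every bad functional set contains a minimal conflict -/
theorem exists_conf {col : {e // e ∈ G} → C → ℕ} {k f g m p : ℕ} (Q : Finset ({e // e ∈ G} × C))
    (hf : Functional Q) (h2 : 2 ≤ Q.card) (hg : Q.card ≤ g) (hV : (Vx Q).card ≤ f)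
    (hle : m * (Vx Q).card ≤ m * k + p * rep col Q) : ∃ S ⊆ Q, Conf col k f g m p S := by
  classical
  obtain ⟨S, hS, hmin⟩ := Finset.exists_min_image (Q.powerset.filter (fun S => 2 ≤ S.card ∧ m * (Vx S).card ≤ m * k + p * rep col S))
    Finset.card ⟨Q, by simp [h2, hle]⟩
  simp only [Finset.mem_filter, Finset.mem_powerset] at hS
  refine ⟨S, hS.1, fun e c c' h h' => hf e c c' (hS.1 h) (hS.1 h'), hS.2.1, (Finset.card_le_card hS.1).trans hg,
    (Finset.card_le_card (Vx_mono hS.1)).trans hV, hS.2.2, ?_⟩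
  intro T hT hT2
  by_contra hc
  have := hmin T (by simp only [Finset.mem_filter, Finset.mem_powerset]; exact ⟨hT.1.trans hS.1, hT2, by omega⟩)
  have := Finset.card_lt_card hT
  omega
end

structure Good (n k f g m p K M r r' : ℕ) (x lam A Bc θc b L η : ℝ) : Prop where
  hK : 1 ≤ K
  hM : 0 < M
  hn : 0 < n
  hx0 : 0 < x
  hx1 : x ≤ 1
  hxm : x ^ m = 1 / (n : ℝ)
  hlam : 1 ≤ lam
  hA : 1 ≤ A
  ht : 1 / ((K : ℝ) * M) ≤ lam / A * x ^ p
  hBc1 : 1 ≤ Bc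
  hθc0 : 0 ≤ θc
  hBc : (K : ℝ) ^ g * (2 ^ (4 * r * g) * (lam ^ g * C1 f g) + (((4 * r * g : ℕ) : ℝ) + 1) * ((lam ^ m / A + lam ^ g * x) * C1 f g)) ≤ Bc
  hθc : (K : ℝ) ^ g * (2 ^ (4 * r * g) * (lam ^ g * x * C1 f g) + (((4 * r * g : ℕ) * ((4 * r * g : ℕ) + 1) * (lam ^ g * x * C1 f g) + (4 * r * g : ℕ) * (lam ^ g * x * C1 f g))
      + (((4 * r * g : ℕ) + 1) * ((4 * r * g : ℕ) + 1) * (lam ^ g * x * C1 f g) + ((4 * r * g : ℕ) + 1) * (lam ^ g * x * C1 f g)))) ≤ θc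
  hun : (n : ℝ) ^ k * ((2 * Bc) ^ (4 * r) * θc ^ r + (1 / 2) ^ r') < 1
  hK4 : 4 * (4 * r * g) ≤ K
  hb0 : 0 < b
  hb : 4 ^ g * (K * ((lam ^ m / A + lam ^ g * x) * C1 f g) + (((r' * g : ℕ) : ℝ) + 1) ^ g * (lam ^ g * C1 f g)) ≤ b
  hbL : 2 * b ≤ L * K / 16
  hL : 0 < L
  hη : η = Real.exp (-L) / 8
  hKL : 2 * Real.exp L / K ≤ 1 / 2
  hE : (n : ℝ) ^ k * Real.exp (-(11 / 16 * (η * K))) < Real.exp (-(4 / 7 * (η * K)))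

theorem ramsey_le (k f q : ℕ) (Fe : Finset (Finset (Fin f))) (hf : k < f) (hq : 1 ≤ q) (hqE : q ≤ Fe.card)
    (hnd : ¬ ((Fe.card - q + 1) ∣ (f - k))) (n : ℕ) (G : Finset (Finset (Fin n))) (hG : ∀ e ∈ G, e.card = k)
    {K M r r' : ℕ} {x lam A Bc θc b L η : ℝ}
    (H : Good n k f Fe.card (Fe.card - q + 1) (f - k) K M r r' x lam A Bc θc b L η) :
    listRamseyF Fe q n G ≤ K * M := by
  classical
  apply Nat.sInf_le
  intro Ls hLs
  have hemb : ∀ e : {e // e ∈ G}, ∃ c : Fin K × Fin M → ℕ, Function.Injective c ∧ ∀ z, c z ∈ Ls e.1 := by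
    intro e
    obtain ⟨i⟩ := Function.Embedding.nonempty_of_card_le (α := Fin K × Fin M) (β := {z // z ∈ Ls e.1}) (by
      simpa using hLs e.1 e.2)
    exact ⟨fun z => (i z).1, fun a b h => i.injective (Subtype.ext h), fun z => (i z).2⟩
  choose col hcol hcolL using hemb
  set m := Fe.card - q + 1 with hm
  set p := f - k with hp
  have hcC : (Fintype.card (Fin K × Fin M) : ℝ) = (K : ℝ) * M := by simp
  have htC : 0 < Fintype.card (Fin K × Fin M) := by
    simp only [Fintype.card_prod, Fintype.card_fin]; exact Nat.mul_pos H.hK H.hM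
  have hTS := conf_TSums col hcol (f := f) (g := Fe.card) (m := m) (p := p) hG (by omega) (by omega) hnd H.hn htC H.hx0 H.hx1 H.hxm
    H.hlam H.hA (by rw [hcC]; exact H.ht)
  rw [hcC] at hTS
  have hC1 := C1_pos f Fe.card
  have hlam0 : 0 < lam := by linarith [H.hlam]
  have hA0 : 0 < A := by linarith [H.hA]
  have hx0 := H.hx0
  have hcard : (Fintype.card {e // e ∈ G} : ℝ) ≤ (n : ℝ) ^ k := by
    have h1 : G ⊆ (Finset.univ : Finset (Fin n)).powersetCard k := by
      intro e he
      rw [Finset.mem_powersetCard]; exact ⟨Finset.subset_univ _, hG e he⟩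
    have h2 := Finset.card_le_card h1
    rw [Finset.card_powersetCard, Finset.card_univ, Fintype.card_fin] at h2
    have h3 := h2.trans (Nat.choose_le_pow n k)
    rw [Fintype.card_coe]
    exact_mod_cast h3
  have hBc0 : 0 < Bc := by linarith [H.hBc1]
  have hθc0 := H.hθc0
  obtain ⟨ψ, hψ⟩ := main_T1 H.hK H.hM (Finset.univ.filter (fun S => Conf col k f Fe.card m p S))
    (fun S hS => (Finset.mem_filter.1 hS).2.1) Fe.card (fun S hS => (Finset.mem_filter.1 hS).2.2.2.1)
    (fun S hS => (Finset.mem_filter.1 hS).2.2.1)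
    (fun S hS S' hS' h => (Finset.mem_filter.1 hS).2.anti (Finset.mem_filter.1 hS').2 h) rfl hTS
    (by positivity) (by positivity) (by positivity) r r' H.hBc1 H.hθc0 H.hBc H.hθc
    (lt_of_le_of_lt (mul_le_mul_of_nonneg_right hcard (by positivity)) H.hun) H.hK4 H.hb0 H.hb H.hbL H.hL H.hη H.hKL
    (lt_of_le_of_lt (mul_le_mul_of_nonneg_right hcard (by positivity)) H.hE)
  refine ⟨fun e => if h : e ∈ G then col ⟨e, h⟩ (ψ ⟨e, h⟩) else 0, ?_, ?_⟩
  · intro e he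
    simp only [he, dif_pos]
    exact hcolL ⟨e, he⟩ _
  intro ι hι
  by_contra hcon
  push Not at hcon
  set φ : Finset (Fin n) → ℕ := fun e => if h : e ∈ G then col ⟨e, h⟩ (ψ ⟨e, h⟩) else 0 with hφ
  set I := Fe.image (fun e => e.map ι) with hI
  have hIc : I.card = Fe.card := Finset.card_image_of_injective _ (Finset.map_injective ι)
  have hIG : ∀ e ∈ I, e ∈ G := by
    intro e he
    obtain ⟨e', he', rfl⟩ := Finset.mem_image.1 he
    exact hι e' he'
  set Q : Finset ({e // e ∈ G} × (Fin K × Fin M)) := Finset.univ.filter (fun z => z.1.1 ∈ I ∧ ψ z.1 = z.2) with hQ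
  have hQm : ∀ z, z ∈ Q ↔ z.1.1 ∈ I ∧ ψ z.1 = z.2 := fun z => by simp [hQ]
  have hQc : Q.card = Fe.card := by
    rw [← hIc]
    apply Finset.card_bij (fun z _ => z.1.1)
    · intro z hz; exact ((hQm z).1 hz).1
    · rintro ⟨e, c⟩ hz ⟨e', c'⟩ hz' h
      have he : e = e' := Subtype.ext h
      subst he
      have h1 := ((hQm _).1 hz).2
      have h2 := ((hQm _).1 hz').2
      simp only at h1 h2
      rw [← h1, ← h2]
    · intro e he
      exact ⟨(⟨e, hIG e he⟩, ψ ⟨e, hIG e he⟩), (hQm _).2 ⟨he, rfl⟩, rfl⟩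
  have hcl : cl col Q = I.image φ := by
    ext c
    simp only [cl, Finset.mem_image]
    constructor
    · rintro ⟨z, hz, rfl⟩
      obtain ⟨h1, h2⟩ := (hQm z).1 hz
      refine ⟨z.1.1, h1, ?_⟩
      simp only [hφ, z.1.2, dif_pos, h2]
    · rintro ⟨e, he, rfl⟩
      refine ⟨(⟨e, hIG e he⟩, ψ ⟨e, hIG e he⟩), (hQm _).2 ⟨he, rfl⟩, ?_⟩
      simp only [hφ, hIG e he, dif_pos]
  have hV : (Vx Q).card ≤ f := by
    have h1 : Vx Q ⊆ (Finset.univ : Finset (Fin f)).map ι := by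
      intro v hv
      simp only [Vx, Finset.mem_biUnion] at hv
      obtain ⟨z, hz, hvz⟩ := hv
      obtain ⟨e', -, he'⟩ := Finset.mem_image.1 ((hQm z).1 hz).1
      rw [← he'] at hvz
      exact Finset.map_subset_map.2 (Finset.subset_univ _) hvz
    have := Finset.card_le_card h1
    simpa using this
  have hrep : m ≤ rep col Q := by
    unfold rep
    rw [hQc, hcl]; omega
  have hm2 : 2 ≤ m := by
    by_contra h
    have : m = 1 := by omega
    rw [this] at hnd
    exact hnd (one_dvd _)
  obtain ⟨S, hSQ, hS⟩ := exists_conf (col := col) (k := k) (f := f) (g := Fe.card) (m := m) (p := p) Q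
    (fun e c c' h h' => by
      have h1 := ((hQm _).1 h).2
      have h2 := ((hQm _).1 h').2
      simp only at h1 h2
      rw [← h1, ← h2]) (by omega) hQc.le hV (by
      calc m * (Vx Q).card ≤ m * f := Nat.mul_le_mul_left _ hV
        _ = m * k + p * m := by rw [show f = k + p by omega, Nat.mul_add, mul_comm m p]
        _ ≤ _ := Nat.add_le_add_left (Nat.mul_le_mul_left _ hrep) _)
  exact hψ S (by simp [hS]) (fun z hz => ((hQm z).1 (hSQ hz)).2)

theorem ev_log (c : ℝ) (a : ℕ) (s : ℝ) (hs : 0 < s) : ∀ᶠ n : ℕ in Filter.atTop, c * (Real.log n) ^ a ≤ (n : ℝ) ^ s := by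
  have h := ((isLittleO_log_rpow_rpow_atTop (a : ℝ) hs).const_mul_left c).bound (zero_lt_one)
  have h2 := tendsto_natCast_atTop_atTop (R := ℝ) |>.eventually h
  filter_upwards [h2] with n hn
  have h3 : (0 : ℝ) ≤ (n : ℝ) ^ s := by positivity
  rw [Real.norm_of_nonneg h3, one_mul, Real.rpow_natCast] at hn
  exact (le_abs_self _).trans hn

/-- the part of the numerics for hBc and hθc -/
theorem num_a {K g R : ℕ} {lam x ℓ D' A C N d : ℝ} {m : ℕ} (hg : 1 ≤ g) (hC : 0 < C) (hx0 : 0 < x) (hx1 : x ≤ 1)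
    (hℓ : 1 ≤ ℓ) (hA : 1 ≤ A) (hlam1 : 1 ≤ lam) (hlam : lam ≤ ℓ) (hlm : lam ^ m = ℓ) (hd : 0 < d) (hK : (K : ℝ) ≤ 2 * d)
    (hN : 2 ^ g * (2 ^ R * C + ((R : ℝ) + 1) * (2 * C)) * ℓ ^ g ≤ d ^ g) :
    (K : ℝ) ^ g * (2 ^ R * (lam ^ g * C) + ((R : ℝ) + 1) * ((lam ^ m / A + lam ^ g * x) * C)) ≤ d ^ g * d ^ g := by
  have h1 : lam ^ g ≤ ℓ ^ g := pow_le_pow_left₀ (by linarith) hlam g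
  have h2 : lam ^ m / A ≤ ℓ ^ g := by
    rw [hlm]
    exact (div_le_self (by linarith) hA).trans (le_self_pow₀ hℓ (by omega))
  have h3 : lam ^ g * x ≤ ℓ ^ g := (mul_le_of_le_one_right (by positivity) hx1).trans h1
  have h4 : (K : ℝ) ^ g ≤ 2 ^ g * d ^ g := by
    rw [← mul_pow]; exact pow_le_pow_left₀ (by positivity) hK g
  calc (K : ℝ) ^ g * (2 ^ R * (lam ^ g * C) + ((R : ℝ) + 1) * ((lam ^ m / A + lam ^ g * x) * C))
      ≤ (2 ^ g * d ^ g) * (2 ^ R * (ℓ ^ g * C) + ((R : ℝ) + 1) * ((ℓ ^ g + ℓ ^ g) * C)) := by gcongr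
    _ = d ^ g * (2 ^ g * (2 ^ R * C + ((R : ℝ) + 1) * (2 * C)) * ℓ ^ g) := by ring
    _ ≤ _ := by gcongr

theorem num_b {K g R : ℕ} {lam x ℓ C d : ℝ} (hC : 0 < C) (hx0 : 0 < x)
    (hlam1 : 1 ≤ lam) (hlam : lam ≤ ℓ) (hd : 0 < d) (hK : (K : ℝ) ≤ 2 * d)
    (hN : 2 ^ g * ((2 ^ R + ((R * (R + 1) + R) + ((R + 1) * (R + 1) + (R + 1)))) * C) * ℓ ^ g ≤ d ^ g) :
    (K : ℝ) ^ g * (2 ^ R * (lam ^ g * x * C) + ((R * (R + 1) * (lam ^ g * x * C) + R * (lam ^ g * x * C))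
      + ((R + 1) * (R + 1) * (lam ^ g * x * C) + (R + 1) * (lam ^ g * x * C)))) ≤ d ^ g * d ^ g * x := by
  have h1 : lam ^ g ≤ ℓ ^ g := pow_le_pow_left₀ (by linarith) hlam g
  have h4 : (K : ℝ) ^ g ≤ 2 ^ g * d ^ g := by
    rw [← mul_pow]; exact pow_le_pow_left₀ (by positivity) hK g
  calc (K : ℝ) ^ g * (2 ^ R * (lam ^ g * x * C) + ((R * (R + 1) * (lam ^ g * x * C) + R * (lam ^ g * x * C))
      + ((R + 1) * (R + 1) * (lam ^ g * x * C) + (R + 1) * (lam ^ g * x * C))))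
     = (K : ℝ) ^ g * ((2 ^ R + ((R * (R + 1) + R) + ((R + 1) * (R + 1) + (R + 1)))) * C * lam ^ g * x) := by ring
    _ ≤ (2 ^ g * d ^ g) * ((2 ^ R + ((R * (R + 1) + R) + ((R + 1) * (R + 1) + (R + 1)))) * C * ℓ ^ g * x) := by gcongr
    _ = d ^ g * (2 ^ g * ((2 ^ R + ((R * (R + 1) + R) + ((R + 1) * (R + 1) + (R + 1)))) * C) * ℓ ^ g) * x := by ring
    _ ≤ _ := by gcongr

theorem num_c {K : ℝ} {g r' k m : ℕ} {lam x ℓ A C d δ L : ℝ} (hg : 1 ≤ g) (hC : 0 < C) (hx0 : 0 < x) (hδ : 0 < δ)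
    (hℓ : 1 ≤ ℓ) (hA : 128 * 4 ^ g * C / δ ≤ A) (hA1 : 1 ≤ A) (hlam1 : 1 ≤ lam) (hlam : lam ≤ ℓ) (hlm : lam ^ m = ℓ) (hd : 0 < d) (hK : d ≤ K)
    (hr : (r' : ℝ) ≤ (k + 1) * 3 * ℓ)
    (h5 : 256 * 4 ^ g * C / δ * ℓ ^ g ≤ 1 / x)
    (h6 : 256 * 4 ^ g * (((k + 1) * 3 * g + 1) ^ g * C) / δ * ℓ ^ (2 * g) ≤ d) (hL : δ * ℓ / 2 ≤ L) :
    4 ^ g * (K * ((lam ^ m / A + lam ^ g * x) * C) + (((r' * g : ℕ) : ℝ) + 1) ^ g * (lam ^ g * C)) ≤ L * K / 32 := by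
  have h1 : lam ^ g ≤ ℓ ^ g := pow_le_pow_left₀ (by linarith) hlam g
  have hK0 : 0 < K := by linarith
  have a1 : 4 ^ g * (K * (lam ^ m / A * C)) ≤ δ * ℓ * K / 128 := by
    rw [hlm]
    have : 4 ^ g * C / A ≤ δ / 128 := by
      rw [div_le_iff₀ (by linarith)]
      rw [div_le_iff₀ hδ] at hA
      linarith
    calc 4 ^ g * (K * (ℓ / A * C)) = (4 ^ g * C / A) * (K * ℓ) := by ring
      _ ≤ δ / 128 * (K * ℓ) := by gcongr
      _ = _ := by ring
  have a2 : 4 ^ g * (K * (lam ^ g * x * C)) ≤ δ * K / 256 := by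
    have : 4 ^ g * C * ℓ ^ g * x ≤ δ / 256 := by
      rw [le_div_iff₀ hx0] at h5
      have := mul_le_mul_of_nonneg_left h5 hδ.le
      have e : δ * (256 * 4 ^ g * C / δ * ℓ ^ g * x) = 256 * (4 ^ g * C * ℓ ^ g * x) := by field_simp
      rw [e] at this; linarith
    calc 4 ^ g * (K * (lam ^ g * x * C)) ≤ 4 ^ g * (K * (ℓ ^ g * x * C)) := by gcongr
      _ = K * (4 ^ g * C * ℓ ^ g * x) := by ring
      _ ≤ K * (δ / 256) := by gcongr
      _ = _ := by ring
  have a3 : 4 ^ g * ((((r' * g : ℕ) : ℝ) + 1) ^ g * (lam ^ g * C)) ≤ δ * K / 256 := by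
    have b1 : ((r' * g : ℕ) : ℝ) + 1 ≤ ((k + 1) * 3 * g + 1) * ℓ := by
      push_cast
      have : (r' : ℝ) * g ≤ (k + 1) * 3 * ℓ * g := by gcongr
      nlinarith
    calc 4 ^ g * ((((r' * g : ℕ) : ℝ) + 1) ^ g * (lam ^ g * C)) ≤ 4 ^ g * ((((k + 1) * 3 * g + 1) * ℓ) ^ g * (ℓ ^ g * C)) := by gcongr
      _ = δ / 256 * (256 * 4 ^ g * (((k + 1) * 3 * g + 1) ^ g * C) / δ * ℓ ^ (2 * g)) := by
          rw [mul_pow, two_mul, pow_add]; field_simp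
      _ ≤ δ / 256 * d := by gcongr
      _ ≤ δ / 256 * K := by gcongr
      _ = _ := by ring
  have a4 : δ * ℓ / 2 * K / 32 ≤ L * K / 32 := by gcongr
  have a5 : δ * K ≤ δ * ℓ * K := by
    have : δ * 1 * K ≤ δ * ℓ * K := by gcongr
    linarith
  calc _ = 4 ^ g * (K * (lam ^ m / A * C)) + 4 ^ g * (K * (lam ^ g * x * C)) + 4 ^ g * ((((r' * g : ℕ) : ℝ) + 1) ^ g * (lam ^ g * C)) := by ring
    _ ≤ _ := by linarith

set_option maxHeartbeats 4000000 in
theorem params (k f g m p : ℕ) (hg : 1 ≤ g) (hm : 1 ≤ m) (hp : 1 ≤ p) : ∃ A : ℝ, 1 ≤ A ∧ ∃ N : ℕ, ∀ n : ℕ, N ≤ n →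
    ∃ (K M r r' : ℕ) (x lam Bc θc b L η : ℝ), Good n k f g m p K M r r' x lam A Bc θc b L η ∧
      (K : ℝ) * M ≤ 2 * A * ((n : ℝ) ^ (p : ℝ) / Real.log n) ^ (1 / (m : ℝ)) := by
  have hgr : (1 : ℝ) ≤ g := by exact_mod_cast hg
  have hmr : (1 : ℝ) ≤ m := by exact_mod_cast hm
  have hpr : (1 : ℝ) ≤ p := by exact_mod_cast hp
  have hC1 := C1_pos f g
  set δ : ℝ := 1 / (28 * g * m) with hδd
  have hδ : 0 < δ := by positivity
  have hδ28 : 28 * (δ * g) = 1 / m := by rw [hδd]; field_simp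
  have hδm : δ ≤ 1 / (2 * m) := by
    rw [hδd]; apply one_div_le_one_div_of_le (by positivity); nlinarith
  set r : ℕ := 2 * m * (k + 1) with hr
  set R : ℕ := 4 * r * g with hR
  set A : ℝ := 128 * 4 ^ g * C1 f g / δ + 1 with hAd
  have hA1 : 1 ≤ A := by rw [hAd]; have : 0 ≤ 128 * 4 ^ g * C1 f g / δ := by positivity
                         linarith
  refine ⟨A, hA1, ?_⟩
  have hδg : 0 < δ * g := by positivity
  have hev : ∀ᶠ n : ℕ in Filter.atTop,
      (2 ^ g * (2 ^ R * C1 f g + ((R : ℝ) + 1) * (2 * C1 f g)) * (Real.log n) ^ g ≤ (n : ℝ) ^ (δ * g)) ∧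
      (2 ^ g * ((2 ^ R + (((R : ℝ) * (R + 1) + R) + ((R + 1) * (R + 1) + (R + 1)))) * C1 f g) * (Real.log n) ^ g ≤ (n : ℝ) ^ (δ * g)) ∧
      (2 * (Real.log n) ^ 0 ≤ (n : ℝ) ^ (δ * g)) ∧
      (((4 * R : ℕ) + 16 : ℝ) * (Real.log n) ^ 0 ≤ (n : ℝ) ^ δ) ∧
      (256 * 4 ^ g * C1 f g / δ * (Real.log n) ^ g ≤ (n : ℝ) ^ (1 / (m : ℝ))) ∧
      (256 * 4 ^ g * ((((k : ℝ) + 1) * 3 * g + 1) ^ g * C1 f g) / δ * (Real.log n) ^ (2 * g) ≤ (n : ℝ) ^ δ) ∧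
      ((896 * (k : ℝ) + 1) * (Real.log n) ^ 1 ≤ (n : ℝ) ^ (δ / 2)) ∧
      (2 * (Real.log n) ^ 1 ≤ (n : ℝ) ^ (1 / (2 * (m : ℝ)))) ∧ 3 ≤ n := by
    filter_upwards [ev_log (2 ^ g * (2 ^ R * C1 f g + ((R : ℝ) + 1) * (2 * C1 f g))) g (δ * g) hδg,
      ev_log (2 ^ g * ((2 ^ R + (((R : ℝ) * (R + 1) + R) + ((R + 1) * (R + 1) + (R + 1)))) * C1 f g)) g (δ * g) hδg,
      ev_log 2 0 (δ * g) hδg, ev_log ((4 * R : ℕ) + 16 : ℝ) 0 δ hδ, ev_log (256 * 4 ^ g * C1 f g / δ) g (1 / (m : ℝ)) (by positivity),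
      ev_log (256 * 4 ^ g * ((((k : ℝ) + 1) * 3 * g + 1) ^ g * C1 f g) / δ) (2 * g) δ hδ,
      ev_log (896 * (k : ℝ) + 1) 1 (δ / 2) (by positivity), ev_log 2 1 (1 / (2 * (m : ℝ))) (by positivity), Filter.eventually_ge_atTop 3]
      with n h1 h2 h3 h4 h5 h6 h7 h8 h9
    exact ⟨h1, h2, h3, h4, h5, h6, h7, h8, h9⟩
  obtain ⟨N, hN⟩ := Filter.eventually_atTop.1 hev
  refine ⟨N, fun n hn => ?_⟩
  obtain ⟨h1, h2, h3, h4, h5, h6, h7, h8, h9⟩ := hN n hn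
  clear hev hN
  have hX3 : (3 : ℝ) ≤ n := by exact_mod_cast h9
  set X : ℝ := (n : ℝ) with hX
  have hX0 : 0 < X := by linarith
  set ℓ : ℝ := Real.log X with hℓd
  have hℓ : 1 ≤ ℓ := by
    rw [hℓd, Real.le_log_iff_exp_le hX0]
    linarith [Real.exp_one_lt_d9]
  have hℓ0 : 0 < ℓ := by linarith
  rw [pow_zero, mul_one] at h3 h4
  rw [pow_one] at h7 h8
  set d : ℝ := X ^ δ with hd
  have hd0 : 0 < d := by positivity
  have hdg : X ^ (δ * g) = d ^ g := by rw [hd, Real.rpow_mul_natCast hX0.le]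
  rw [hdg] at h1 h2 h3
  have hR0 : (0 : ℝ) ≤ ((4 * R : ℕ) : ℝ) := by positivity
  have hd16 : 16 ≤ d := by linarith
  set K : ℕ := ⌈d⌉₊ with hKd
  have hKl : d ≤ K := Nat.le_ceil d
  have hKu : (K : ℝ) ≤ 2 * d := by
    have := Nat.ceil_lt_add_one hd0.le
    linarith
  have hK0 : (0 : ℝ) < K := by linarith
  set x : ℝ := X ^ (-(1 / (m : ℝ))) with hx
  have hx0 : 0 < x := by positivity
  have hx1 : x ≤ 1 := Real.rpow_le_one_of_one_le_of_nonpos (by linarith) (by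
    have : (0 : ℝ) < 1 / m := by positivity
    linarith)
  have hxinv : 1 / x = X ^ (1 / (m : ℝ)) := by
    rw [hx, Real.rpow_neg hX0.le, one_div, inv_inv]
  have hxm : x ^ m = 1 / X := by
    rw [hx, ← Real.rpow_mul_natCast hX0.le, neg_mul, one_div_mul_cancel (by positivity), Real.rpow_neg_one, one_div]
  set lam : ℝ := ℓ ^ (1 / (m : ℝ)) with hlamd
  have hlam1 : 1 ≤ lam := Real.one_le_rpow hℓ (by positivity)
  have hlamℓ : lam ≤ ℓ := by
    calc lam ≤ ℓ ^ (1 : ℝ) := Real.rpow_le_rpow_of_exponent_le hℓ (by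
          rw [div_le_one (by positivity)]; exact hmr)
      _ = ℓ := Real.rpow_one _
  have hlm : lam ^ m = ℓ := by
    rw [hlamd, ← Real.rpow_mul_natCast hℓ0.le, one_div_mul_cancel (by positivity), Real.rpow_one]
  set τ : ℝ := (X ^ (p : ℝ) / ℓ) ^ (1 / (m : ℝ)) with hτ
  have hτ0 : 0 < τ := by positivity
  have hτe : τ * (lam * x ^ p) = 1 := by
    have e1 : x ^ p = (X ^ (p : ℝ) ) ^ (-(1 / (m : ℝ))) := by
      rw [hx, ← Real.rpow_mul_natCast hX0.le, ← Real.rpow_mul hX0.le, mul_comm]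
    have e2 : (X ^ (p : ℝ)) ^ (-(1 / (m : ℝ))) = ((X ^ (p : ℝ)) ^ (1 / (m : ℝ)))⁻¹ := Real.rpow_neg (by positivity) _
    rw [e1, e2, hτ, Real.div_rpow (by positivity) hℓ0.le]
    have : 0 < (X ^ (p : ℝ)) ^ (1 / (m : ℝ)) := by positivity
    rw [← hlamd]
    field_simp
  have hτl : X ^ (1 / (m : ℝ)) ≤ τ * ℓ := by
    -- τ = X^{p/m}/lam
    have e : x ^ p ≤ x := pow_le_of_le_one hx0.le hx1 (by omega)
    have : 1 ≤ τ * (ℓ * x) := by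
      rw [← hτe]; gcongr
    rw [← hxinv, div_le_iff₀ hx0]; linarith
  have hKτ : (K : ℝ) ≤ A * τ := by
    have e1 : d * X ^ (1 / (2 * (m : ℝ))) ≤ X ^ (1 / (m : ℝ)) := by
      rw [hd, ← Real.rpow_add hX0]
      apply Real.rpow_le_rpow_of_exponent_le (by linarith)
      have : 1 / (m : ℝ) = 1 / (2 * m) + 1 / (2 * m) := by field_simp; norm_num
      linarith
    have e2 : d * (2 * ℓ) ≤ τ * ℓ := (mul_le_mul_of_nonneg_left h8 hd0.le).trans (e1.trans hτl)
    have e3 : 2 * d ≤ τ := by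
      have : (2 * d) * ℓ ≤ τ * ℓ := by linarith
      exact le_of_mul_le_mul_right this hℓ0
    have e4 : 1 * τ ≤ A * τ := by gcongr
    linarith
  set M : ℕ := ⌈A * τ / K⌉₊ with hM
  have hMl : A * τ ≤ K * M := by
    have := Nat.le_ceil (A * τ / K)
    rw [div_le_iff₀ hK0] at this
    rw [mul_comm (K : ℝ)]; exact this
  have hMu : (K : ℝ) * M ≤ 2 * A * τ := by
    have := (Nat.ceil_lt_add_one (show 0 ≤ A * τ / K by positivity)).le
    have := mul_le_mul_of_nonneg_left this hK0.le
    have e : (K : ℝ) * (A * τ / K + 1) = A * τ + K := by field_simp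
    rw [e] at this
    linarith
  set L : ℝ := Real.log (Real.sqrt K) with hL
  have hsK : 0 < Real.sqrt K := Real.sqrt_pos.2 hK0
  have hsK2 : Real.sqrt K * Real.sqrt K = K := Real.mul_self_sqrt hK0.le
  have hLe : Real.exp L = Real.sqrt K := Real.exp_log hsK
  have hLδ : δ * ℓ / 2 ≤ L := by
    rw [hL, Real.log_sqrt hK0.le]
    have : δ * ℓ ≤ Real.log K := by
      rw [hℓd, ← Real.log_rpow hX0]
      exact Real.log_le_log hd0 hKl
    linarith
  have hL0 : 0 < L := lt_of_lt_of_le (by positivity) hLδ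
  set r' : ℕ := (k + 1) * ⌈2 * ℓ⌉₊ with hr'
  have hr'u : (r' : ℝ) ≤ (k + 1) * 3 * ℓ := by
    have : (⌈2 * ℓ⌉₊ : ℝ) ≤ 3 * ℓ := by
      have := Nat.ceil_lt_add_one (show 0 ≤ 2 * ℓ by positivity)
      linarith
    rw [hr']; push_cast
    calc ((k : ℝ) + 1) * ⌈2 * ℓ⌉₊ ≤ (k + 1) * (3 * ℓ) := by gcongr
      _ = _ := by ring
  have hhalf : (1 / 2 : ℝ) ^ r' ≤ (1 / X) ^ (k + 1) := by
    rw [hr', mul_comm, pow_mul]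
    apply pow_le_pow_left₀ (by positivity)
    have e1 : (1 / 2 : ℝ) ^ ⌈2 * ℓ⌉₊ ≤ (1 / 2 : ℝ) ^ (2 * ℓ) := by
      rw [← Real.rpow_natCast]
      exact Real.rpow_le_rpow_of_exponent_ge (by norm_num) (by norm_num) (Nat.le_ceil _)
    refine e1.trans ?_
    rw [Real.rpow_def_of_pos (by norm_num)]
    have e2 : 1 / X = Real.exp (-ℓ) := by rw [Real.exp_neg, hℓd, Real.exp_log hX0, one_div]
    rw [e2, Real.exp_le_exp, one_div, Real.log_inv]
    have hl2 : (1 / 2 : ℝ) ≤ Real.log 2 := by linarith only [Real.log_two_gt_d9]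
    have := mul_le_mul_of_nonneg_right hl2 (show 0 ≤ 2 * ℓ by positivity)
    linarith only [this]
  refine ⟨K, M, r, r', x, lam, d ^ g * d ^ g, d ^ g * d ^ g * x, L * K / 32, L, Real.exp (-L) / 8, ?_, hMu⟩
  have hdg0 : 0 < d ^ g := by positivity
  refine { hK := ?_, hM := ?_, hn := by omega, hx0 := hx0, hx1 := hx1, hxm := hxm, hlam := hlam1, hA := hA1, ht := ?_, hBc1 := ?_, hθc0 := by positivity, hBc := ?_, hθc := ?_, hun := ?_, hK4 := ?_, hb0 := by positivity, hb := ?_, hbL := by linarith, hL := hL0, hη := rfl, hKL := ?_, hE := ?_ }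
  · have : (1 : ℝ) ≤ K := by linarith
    exact_mod_cast this
  · exact Nat.ceil_pos.2 (by positivity)
  · rw [div_le_iff₀ (by positivity)]
    calc (1 : ℝ) = lam / A * x ^ p * (A * τ) := by rw [← hτe]; field_simp
      _ ≤ _ := by gcongr
  · have hone : 1 ≤ d ^ g := by linarith only [h3]
    exact one_le_mul_of_one_le_of_one_le hone hone
  · exact num_a (D' := 0) (N := 0) hg hC1 hx0 hx1 hℓ hA1 hlam1 hlamℓ hlm hd0 hKu h1
  · exact num_b hC1 hx0 hlam1 hlamℓ hd0 hKu h2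
  · have e1 : (2 * (d ^ g * d ^ g)) ^ 4 * (d ^ g * d ^ g * x) ≤ X ^ (-(1 / (2 * (m : ℝ)))) := by
      calc (2 * (d ^ g * d ^ g)) ^ 4 * (d ^ g * d ^ g * x) ≤ (d ^ g * (d ^ g * d ^ g)) ^ 4 * (d ^ g * d ^ g * x) := by gcongr
        _ = (d ^ g) ^ 14 * x := by ring
        _ = X ^ (-(1 / (2 * (m : ℝ)))) := by
            rw [← hdg, ← Real.rpow_mul_natCast hX0.le, hx, ← Real.rpow_add hX0]
            congr 1
            have : 1 / (m : ℝ) = 1 / (2 * m) + 1 / (2 * m) := by field_simp; norm_num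
            push_cast
            linarith
    have e2 : (2 * (d ^ g * d ^ g)) ^ (4 * r) * (d ^ g * d ^ g * x) ^ r ≤ (1 / X) ^ (k + 1) := by
      rw [pow_mul, ← mul_pow]
      refine (pow_le_pow_left₀ (by positivity) e1 r).trans (le_of_eq ?_)
      rw [← Real.rpow_mul_natCast hX0.le, one_div X, ← Real.rpow_neg_one, ← Real.rpow_mul_natCast hX0.le, hr]
      congr 1
      push_cast
      field_simp
    calc X ^ k * ((2 * (d ^ g * d ^ g)) ^ (4 * r) * (d ^ g * d ^ g * x) ^ r + (1 / 2) ^ r')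
        ≤ X ^ k * ((1 / X) ^ (k + 1) + (1 / X) ^ (k + 1)) := by gcongr
      _ = 2 / X := by rw [pow_succ, one_div, inv_pow]; field_simp; norm_num
      _ < 1 := by rw [div_lt_one hX0]; linarith
  · have : ((4 * R : ℕ) : ℝ) ≤ K := by linarith
    exact_mod_cast this
  · exact num_c (d := d) hg hC1 hx0 hδ hℓ (by rw [hAd]; linarith) hA1 hlam1 hlamℓ hlm hd0 hKl hr'u (by rw [hxinv]; exact h5) h6 hLδ
  · rw [hLe, div_le_iff₀ hK0]
    have : 4 ≤ Real.sqrt K := by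
      apply Real.le_sqrt_of_sq_le; linarith only [hKl, hd16]
    have := mul_le_mul_of_nonneg_right this hsK.le
    linarith only [this, hsK2]
  · have e1 : Real.exp (-L) / 8 * K = Real.sqrt K / 8 := by
      rw [Real.exp_neg, hLe]
      nth_rewrite 2 [← hsK2]
      field_simp
    have e2 : X ^ k = Real.exp (k * ℓ) := by
      rw [mul_comm, Real.exp_mul, hℓd, Real.exp_log hX0, Real.rpow_natCast]
    rw [e1, e2, ← Real.exp_add, Real.exp_lt_exp]
    have e3 : X ^ (δ / 2) ≤ Real.sqrt K := by
      apply Real.le_sqrt_of_sq_le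
      rw [← Real.rpow_mul_natCast hX0.le]
      convert hKl using 1
      rw [hd]; congr 1; push_cast; ring
    have e4 : (896 * (k : ℝ) + 1) * ℓ ≤ Real.sqrt K := h7.trans e3
    have : 0 ≤ (k : ℝ) * ℓ := by positivity
    linarith only [this, e4, hℓ0, hsK]

theorem stmt14 (k f q : ℕ) (hk : 2 ≤ k) (Fe : Finset (Finset (Fin f)))
    (hFk : ∀ e ∈ Fe, e.card = k) (hf : k < f) (hq : 1 ≤ q) (hqE : q ≤ Fe.card)
    (hnd : ¬ ((Fe.card - q + 1) ∣ (f - k))) :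
    ∃ C : ℝ, 0 < C ∧ ∃ N : ℕ, ∀ n : ℕ, N ≤ n →
      ∀ G : Finset (Finset (Fin n)), (∀ e ∈ G, e.card = k) →
      (listRamseyF Fe q n G : ℝ) ≤
        C * ((n : ℝ) ^ (((f : ℝ) - k)) / Real.log n) ^ (1 / ((Fe.card : ℝ) - q + 1)) := by
  obtain ⟨A, hA, N, hN⟩ := params k f Fe.card (Fe.card - q + 1) (f - k) (by omega) (by omega) (by omega)
  refine ⟨2 * A, by linarith, N, fun n hn G hG => ?_⟩
  obtain ⟨K, M, r, r', x, lam, Bc, θc, b, L, η, H, hle⟩ := hN n hn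
  have h1 := ramsey_le k f q Fe hf hq hqE hnd n G hG H
  have h2 : (listRamseyF Fe q n G : ℝ) ≤ (K : ℝ) * M := by exact_mod_cast h1
  refine h2.trans (hle.trans (le_of_eq ?_))
  rw [Nat.cast_sub hf.le, Nat.cast_add, Nat.cast_sub hqE, Nat.cast_one]
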